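/- Fix an integer d ≥ 2, δ ∈ (0,1), K > 0, and p ∈ (2,∞). Let a^{jk}, b^j, c : ℝ^{d+1} → ℝ be measurable with a^{jk} = a^{kj}, |b^j| ≤ K, |c| ≤ K, and δ|θ|² ≤ Σ_{j,k=1}^d a^{jk}(t,x) θ^j θ^k ≤ δ⁻¹|θ|² for all (t,x) and θ ∈ ℝ^d; suppose there is a continuous function ω on [0,∞) with ω(0) = 0 and a_R^# ≤ ω(R) for all R ∈ [0,∞). Set Lu = u_t + Σ_{j,k} a^{jk} u_{x^j x^k} + Σ_j b^j u_{x^j} + c u. Let T ∈ (0,∞]. Then there exist λ₀ = λ₀(d,δ,K,p,ω) ≥ 0 and N = N(d,δ,K,p,ω), both independent of T, such that for all λ ≥ λ₀ and all smooth compactly supported u : ℝ^{d+1} → ℝ with u(t,x) = 0 whenever t ≥ T: λ ‖u‖_{L_p(Ω_T)} + ‖u_{xx}‖_{L_p(Ω_T)} + ‖u_t‖_{L_p(Ω_T)} ≤ N ‖Lu − λu‖_{L_p(Ω_T)}. -/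

import Mathlib

open MeasureTheory ENNReal

/-- Partial derivative in `t`. -/
noncomputable def pdt {d : ℕ} (u : ℝ × (Fin d → ℝ) → ℝ) : ℝ × (Fin d → ℝ) → ℝ :=
  fun p => fderiv ℝ u p (1, 0)

/-- Partial derivative in `x^j`. -/
noncomputable def pdx {d : ℕ} (j : Fin d) (u : ℝ × (Fin d → ℝ) → ℝ) :
    ℝ × (Fin d → ℝ) → ℝ :=
  fun p => fderiv ℝ u p (0, Pi.single j 1)

/-- Second partial derivative in `x^j, x^k`. -/
noncomputable def pdxx {d : ℕ} (j k : Fin d) (u : ℝ × (Fin d → ℝ) → ℝ) :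
    ℝ × (Fin d → ℝ) → ℝ :=
  pdx j (pdx k u)

/-- Open Euclidean ball of radius `r` about `x` in `ℝ^d`. -/
def ballC {d : ℕ} (r : ℝ) (x : Fin d → ℝ) : Set (Fin d → ℝ) :=
  {y | ∑ j, (y j - x j) ^ 2 < r ^ 2}

/-- `Γ_r(t,x') = (t,t+r²) × B'_r(x') ⊂ ℝ × ℝ^{d-1}` (here `d-1 = n`). -/
def GammaC {n : ℕ} (r : ℝ) (t : ℝ) (x' : Fin n → ℝ) : Set (ℝ × (Fin n → ℝ)) :=
  Set.Ioo t (t + r ^ 2) ×ˢ ballC r x'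

/-- `osc_{(t,x')}(a, Λ_r(t,x))`. -/
noncomputable def oscA {n : ℕ}
    (a : ℝ × (Fin (n + 1) → ℝ) → Fin (n + 1) → Fin (n + 1) → ℝ)
    (r : ℝ) (t : ℝ) (x : Fin (n + 1) → ℝ) : ℝ :=
  (r ^ 5)⁻¹ * (((volume (ballC r (0 : Fin n → ℝ))).toReal) ^ 2)⁻¹ *
    ∫ τ in Set.Ioo (x 0 - r) (x 0 + r),
      ∫ s₁ in GammaC r t (fun j : Fin n => x j.succ),
        ∫ s₂ in GammaC r t (fun j : Fin n => x j.succ),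
          ⨆ j, ⨆ k,
            |a (s₁.1, Fin.cons τ s₁.2) j k - a (s₂.1, Fin.cons τ s₂.2) j k|

/-- `a_R^# = sup_{(t,x)} sup_{0 < r ≤ R} osc_{(t,x')}(a, Λ_r(t,x))`. -/
noncomputable def aSharp {n : ℕ}
    (a : ℝ × (Fin (n + 1) → ℝ) → Fin (n + 1) → Fin (n + 1) → ℝ) (R : ℝ) : ℝ :=
  ⨆ z : ℝ × (Fin (n + 1) → ℝ), ⨆ r : {r : ℝ // 0 < r ∧ r ≤ R},
    oscA a r.val z.1 z.2

/-- `Ω_T = (0,T) × ℝ^d` for `T ∈ (0,∞]`. -/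
def OmegaT (d : ℕ) (T : ℝ≥0∞) : Set (ℝ × (Fin d → ℝ)) :=
  {q | 0 < q.1 ∧ ENNReal.ofReal q.1 < T}

/-- `L_p(Ω)` norm on a set `Ω` (real exponent `p`). -/
noncomputable def LpNormOn {d : ℕ} (p : ℝ) (s : Set (ℝ × (Fin d → ℝ)))
    (f : ℝ × (Fin d → ℝ) → ℝ) : ℝ :=
  (∫ q in s, |f q| ^ p) ^ (1 / p)

notation:max "Ix" n:max => Fin (n + 1)
notation:max "Mx" n:max => (Fin (n + 1) → Fin (n + 1) → ℝ)
notation "oR" => ENNReal.ofReal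
notation:max "Fu" n:max => (ℝ × (Fin (n + 1) → ℝ) → ℝ)
notation "I01" => (Set.Ioc (0:ℝ) 1)
notation "CD" => ContDiff ℝ (⊤ : ℕ∞)

section

abbrev E (n : ℕ) := ℝ × (Ix n → ℝ)

noncomputable def D {n : ℕ} (v : E n) (u : Fu n) : E n → ℝ := fun p => fderiv ℝ u p v

def et {n : ℕ} : E n := (1, 0)
def ex {n : ℕ} (j : Ix n) : E n := (0, Pi.single j 1)

notation:max "Dd" j:max k:max u:max => D (ex j) (D (ex k) u)

def Hs {n : ℕ} (τ : ℝ) : Set (E n) := {p | τ < p.1}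

def Sm {n : ℕ} (u : Fu n) : Prop := CD u

structure TF {n : ℕ} (u : Fu n) : Prop where
  sm : Sm u
  cs : HasCompactSupport u

variable {n : ℕ}

instance : (volume : Measure (E n)).IsAddHaarMeasure := by
  rw [Measure.volume_eq_prod]; infer_instance

theorem measurableSet_Hs (τ : ℝ) : MeasurableSet (Hs (n := n) τ) :=
  measurableSet_lt measurable_const measurable_fst

namespace Sm
variable {u w : Fu n}
theorem cont (h : Sm u) : Continuous u := h.continuous
theorem diff (h : Sm u) (p : E n) : DifferentiableAt ℝ u p :=
  h.differentiable (by simp) p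
theorem D (h : Sm u) (v : E n) : Sm (D v u) := by
  unfold Sm _root_.D
  exact (h.fderiv_right (m := (⊤ : ℕ∞)) (by simp)).clm_apply contDiff_const
theorem add (h : Sm u) (h' : Sm w) : Sm (fun p => u p + w p) := ContDiff.add h h'
theorem sub (h : Sm u) (h' : Sm w) : Sm (fun p => u p - w p) := ContDiff.sub h h'
theorem mul (h : Sm u) (h' : Sm w) : Sm (fun p => u p * w p) := ContDiff.mul h h'
theorem const (c : ℝ) : Sm (fun _ : E n => c) := contDiff_const
theorem comp0 {m : ℝ → ℝ} (hm : CD m) : Sm (fun p : E n => m (p.2 0)) :=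
  hm.comp (by fun_prop)
theorem sum {ι : Type*} {s : Finset ι} {f : ι → E n → ℝ} (h : ∀ i ∈ s, Sm (f i)) :
    Sm (fun p => ∑ i ∈ s, f i p) := ContDiff.sum h
end Sm

theorem D_add {u w : Fu n} (h : Sm u) (h' : Sm w) (v : E n) :
    D v (fun p => u p + w p) = fun p => D v u p + D v w p := by
  funext p; simp only [D]; rw [fderiv_fun_add (h.diff p) (h'.diff p)]; rfl
theorem D_sub {u w : Fu n} (h : Sm u) (h' : Sm w) (v : E n) :
    D v (fun p => u p - w p) = fun p => D v u p - D v w p := by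
  funext p; simp only [D]; rw [fderiv_fun_sub (h.diff p) (h'.diff p)]; rfl
theorem D_mul {u w : Fu n} (h : Sm u) (h' : Sm w) (v : E n) :
    D v (fun p => u p * w p) = fun p => D v u p * w p + u p * D v w p := by
  funext p; simp only [D]; rw [fderiv_fun_mul (h.diff p) (h'.diff p)]
  simp; ring
theorem D_const (c : ℝ) (v : E n) : D v (fun _ => c) = fun _ => 0 := by
  funext p; simp [D]
theorem D_cmul {u : Fu n} (h : Sm u) (c : ℝ) (v : E n) :
    D v (fun p => c * u p) = fun p => c * D v u p := by
  rw [D_mul (Sm.const c) h, D_const]; simp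
theorem D_sum {ι : Type*} {s : Finset ι} {f : ι → E n → ℝ} (h : ∀ i ∈ s, Sm (f i)) (v : E n) :
    D v (fun p => ∑ i ∈ s, f i p) = fun p => ∑ i ∈ s, D v (f i) p := by
  funext p; simp only [D]; rw [fderiv_fun_sum (fun i hi => (h i hi).diff p)]; simp
theorem D_comm {u : Fu n} (h : Sm u) (v w : E n) : D v (D w u) = D w (D v u) := by
  funext p
  have key : ∀ a b : E n, D a (D b u) p = fderiv ℝ (fderiv ℝ u) p a b := by
    intro a b
    have hd : DifferentiableAt ℝ (fderiv ℝ u) p :=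
      (h.fderiv_right (m := (⊤ : ℕ∞)) (by simp)).differentiable (by simp) p
    change fderiv ℝ (fun q => fderiv ℝ u q b) p a = _
    rw [fderiv_clm_apply hd (differentiableAt_const b)]
    simp
  rw [key, key]
  have := (ContDiffAt.isSymmSndFDerivAt (h.contDiffAt (x := p)) (by simp; exact WithTop.coe_le_coe.2 le_top))
  exact this v w
theorem D_comp0 {m : ℝ → ℝ} (hm : CD m) {v : E n} (hv : v.2 0 = 0) :
    D v (fun p : E n => m (p.2 0)) = fun _ => 0 := by
  funext p
  simp only [D]
  have hl : HasFDerivAt (fun p : E n => p.2 0)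
      ((ContinuousLinearMap.proj (R := ℝ) (φ := fun _ : Ix n => ℝ) 0).comp
        (ContinuousLinearMap.snd ℝ ℝ (Ix n → ℝ))) p :=
    ((ContinuousLinearMap.proj (R := ℝ) (φ := fun _ : Ix n => ℝ) 0).comp
        (ContinuousLinearMap.snd ℝ ℝ (Ix n → ℝ))).hasFDerivAt
  have := (hm.differentiable (by simp) (p.2 0)).hasDerivAt.comp_hasFDerivAt p hl
  have h2 := this.fderiv
  simp only [Function.comp_def] at h2
  rw [h2]; simp [hv]

namespace TF
variable {u w : Fu n}
theorem D (h : TF u) (v : E n) : TF (D v u) :=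
  ⟨h.sm.D v, h.cs.fderiv_apply (𝕜 := ℝ) v⟩
theorem add (h : TF u) (h' : TF w) : TF (fun p => u p + w p) := ⟨h.sm.add h'.sm, h.cs.add h'.cs⟩
theorem mul_left (h : Sm u) (h' : TF w) : TF (fun p => u p * w p) := ⟨h.mul h'.sm, h'.cs.mul_left⟩
theorem mul_right (h : TF u) (h' : Sm w) : TF (fun p => u p * w p) := ⟨h.sm.mul h', h.cs.mul_right⟩
theorem mul (h : TF u) (h' : TF w) : TF (fun p => u p * w p) := h.mul_right h'.sm
theorem cmul (h : TF u) (c : ℝ) : TF (fun p => c * u p) := mul_left (Sm.const c) h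
theorem sub (h : TF u) (h' : TF w) : TF (fun p => u p - w p) := by
  have := h.add (h'.cmul (-1))
  simpa [sub_eq_add_neg] using this
theorem zero : TF (fun _ : E n => (0:ℝ)) := ⟨Sm.const 0, HasCompactSupport.zero⟩
theorem sum {ι : Type*} {s : Finset ι} {f : ι → E n → ℝ} (h : ∀ i ∈ s, TF (f i)) :
    TF (fun p => ∑ i ∈ s, f i p) := by
  classical
  induction s using Finset.induction_on with
  | empty => simpa using zero
  | insert a s ha ih =>
    simp only [Finset.sum_insert ha]
    exact (h a (by simp)).add (ih fun i hi => h i (by simp [hi]))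
theorem cont (h : TF u) : Continuous u := h.sm.cont
theorem int (h : TF u) {s : Set (E n)} : IntegrableOn u s :=
  (h.cont.integrable_of_hasCompactSupport h.cs).integrableOn
theorem sq (h : TF u) : TF (fun p => u p ^ 2) := by
  have := h.mul h; simpa [pow_two] using this
end TF

theorem ibp_x0 {φ : Fu n} (h : TF φ) {v : E n} (hv : v.1 = 0) (τ : ℝ) :
    ∫ p in Hs τ, D v φ p = 0 := by
  have hi : Integrable (Set.indicator (Hs τ) (D v φ)) :=
    (integrable_indicator_iff (measurableSet_Hs τ)).2 (h.D v).int
  have hi2 : Integrable (Set.indicator (Hs τ) φ) :=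
    (integrable_indicator_iff (measurableSet_Hs τ)).2 h.int
  have key := integral_bilinear_hasLineDerivAt_right_eq_neg_left_of_integrable
    (μ := (volume : Measure (E n))) (f := fun p => Set.indicator (Hs τ) (fun _ => (1:ℝ)) p)
    (f' := fun _ => 0) (g := φ) (g' := D v φ) (B := ContinuousLinearMap.mul ℝ ℝ) (v := v)
    (by simp) ?_ ?_ ?_ ?_
  · rw [← integral_indicator (measurableSet_Hs τ)]
    simp only [ContinuousLinearMap.mul_apply', zero_mul, integral_zero, neg_zero] at key
    rw [← key]; congr 1; funext p
    by_cases hp : p ∈ Hs τ <;> simp [hp]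
  · convert hi using 2 with p
    by_cases hp : p ∈ Hs τ <;> simp [hp]
  · convert hi2 using 2 with p
    by_cases hp : p ∈ Hs τ <;> simp [hp]
  · intro p _
    have : (fun t : ℝ => Set.indicator (Hs τ) (fun _ => (1:ℝ)) (p + t • v)) =
        fun _ => Set.indicator (Hs τ) (fun _ => (1:ℝ)) p := by
      funext t
      have : (p + t • v ∈ Hs τ) ↔ p ∈ Hs τ := by simp [Hs, hv]
      by_cases hp : p ∈ Hs τ
      · simp [hp, this.2 hp]
      · simp [hp, mt this.1 hp]
    unfold HasLineDerivAt
    rw [this]; exact hasDerivAt_const _ _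
  · intro p _
    exact (h.sm.diff p).hasFDerivAt.hasLineDerivAt v

theorem ibp_x {g w m : Fu n} (hm : Sm m) (hg : TF g) (hw : TF w) {v : E n} (hv : v.1 = 0)
    (hmv : ∀ p, D v m p = 0) (τ : ℝ) :
    ∫ p in Hs τ, m p * D v g p * w p = - ∫ p in Hs τ, m p * g p * D v w p := by
  have h1 := ibp_x0 (φ := fun p => m p * (g p * w p)) (TF.mul_left hm (hg.mul hw)) hv τ
  rw [D_mul hm (hg.sm.mul hw.sm), D_mul hg.sm hw.sm] at h1
  have e : ∀ p, D v m p * (g p * w p) + m p * (D v g p * w p + g p * D v w p)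
      = m p * D v g p * w p + m p * g p * D v w p := by intro p; rw [hmv]; ring
  simp only [e] at h1
  rw [integral_add] at h1
  · linarith
  · exact ((TF.mul_left hm (hg.D v)).mul hw).int
  · exact ((TF.mul_left hm hg).mul (hw.D v)).int

theorem ibp_t {φ : Fu n} (h : TF φ) (τ : ℝ) :
    ∫ p in Hs τ, D et φ p = - ∫ x, φ (τ, x) := by
  have hs : (Hs τ : Set (E n)) = Set.Ioi τ ×ˢ Set.univ := by ext p; simp [Hs]
  have hi : IntegrableOn (D et φ) (Set.Ioi τ ×ˢ (Set.univ : Set (Ix n → ℝ))) := (h.D et).int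
  rw [hs, Measure.volume_eq_prod, ← Measure.prod_restrict, integral_prod_symm]
  · rw [Measure.restrict_univ, ← integral_neg]
    congr 1; funext x
    have hc : HasCompactSupport (fun t : ℝ => φ (t, x)) :=
      h.cs.comp_isClosedEmbedding (g := fun t : ℝ => (t, x)) ⟨isEmbedding_prodMkLeft x, by
        have : Set.range (fun t : ℝ => (t, x)) = Set.univ ×ˢ {x} := by
          ext p; constructor
          · rintro ⟨t, rfl⟩; simp
          · rintro ⟨_, hp⟩; exact ⟨p.1, by ext <;> simp_all⟩
        rw [this]; exact isClosed_univ.prod isClosed_singleton⟩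
    have hd : ∀ t, HasDerivAt (fun t : ℝ => φ (t, x)) (D et φ (t, x)) t := by
      intro t
      have h1 : HasDerivAt (fun t : ℝ => ((t, x) : E n)) (et : E n) t :=
        (hasDerivAt_id t).prodMk (hasDerivAt_const t x)
      exact (h.sm.diff (t, x)).hasFDerivAt.comp_hasDerivAt t h1
    have hc1 : ContDiff ℝ 1 (fun t : ℝ => φ (t, x)) :=
      (h.sm.of_le (by simp)).comp (by fun_prop)
    have := HasCompactSupport.integral_Ioi_deriv_eq hc1 hc τ
    rw [← this]
    congr 1; funext t; exact (hd t).deriv.symm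
  · rw [Measure.prod_restrict, ← Measure.volume_eq_prod]; exact hi

theorem ibp_t_le {φ : Fu n} (h : TF φ) (h0 : ∀ p, 0 ≤ φ p) (τ : ℝ) :
    ∫ p in Hs τ, D et φ p ≤ 0 := by
  rw [ibp_t h]; 
  have : 0 ≤ ∫ x, φ (τ, x) := integral_nonneg (fun x => h0 (τ, x))
  linarith

theorem ibp_t_sq {g m : Fu n} (hm : Sm m) (hm0 : ∀ p, 0 ≤ m p) (hmt : ∀ p, D et m p = 0)
    (hg : TF g) (τ : ℝ) : ∫ p in Hs τ, m p * g p * D et g p ≤ 0 := by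
  have h1 := ibp_t_le (φ := fun p => m p * (g p * g p)) (TF.mul_left hm (hg.mul hg))
    (fun p => mul_nonneg (hm0 p) (mul_self_nonneg _)) τ
  rw [D_mul hm (hg.sm.mul hg.sm), D_mul hg.sm hg.sm] at h1
  have e : ∀ p, D et m p * (g p * g p) + m p * (D et g p * g p + g p * D et g p)
      = 2 * (m p * g p * D et g p) := by intro p; rw [hmt]; ring
  simp only [e] at h1
  rw [integral_const_mul] at h1; linarith

end

section

structure Ell {n : ℕ} (δ : ℝ) (A : Mx n) : Prop where
  symm : ∀ j k, A j k = A k j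
  lo : ∀ θ : Ix n → ℝ, δ * ∑ j, (θ j) ^ 2 ≤ ∑ j, ∑ k, A j k * θ j * θ k
  hi : ∀ θ : Ix n → ℝ, ∑ j, ∑ k, A j k * θ j * θ k ≤ δ⁻¹ * ∑ j, (θ j) ^ 2

noncomputable def Pop {n : ℕ} (A : ℝ → Mx n) (u : Fu n) :
    E n → ℝ :=
  fun p => D et u p + (∑ j, ∑ k, A (p.2 0) j k * Dd j k u p)

structure SmEll {n : ℕ} (δ : ℝ) (A : ℝ → Mx n) : Prop where
  sm : ∀ j k, CD (fun s => A s j k)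
  ell : ∀ s, Ell δ (A s)

variable {n : ℕ}

theorem Ell.diag {δ : ℝ} {A : Mx n} (h : Ell δ A) (j : Ix n) :
    δ ≤ A j j ∧ A j j ≤ δ⁻¹ := by
  have h1 := h.lo (Pi.single j 1)
  have h2 := h.hi (Pi.single j 1)
  simp [Pi.single_apply] at h1 h2
  exact ⟨h1, h2⟩

theorem Ell.bdd {δ : ℝ} (hδ : 0 < δ) {A : Mx n} (h : Ell δ A)
    (j k : Ix n) : |A j k| ≤ δ⁻¹ := by
  by_cases hjk : j = k
  · subst hjk; rw [abs_of_nonneg (by linarith [(h.diag j).1])]; exact (h.diag j).2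
  have expand : ∀ c : ℝ, c ^ 2 = 1 → A j j + A k k + 2 * c * A j k ≤ 2 * δ⁻¹ := by
    intro c hc
    have h2 := h.hi (Pi.single j 1 + Pi.single k c)
    have e1 : ∀ i, ((Pi.single j 1 + Pi.single k c : Ix n → ℝ) i) =
      (if i = j then 1 else 0) + (if i = k then c else 0) := by intro i; simp [Pi.single_apply]
    simp only [e1] at h2
    have e2 : ∑ i, ((if i = j then (1:ℝ) else 0) + (if i = k then c else 0)) ^ 2 = 2 := by
      have : ∀ i, ((if i = j then (1:ℝ) else 0) + (if i = k then c else 0)) ^ 2 =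
        (if i = j then (1:ℝ) else 0) + (if i = k then 1 else 0) := by
        intro i
        by_cases h1 : i = j <;> by_cases h3 : i = k
        · exact absurd (h1.symm.trans h3) hjk
        all_goals simp [h1, h3, hc]
        · subst h1; simp [hjk]
        · subst h3; simp [h1, hc]
      simp only [this, Finset.sum_add_distrib]; simp; norm_num
    rw [e2] at h2
    simp only [mul_add, add_mul, mul_ite, ite_mul, mul_zero, zero_mul, mul_one,
      Finset.sum_add_distrib, Finset.sum_ite_eq', Finset.mem_univ, if_true] at h2
    have h3 : A k k * c * c = A k k := by rw [mul_assoc, ← pow_two, hc, mul_one]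
    rw [← h.symm j k, h3] at h2
    linarith
  have a1 := expand 1 (by norm_num)
  have a2 := expand (-1) (by norm_num)
  have d1 := (h.diag j).1
  have d2 := (h.diag k).1
  rw [abs_le]; constructor <;> linarith

theorem Sm.Pop {δ : ℝ} {A : ℝ → Mx n} (hA : SmEll δ A) {u : Fu n}
    (hu : Sm u) : Sm (Pop A u) :=
  (hu.D et).add (Sm.sum fun j _ => Sm.sum fun k _ =>
    (Sm.comp0 (hA.sm j k)).mul ((hu.D (ex k)).D (ex j)))

theorem TF.Pop {δ : ℝ} {A : ℝ → Mx n} (hA : SmEll δ A) {u : Fu n}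
    (hu : TF u) : TF (Pop A u) :=
  (hu.D et).add (TF.sum fun j _ => TF.sum fun k _ =>
    TF.mul_left (Sm.comp0 (hA.sm j k)) ((hu.D (ex k)).D (ex j)))

theorem int_mono {f g : Fu n} (hf : TF f) (hg : TF g) (h : ∀ p, f p ≤ g p) (τ : ℝ) :
    ∫ p in Hs τ, f p ≤ ∫ p in Hs τ, g p := integral_mono hf.int hg.int h

theorem rho_sm {δ : ℝ} (hδ : 0 < δ) {A : ℝ → Mx n} (hA : SmEll δ A) :
    CD (fun s => (A s 0 0)⁻¹) :=
  (hA.sm 0 0).inv fun s => by linarith [((hA.ell s).diag 0).1]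

theorem rho_bd {δ : ℝ} (hδ : 0 < δ) {A : ℝ → Mx n} (hA : SmEll δ A)
    (s : ℝ) : δ ≤ (A s 0 0)⁻¹ ∧ (A s 0 0)⁻¹ ≤ δ⁻¹ := by
  have h := (hA.ell s).diag 0
  constructor
  · rw [le_inv_comm₀ hδ (by linarith)]; exact h.2
  · exact inv_anti₀ hδ h.1

theorem L2_tang {δ : ℝ} (hδ : 0 < δ) {A : ℝ → Mx n}
    (hA : SmEll δ A) {u : Fu n} (hu : TF u) (τ : ℝ) {k : Ix n} (hk : k ≠ 0) :
    ∫ p in Hs τ, ∑ j, (Dd j k u p) ^ 2 ≤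
      (δ ^ 6)⁻¹ * ∫ p in Hs τ, (Pop A u p) ^ 2 := by
  set ρ : E n → ℝ := fun p => (A (p.2 0) 0 0)⁻¹ with hρ
  have sρ : Sm ρ := Sm.comp0 (rho_sm hδ hA)
  have hv : ∀ i : Ix n, i ≠ 0 → (ex i : E n).2 0 = 0 := by
    intro i hi; simp [ex, hi.symm]
  have hv1 : ∀ i : Ix n, (ex i : E n).1 = 0 := fun i => rfl
  have Dρ : ∀ v : E n, v.2 0 = 0 → ∀ p, D v ρ p = 0 := by
    intro v h p; rw [hρ, D_comp0 (rho_sm hδ hA) h]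
  have Hρ : ∀ p, δ ≤ ρ p ∧ ρ p ≤ δ⁻¹ := fun p => rho_bd hδ hA (p.2 0)
  set f := Pop A u with hf
  have tf : TF f := hu.Pop hA
  set m : Ix n → Ix n → E n → ℝ := fun j l p => (A (p.2 0) 0 0)⁻¹ * A (p.2 0) j l with hm
  have sm0 : ∀ j l, CD (fun s => (A s 0 0)⁻¹ * A s j l) :=
    fun j l => (rho_sm hδ hA).mul (hA.sm j l)
  have sm : ∀ j l, Sm (m j l) := fun j l => Sm.comp0 (sm0 j l)
  have Dm : ∀ j l, ∀ v : E n, v.2 0 = 0 → ∀ p, D v (m j l) p = 0 := by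
    intro j l v h p; simp only [hm]; rw [D_comp0 (sm0 j l) h]
  have Dm0 : ∀ v : E n, ∀ p, D v (m 0 0) p = 0 := by
    intro v p
    have : m 0 0 = fun _ => 1 := by
      funext q; simp only [hm]
      exact inv_mul_cancel₀ (by linarith [((hA.ell (q.2 0)).diag 0).1])
    rw [this, D_const]
  have tk : TF (D (ex k) u) := hu.D _
  have C3 : ∀ j l, D (ex k) (Dd j l u) = D (ex l) (Dd j k u) := by
    intro j l
    rw [D_comm (hu.D (ex l)).sm (ex k) (ex j), D_comm hu.sm (ex k) (ex l),
      D_comm (hu.D (ex k)).sm (ex j) (ex l)]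
  have key : ∀ j l, ∫ p in Hs τ, m j l p * Dd j l u p * Dd k k u p =
      ∫ p in Hs τ, m j l p * Dd j k u p * Dd l k u p := by
    have main : ∀ j l, (∀ p, D (ex l) (m j l) p = 0) →
      ∫ p in Hs τ, m j l p * Dd j l u p * Dd k k u p =
      ∫ p in Hs τ, m j l p * Dd j k u p * Dd l k u p := by
      intro j l h
      have h1 := ibp_x (sm j l) ((hu.D (ex l)).D (ex j)) tk (hv1 k) (Dm j l _ (hv k hk)) τ
      have h2 := ibp_x (sm j l) (tk.D (ex j)) tk (hv1 l) h τ
      rw [← C3] at h2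
      linarith
    intro j l
    by_cases hl0 : l = 0
    · by_cases hj0 : j = 0
      · subst hl0; subst hj0; exact main 0 0 (Dm0 _)
      · have h2 := main l j (Dm l j _ (hv j hj0))
        have e : m l j = m j l := by funext p; simp only [hm]; rw [(hA.ell (p.2 0)).symm l j]
        rw [e, D_comm hu.sm] at h2
        rw [h2]; congr 1; funext p; ring
    · exact main j l (Dm j l _ (hv l hl0))
  have k1 : 0 ≤ ∫ p in Hs τ, ρ p * D et u p * Dd k k u p := by
    have h1 := ibp_x sρ (hu.D et) tk (hv1 k) (Dρ _ (hv k hk)) τ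
    have h2 := ibp_t_sq sρ (fun p => by linarith [(Hρ p).1]) (Dρ _ (by simp [et])) tk τ
    rw [D_comm hu.sm] at h1
    have e : ∀ p, ρ p * D et (D (ex k) u) p * D (ex k) u p =
      ρ p * D (ex k) u p * D et (D (ex k) u) p := fun p => by ring
    simp only [e] at h1
    linarith
  have tt : ∀ j l, TF (fun p => m j l p * Dd j l u p * Dd k k u p) :=
    fun j l => (TF.mul_left (sm j l) ((hu.D _).D _)).mul (tk.D _)
  have tt2 : ∀ j l, TF (fun p => m j l p * Dd j k u p * Dd l k u p) :=
    fun j l => (TF.mul_left (sm j l) ((hu.D _).D _)).mul (tk.D _)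
  have split : ∫ p in Hs τ, ρ p * f p * Dd k k u p =
      (∫ p in Hs τ, ρ p * D et u p * Dd k k u p) +
      (∫ p in Hs τ, ∑ j, ∑ l, m j l p * Dd j k u p * Dd l k u p) := by
    have e : ∫ p in Hs τ, ∑ j, ∑ l, m j l p * Dd j k u p * Dd l k u p =
      ∫ p in Hs τ, ∑ j, ∑ l, m j l p * Dd j l u p * Dd k k u p := by
      rw [integral_finsetSum _ fun j _ => (TF.sum fun l _ => tt2 j l).int,
        integral_finsetSum _ fun j _ => (TF.sum fun l _ => tt j l).int]
      refine Finset.sum_congr rfl fun j _ => ?_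
      rw [integral_finsetSum _ fun l _ => (tt2 j l).int, integral_finsetSum _ fun l _ => (tt j l).int]
      exact Finset.sum_congr rfl fun l _ => (key j l).symm
    rw [e, ← integral_add]
    · congr 1; funext p
      simp only [hf, _root_.Pop, hm, hρ, Finset.mul_sum, Finset.sum_mul, mul_add, add_mul]
      congr 1
      refine Finset.sum_congr rfl fun j _ => Finset.sum_congr rfl fun l _ => ?_
      ring
    · exact ((TF.mul_left sρ (hu.D _)).mul (tk.D _)).int
    · exact (TF.sum fun j _ => TF.sum fun l _ => tt j l).int
  have tS : TF (fun p => ∑ j, (Dd j k u p) ^ 2) := TF.sum fun j _ => (tk.D _).sq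
  have low : δ ^ 2 * ∫ p in Hs τ, ∑ j, (Dd j k u p) ^ 2 ≤
      ∫ p in Hs τ, ∑ j, ∑ l, m j l p * Dd j k u p * Dd l k u p := by
    rw [← integral_const_mul]
    refine int_mono (tS.cmul _) (TF.sum fun j _ => TF.sum fun l _ => tt2 j l) ?_ τ
    intro p
    have h1 := (hA.ell (p.2 0)).lo (fun j => Dd j k u p)
    have h2 : ∑ j, ∑ l, m j l p * Dd j k u p * Dd l k u p =
      ρ p * ∑ j, ∑ l, A (p.2 0) j l * Dd j k u p * Dd l k u p := by
      simp only [Finset.mul_sum, hm, hρ]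
      refine Finset.sum_congr rfl fun j _ => Finset.sum_congr rfl fun l _ => ?_
      ring
    rw [h2]
    have h3 : 0 ≤ ∑ j, (Dd j k u p) ^ 2 := Finset.sum_nonneg fun _ _ => sq_nonneg _
    calc _ = δ * (δ * ∑ j, (Dd j k u p) ^ 2) := by ring
      _ ≤ ρ p * (δ * ∑ j, (Dd j k u p) ^ 2) :=
        mul_le_mul_of_nonneg_right (Hρ p).1 (by positivity)
      _ ≤ _ := mul_le_mul_of_nonneg_left h1 (by linarith [(Hρ p).1])
  have up : ∫ p in Hs τ, ρ p * f p * Dd k k u p ≤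
      δ ^ 2 / 2 * (∫ p in Hs τ, ∑ j, (Dd j k u p) ^ 2) +
      (2 * δ ^ 4)⁻¹ * ∫ p in Hs τ, f p ^ 2 := by
    rw [← integral_const_mul, ← integral_const_mul, ← integral_add (tS.cmul _).int (tf.sq.cmul _).int]
    refine int_mono ((TF.mul_left sρ tf).mul (tk.D _)) ((tS.cmul _).add (tf.sq.cmul _)) ?_ τ
    intro p
    have h3 : (Dd k k u p) ^ 2 ≤ ∑ j, (Dd j k u p) ^ 2 :=
      Finset.single_le_sum (f := fun j => (Dd j k u p) ^ 2)
        (fun _ _ => sq_nonneg _) (Finset.mem_univ k)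
    set g := Dd k k u p
    have h4 : ρ p * f p * g ≤ δ ^ 2 / 2 * g ^ 2 + (2 * δ ^ 2)⁻¹ * (ρ p * f p) ^ 2 := by
      have := sq_nonneg (δ * g - δ⁻¹ * (ρ p * f p))
      have e : (δ * g - δ⁻¹ * (ρ p * f p)) ^ 2 =
        δ ^ 2 * g ^ 2 - 2 * (ρ p * f p * g) + (δ ^ 2)⁻¹ * (ρ p * f p) ^ 2 := by
        field_simp
        ring
      rw [e] at this
      rw [mul_inv]; linarith
    have h5 : (ρ p) ^ 2 ≤ (δ ^ 2)⁻¹ := by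
      rw [← inv_pow]; exact pow_le_pow_left₀ (by linarith [(Hρ p).1]) (Hρ p).2 2
    have h6 : (2 * δ ^ 2)⁻¹ * (ρ p * f p) ^ 2 ≤ (2 * δ ^ 4)⁻¹ * f p ^ 2 := by
      rw [mul_pow]
      calc _ ≤ (2 * δ ^ 2)⁻¹ * ((δ ^ 2)⁻¹ * f p ^ 2) := by gcongr
        _ = _ := by field_simp
    have h7 : δ ^ 2 / 2 * g ^ 2 ≤ δ ^ 2 / 2 * ∑ j, (Dd j k u p) ^ 2 := by gcongr
    linarith
  have fin : δ ^ 2 / 2 * (∫ p in Hs τ, ∑ j, (Dd j k u p) ^ 2) ≤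
    (2 * δ ^ 4)⁻¹ * ∫ p in Hs τ, f p ^ 2 := by linarith
  calc _ = 2 / δ ^ 2 * (δ ^ 2 / 2 * (∫ p in Hs τ, ∑ j, (Dd j k u p) ^ 2)) := by
        field_simp
    _ ≤ 2 / δ ^ 2 * ((2 * δ ^ 4)⁻¹ * ∫ p in Hs τ, f p ^ 2) := by gcongr
    _ = _ := by field_simp

theorem L2_full {δ : ℝ} (hδ : 0 < δ) : ∃ N : ℝ, 0 ≤ N ∧ ∀ (A : ℝ → Mx n),
    SmEll δ A → ∀ (u : Fu n), TF u → ∀ τ : ℝ,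
    ∫ p in Hs τ, ((D et u p) ^ 2 + ∑ j, ∑ k, (Dd j k u p) ^ 2) ≤
      N * ∫ p in Hs τ, (Pop A u p) ^ 2 := by
  set c := (δ ^ 6)⁻¹
  set c1 := 2 + 2 * ((n + 1 : ℝ) ^ 2 * (δ ^ 2)⁻¹ * ((n + 1 : ℝ) ^ 2 * c))
  set c2 := (δ ^ 2)⁻¹ * c1
  set c3 := 2 * (δ ^ 2)⁻¹ * (c1 + c2)
  have hc : 0 ≤ c := by positivity
  have hc1 : 0 ≤ c1 := by positivity
  have hc2 : 0 ≤ c2 := by positivity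
  have hc3 : 0 ≤ c3 := by positivity
  refine ⟨c2 + (n + 1 : ℝ) ^ 2 * (c + c3), by positivity, fun A hA u hu τ => ?_⟩
  set g : Ix n → Ix n → E n → ℝ := fun j k => Dd j k u with hg
  have tg : ∀ j k, TF (g j k) := fun j k => (hu.D _).D _
  set S := ∫ p in Hs τ, (Pop A u p) ^ 2 with hS
  have S0 : 0 ≤ S := integral_nonneg fun p => sq_nonneg _
  have tf : TF (Pop A u) := hu.Pop hA
  set ρ : E n → ℝ := fun p => (A (p.2 0) 0 0)⁻¹ with hρ
  have sρ : Sm ρ := Sm.comp0 (rho_sm hδ hA)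
  have Hρ : ∀ p, δ ≤ ρ p ∧ ρ p ≤ δ⁻¹ := fun p => rho_bd hδ hA (p.2 0)
  have T1 : ∀ j k, k ≠ 0 → ∫ p in Hs τ, (g j k p) ^ 2 ≤ c * S := by
    intro j k hk
    refine le_trans (int_mono (tg j k).sq (TF.sum fun j _ => (tg j k).sq) (fun p => ?_) τ)
      (L2_tang hδ hA hu τ hk)
    exact Finset.single_le_sum (f := fun j => (g j k p) ^ 2) (fun _ _ => sq_nonneg _) (Finset.mem_univ j)
  set B : Ix n → Ix n → E n → ℝ := fun j k => if j = 0 ∧ k = 0 then fun _ => 0 else g j k with hB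
  have tB : ∀ j k, TF (B j k) := by
    intro j k; simp only [hB]; split_ifs; exacts [TF.zero, tg j k]
  have T2 : ∀ j k, ∫ p in Hs τ, (B j k p) ^ 2 ≤ c * S := by
    intro j k
    by_cases h : j = 0 ∧ k = 0
    · simp only [hB, if_pos h]; simp; positivity
    · simp only [hB, if_neg h]
      by_cases hk : k = 0
      · have hj : j ≠ 0 := fun e => h ⟨e, hk⟩
        have := T1 k j hj
        rwa [show g k j = g j k from D_comm hu.sm _ _] at this
      · exact T1 j k hk
  set F : E n → ℝ := fun p => D et u p + A (p.2 0) 0 0 * g 0 0 p with hF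
  have tF : TF F := (hu.D _).add (TF.mul_left (Sm.comp0 (hA.sm 0 0)) (tg 0 0))
  have fF : ∀ p, Pop A u p = F p + ∑ j, ∑ k, A (p.2 0) j k * B j k p := by
    intro p
    have : ∑ j, ∑ k, A (p.2 0) j k * Dd j k u p =
        A (p.2 0) 0 0 * g 0 0 p + ∑ j, ∑ k, A (p.2 0) j k * B j k p := by
      have e : ∀ j k, A (p.2 0) j k * Dd j k u p =
        (if j = 0 then (if k = 0 then A (p.2 0) 0 0 * g 0 0 p else 0) else 0) + A (p.2 0) j k * B j k p := by
        intro j k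
        by_cases hj : j = 0 <;> by_cases hk : k = 0 <;> simp [hB, hg, hj, hk]
      simp only [e, Finset.sum_add_distrib]
      simp
    simp only [_root_.Pop, hF, this]; ring
  have F2 : ∀ p, F p ^ 2 ≤ 2 * (Pop A u p) ^ 2 +
      2 * ((n + 1 : ℝ) ^ 2 * (δ ^ 2)⁻¹) * ∑ j, ∑ k, (B j k p) ^ 2 := by
    intro p
    set X := ∑ j, ∑ k, A (p.2 0) j k * B j k p with hX
    have hX2 : X ^ 2 ≤ (n + 1 : ℝ) ^ 2 * (δ ^ 2)⁻¹ * ∑ j, ∑ k, (B j k p) ^ 2 := by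
      have h1 : X ^ 2 ≤ (n + 1 : ℝ) * ∑ j, (∑ k, A (p.2 0) j k * B j k p) ^ 2 := by
        have := sq_sum_le_card_mul_sum_sq (s := (Finset.univ : Finset (Ix n)))
          (f := fun j => ∑ k, A (p.2 0) j k * B j k p)
        simpa using this
      have h2 : ∀ j, (∑ k, A (p.2 0) j k * B j k p) ^ 2 ≤
          (n + 1 : ℝ) * ((δ ^ 2)⁻¹ * ∑ k, (B j k p) ^ 2) := by
        intro j
        have h3 := sq_sum_le_card_mul_sum_sq (s := (Finset.univ : Finset (Ix n)))
          (f := fun k => A (p.2 0) j k * B j k p)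
        simp only [Finset.card_univ, Fintype.card_fin, Nat.cast_add, Nat.cast_one] at h3
        refine h3.trans (mul_le_mul_of_nonneg_left ?_ (by positivity))
        rw [Finset.mul_sum]
        refine Finset.sum_le_sum fun k _ => ?_
        rw [mul_pow]
        refine mul_le_mul_of_nonneg_right ?_ (sq_nonneg _)
        rw [← sq_abs, ← inv_pow]
        exact pow_le_pow_left₀ (abs_nonneg _) ((hA.ell _).bdd hδ j k) 2
      calc X ^ 2 ≤ _ := h1
        _ ≤ (n + 1 : ℝ) * ∑ j, ((n + 1 : ℝ) * ((δ ^ 2)⁻¹ * ∑ k, (B j k p) ^ 2)) := by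
          gcongr with j; exact h2 j
        _ = _ := by rw [← Finset.mul_sum, ← Finset.mul_sum]; ring
    have := fF p
    have e : F p = Pop A u p - X := by linarith
    rw [e]; nlinarith [sq_nonneg (Pop A u p + X)]
  have IB : ∫ p in Hs τ, ∑ j, ∑ k, (B j k p) ^ 2 ≤ (n + 1 : ℝ) ^ 2 * c * S := by
    rw [integral_finsetSum _ fun j _ => (TF.sum fun l _ => (tB j l).sq).int]
    have : ∀ j, ∫ p in Hs τ, ∑ k, (B j k p) ^ 2 ≤ (n + 1 : ℝ) * (c * S) := by
      intro j
      rw [integral_finsetSum _ fun l _ => (tB j l).sq.int]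
      have := Finset.sum_le_sum fun k (_ : k ∈ Finset.univ) => T2 j k
      simpa using this
    have := Finset.sum_le_sum fun k (_ : k ∈ Finset.univ) => this k
    simp at this; simp; linarith
  have tSB : TF (fun p => ∑ j, ∑ k, (B j k p) ^ 2) := TF.sum fun j _ => TF.sum fun k _ => (tB j k).sq
  have IF : ∫ p in Hs τ, F p ^ 2 ≤ c1 * S := by
    have h1 := int_mono tF.sq ((tf.sq.cmul 2).add (tSB.cmul _)) F2 τ
    rw [integral_add (tf.sq.cmul 2).int (tSB.cmul _).int, integral_const_mul, integral_const_mul] at h1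
    refine h1.trans ?_
    have := mul_le_mul_of_nonneg_left IB (by positivity : 0 ≤ 2 * ((n + 1 : ℝ) ^ 2 * (δ ^ 2)⁻¹))
    simp only [c1]
    linarith
  have I1 : 0 ≤ ∫ p in Hs τ, g 0 0 p * D et u p := by
    have h1 := ibp_x (Sm.const (n := n) 1) (hu.D (ex 0)) (hu.D et) (v := ex 0) rfl
      (fun p => by rw [D_const]) τ
    have h2 := ibp_t_sq (Sm.const (n := n) 1) (fun _ => zero_le_one) (fun p => by rw [D_const])
      (hu.D (ex 0)) τ
    rw [D_comm hu.sm (ex 0) et] at h1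
    simp only [one_mul] at h1 h2
    rw [hg]; linarith
  have It : ∫ p in Hs τ, (D et u p) ^ 2 ≤ c2 * S := by
    have h1 : ∫ p in Hs τ, (δ / 2 * (D et u p) ^ 2 + g 0 0 p * D et u p) ≤
        ∫ p in Hs τ, (δ⁻¹ / 2 * F p ^ 2) := by
      refine int_mono (((hu.D et).sq.cmul _).add ((tg 0 0).mul (hu.D et))) (tF.sq.cmul _) (fun p => ?_) τ
      have e : g 0 0 p = ρ p * (F p - D et u p) := by
        simp only [hF, hρ]
        have : A (p.2 0) 0 0 ≠ 0 := by linarith [((hA.ell (p.2 0)).diag 0).1]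
        field_simp; ring
      rw [e]
      have h2 := mul_le_mul_of_nonneg_right (Hρ p).1 (sq_nonneg (D et u p))
      have h3 := mul_le_mul_of_nonneg_right (Hρ p).2 (sq_nonneg (F p))
      have h4 := mul_nonneg (hδ.le.trans (Hρ p).1) (sq_nonneg (F p - D et u p))
      nlinarith
    rw [integral_add ((hu.D et).sq.cmul _).int ((tg 0 0).mul (hu.D et)).int, integral_const_mul,
      integral_const_mul] at h1
    have h2 : δ / 2 * ∫ p in Hs τ, (D et u p) ^ 2 ≤ δ⁻¹ / 2 * (c1 * S) := by
      have := mul_le_mul_of_nonneg_left IF (by positivity : 0 ≤ δ⁻¹ / 2)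
      linarith
    calc _ = 2 / δ * (δ / 2 * ∫ p in Hs τ, (D et u p) ^ 2) := by field_simp
      _ ≤ 2 / δ * (δ⁻¹ / 2 * (c1 * S)) := by gcongr
      _ = _ := by simp only [c2]; field_simp
  have I00 : ∫ p in Hs τ, (g 0 0 p) ^ 2 ≤ c3 * S := by
    have h1 : ∫ p in Hs τ, (g 0 0 p) ^ 2 ≤
        ∫ p in Hs τ, 2 * (δ ^ 2)⁻¹ * (F p ^ 2 + (D et u p) ^ 2) := by
      refine int_mono (tg 0 0).sq ((tF.sq.add (hu.D et).sq).cmul _) (fun p => ?_) τ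
      have e : g 0 0 p = ρ p * (F p - D et u p) := by
        simp only [hF, hρ]
        have : A (p.2 0) 0 0 ≠ 0 := by linarith [((hA.ell (p.2 0)).diag 0).1]
        field_simp; ring
      rw [e, mul_pow]
      have h5 : (ρ p) ^ 2 ≤ (δ ^ 2)⁻¹ := by
        rw [← inv_pow]; exact pow_le_pow_left₀ (by linarith [(Hρ p).1]) (Hρ p).2 2
      calc _ ≤ (δ ^ 2)⁻¹ * (F p - D et u p) ^ 2 := by gcongr
        _ ≤ (δ ^ 2)⁻¹ * (2 * (F p ^ 2 + (D et u p) ^ 2)) := by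
          gcongr; nlinarith [sq_nonneg (F p + D et u p)]
        _ = _ := by ring
    rw [integral_const_mul, integral_add tF.sq.int (hu.D et).sq.int] at h1
    refine h1.trans ?_
    have := mul_le_mul_of_nonneg_left (add_le_add IF It) (by positivity : 0 ≤ 2 * (δ ^ 2)⁻¹)
    simp only [c3]; linarith
  have T3 : ∀ j k, ∫ p in Hs τ, (g j k p) ^ 2 ≤ (c + c3) * S := by
    intro j k
    by_cases h : j = 0 ∧ k = 0
    · rw [h.1, h.2]; nlinarith
    · have := T2 j k; simp only [hB, if_neg h] at this; nlinarith
  rw [integral_add (hu.D et).sq.int (TF.sum fun j _ => TF.sum fun k _ => (tg j k).sq).int,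
    integral_finsetSum _ fun j _ => (TF.sum fun l _ => (tg j l).sq).int]
  have : ∀ j, ∫ p in Hs τ, ∑ k, (g j k p) ^ 2 ≤ (n + 1 : ℝ) * ((c + c3) * S) := by
    intro j
    rw [integral_finsetSum _ fun l _ => (tg j l).sq.int]
    have := Finset.sum_le_sum fun k (_ : k ∈ Finset.univ) => T3 j k
    simpa using this
  have := Finset.sum_le_sum fun k (_ : k ∈ Finset.univ) => this k
  simp only [Finset.sum_const, Finset.card_univ, Fintype.card_fin, nsmul_eq_mul, Nat.cast_add, Nat.cast_one] at this
  nlinarith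

end

section

structure MEll {n : ℕ} (δ : ℝ) (A : ℝ → Mx n) : Prop where
  meas : ∀ j k, Measurable (fun s => A s j k)
  ell : ∀ s, Ell δ (A s)

noncomputable def VV {n : ℕ} (u : Fu n) (p : E n) : ℝ :=
  |D et u p| + ∑ j, ∑ k, |Dd j k u p|

noncomputable def nq {n : ℕ} (q : ℝ) (s : Set (E n)) (f : Fu n) : ℝ≥0∞ :=
  eLpNorm f (oR q) (volume.restrict s)

def HQ (n : ℕ) (δ q : ℝ) : Prop :=
  ∃ N : NNReal, ∀ A : ℝ → Mx n, MEll δ A → ∀ u : E n → ℝ, TF u → ∀ τ : ℝ,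
    nq q (Hs τ) (VV u) ≤ N * nq q (Hs τ) (Pop A u)

variable {n : ℕ}

theorem VV_nonneg (u : Fu n) (p : E n) : 0 ≤ VV u p := by unfold VV; positivity

theorem TF.contV {u : Fu n} (hu : TF u) : Continuous (VV u) := by
  unfold VV
  exact (hu.D et).cont.abs.add (continuous_finsetSum _ fun j _ => continuous_finsetSum _ fun k _ =>
    ((hu.D (ex k)).D (ex j)).cont.abs)

theorem TF.csV {u : Fu n} (hu : TF u) : HasCompactSupport (VV u) := by
  refine HasCompactSupport.intro hu.cs (fun p hp => ?_)
  have h1 : ∀ v : E n, _root_.D v u p = 0 := fun v =>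
    image_eq_zero_of_notMem_tsupport (fun h => hp (tsupport_fderiv_apply_subset ℝ v h))
  have h2 : ∀ v w : E n, _root_.D v (_root_.D w u) p = 0 := fun v w =>
    image_eq_zero_of_notMem_tsupport (fun h => hp (tsupport_fderiv_apply_subset ℝ w
      (tsupport_fderiv_apply_subset ℝ v h)))
  simp [VV, h1, h2]

theorem Pop_le {δ : ℝ} (hδ : 0 < δ) {A : ℝ → Mx n} (hA : ∀ s, Ell δ (A s))
    (u : Fu n) (p : E n) : |Pop A u p| ≤ (1 + δ⁻¹) * VV u p := by
  unfold Pop VV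
  refine (abs_add_le _ _).trans ?_
  have h1 : |∑ j, ∑ k, A (p.2 0) j k * Dd j k u p| ≤
      δ⁻¹ * ∑ j, ∑ k, |Dd j k u p| := by
    rw [Finset.mul_sum]
    refine (Finset.abs_sum_le_sum_abs _ _).trans (Finset.sum_le_sum fun j _ => ?_)
    rw [Finset.mul_sum]
    refine (Finset.abs_sum_le_sum_abs _ _).trans (Finset.sum_le_sum fun k _ => ?_)
    rw [abs_mul]; exact mul_le_mul_of_nonneg_right ((hA _).bdd hδ j k) (abs_nonneg _)
  have h2 : 0 ≤ ∑ j, ∑ k, |Dd j k u p| := by positivity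
  have h3 : 0 < δ⁻¹ := by positivity
  nlinarith [abs_nonneg (D et u p)]

theorem Pop_meas {δ : ℝ} {A : ℝ → Mx n} (hA : MEll δ A)
    {u : Fu n} (hu : TF u) : Measurable (Pop A u) := by
  unfold Pop
  refine (hu.D et).cont.measurable.add (Finset.measurable_sum _ fun j _ =>
    Finset.measurable_sum _ fun k _ => ?_)
  refine Measurable.mul ?_ ((hu.D (ex k)).D (ex j)).cont.measurable
  exact (hA.meas j k).comp ((measurable_pi_apply 0).comp measurable_snd)

theorem TF.memV {u : Fu n} (hu : TF u) {q : ℝ≥0∞} {s : Set (E n)} :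
    MemLp (VV u) q (volume.restrict s) :=
  (hu.contV.memLp_of_hasCompactSupport hu.csV).restrict s

theorem Pop_mem {δ : ℝ} (hδ : 0 < δ) {A : ℝ → Mx n} (hA : MEll δ A)
    {u : Fu n} (hu : TF u) {q : ℝ≥0∞} {s : Set (E n)} : MemLp (Pop A u) q (volume.restrict s) :=
  (hu.memV (q := q) (s := s)).of_le_mul (Pop_meas hA hu).aestronglyMeasurable
    (Filter.Eventually.of_forall fun p => by
      rw [Real.norm_eq_abs, Real.norm_eq_abs, abs_of_nonneg (VV_nonneg u p)]
      exact Pop_le hδ hA.ell u p)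

open Filter Topology Convolution in
theorem mollA {δ : ℝ} (hδ : 0 < δ) {A : ℝ → Mx n} (hA : MEll δ A) :
    ∃ B : ℕ → ℝ → Mx n, (∀ i, SmEll δ (B i)) ∧
      ∀ᵐ s, ∀ j k, Tendsto (fun i => B i s j k) atTop (𝓝 (A s j k)) := by
  have li : ∀ j k, LocallyIntegrable (fun s => A s j k) volume := by
    intro j k
    refine (locallyIntegrable_const (δ⁻¹ : ℝ)).mono (hA.meas j k).aestronglyMeasurable
      (Eventually.of_forall fun s => ?_)
    rw [Real.norm_eq_abs, Real.norm_eq_abs, abs_of_pos (inv_pos.2 hδ)]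
    exact (hA.ell s).bdd hδ j k
  set φ : ℕ → ContDiffBump (0 : ℝ) := fun i =>
    ⟨1 / ((i:ℝ) + 1) / 2, 1 / ((i:ℝ) + 1), by positivity, by
      have : 0 < 1 / ((i:ℝ) + 1) := by positivity
      linarith⟩ with hφ
  refine ⟨fun i s j k => ((φ i).normed volume ⋆[ContinuousLinearMap.lsmul ℝ ℝ, volume] (fun s => A s j k)) s,
    fun i => ⟨fun j k => ?_, fun s => ?_⟩, ?_⟩
  · exact (φ i).hasCompactSupport_normed.contDiff_convolution_left _ ((φ i).contDiff_normed) (li j k)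
  · have ce : ∀ j k, ConvolutionExistsAt ((φ i).normed volume) (fun s => A s j k) s
        (ContinuousLinearMap.lsmul ℝ ℝ) volume := fun j k =>
      (φ i).hasCompactSupport_normed.convolutionExists_left _ (φ i).continuous_normed (li j k) s
    have ce' : ∀ j k, Integrable (fun t => (φ i).normed volume t * A (s - t) j k) := fun j k => ce j k
    have ex : ∀ θ : Ix n → ℝ, ∑ j, ∑ k,
        ((φ i).normed volume ⋆[ContinuousLinearMap.lsmul ℝ ℝ, volume] (fun s => A s j k)) s * θ j * θ k =
        ∫ t, (φ i).normed volume t * ∑ j, ∑ k, A (s - t) j k * θ j * θ k := by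
      intro θ
      simp only [Finset.mul_sum]
      have i1 : ∀ j k, Integrable (fun t => (φ i).normed volume t * (A (s - t) j k * θ j * θ k)) := by
        intro j k
        have := ((ce' j k).mul_const (θ j)).mul_const (θ k)
        simpa only [mul_assoc] using this
      rw [integral_finsetSum _ fun j _ => integrable_finsetSum _ fun k _ => i1 j k]
      refine Finset.sum_congr rfl fun j _ => ?_
      rw [integral_finsetSum _ fun k _ => i1 j k]
      refine Finset.sum_congr rfl fun k _ => ?_
      rw [convolution_def, ← integral_mul_const, ← integral_mul_const]
      congr 1; funext t; simp; ring
    have i2 : ∀ θ : Ix n → ℝ, Integrable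
        (fun t => (φ i).normed volume t * ∑ j, ∑ k, A (s - t) j k * θ j * θ k) := by
      intro θ
      simp only [Finset.mul_sum]
      refine integrable_finsetSum _ fun j _ => integrable_finsetSum _ fun k _ => ?_
      have := ((ce' j k).mul_const (θ j)).mul_const (θ k)
      simpa only [mul_assoc] using this
    have i3 := (φ i).integrable_normed (μ := volume)
    have i4 := (φ i).integral_normed (μ := volume)
    refine ⟨fun j k => ?_, fun θ => ?_, fun θ => ?_⟩
    · have : (fun s => A s j k) = fun s => A s k j := by funext s; exact (hA.ell s).symm j k
      simp only [this]
    · rw [ex]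
      calc _ = ∫ t, (φ i).normed volume t * (δ * ∑ j, θ j ^ 2) := by
            rw [integral_mul_const, i4, one_mul]
        _ ≤ _ := integral_mono (i3.mul_const _) (i2 θ) fun t =>
            mul_le_mul_of_nonneg_left ((hA.ell _).lo θ) ((φ i).nonneg_normed t)
    · rw [ex]
      calc _ ≤ ∫ t, (φ i).normed volume t * (δ⁻¹ * ∑ j, θ j ^ 2) := 
            integral_mono (i2 θ) (i3.mul_const _) fun t =>
            mul_le_mul_of_nonneg_left ((hA.ell _).hi θ) ((φ i).nonneg_normed t)
        _ = _ := by rw [integral_mul_const, i4, one_mul]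
  · rw [ae_all_iff]; intro j; rw [ae_all_iff]; intro k
    refine ContDiffBump.ae_convolution_tendsto_right_of_locallyIntegrable (K := 2) ?_ ?_ (li j k)
    · exact tendsto_one_div_add_atTop_nhds_zero_nat
    · refine Eventually.of_forall fun i => ?_
      simp only [hφ]; linarith

theorem ae_x0 {P : ℝ → Prop} (h : ∀ᵐ s, P s) : ∀ᵐ p : E n, P (p.2 0) := by
  have h1 : ∀ᵐ x : Ix n → ℝ, P (x 0) :=
    (Measure.quasiMeasurePreserving_eval (μ := fun _ : Ix n => (volume : Measure ℝ)) 0).ae h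
  rw [Measure.volume_eq_prod]
  exact Measure.quasiMeasurePreserving_snd.ae h1

open Filter Topology in
theorem HQ_two {δ : ℝ} (hδ : 0 < δ) : HQ n δ 2 := by
  obtain ⟨N, hN, hL⟩ := L2_full (n := n) hδ
  set N' : ℝ := (1 + (n + 1 : ℝ) ^ 2) * 2 * N + 1
  have hN' : 0 ≤ N' := by positivity
  refine ⟨Real.toNNReal (N' ^ (1/2 : ℝ)), fun A hA u hu τ => ?_⟩
  obtain ⟨B, hB, hBA⟩ := mollA hδ hA
  have m1 : MemLp (VV u) (oR 2) (volume.restrict (Hs τ)) := hu.memV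
  have m2 : MemLp (Pop A u) (oR 2) (volume.restrict (Hs τ)) := Pop_mem hδ hA hu
  have tS : TF (fun p => (D et u p) ^ 2 + ∑ j, ∑ k, (Dd j k u p) ^ 2) :=
    (hu.D et).sq.add (TF.sum fun j _ => TF.sum fun k _ => ((hu.D (ex k)).D (ex j)).sq)
  have iV : IntegrableOn (fun p => (VV u p) ^ 2) (Hs τ) := by
    have : HasCompactSupport (fun p => (VV u p) ^ 2) := by
      simp only [pow_two]; exact hu.csV.mul_right
    exact ((hu.contV.pow 2).integrable_of_hasCompactSupport this).integrableOn
  have lim : ∫ p in Hs τ, ((D et u p) ^ 2 + ∑ j, ∑ k, (Dd j k u p) ^ 2) ≤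
      N * ∫ p in Hs τ, (Pop A u p) ^ 2 := by
    have t1 : Tendsto (fun i => ∫ p in Hs τ, (Pop (B i) u p) ^ 2) atTop
        (𝓝 (∫ p in Hs τ, (Pop A u p) ^ 2)) := by
      refine tendsto_integral_of_dominated_convergence (fun p => (1 + δ⁻¹) ^ 2 * VV u p ^ 2) ?_ ?_ ?_ ?_
      · exact fun i => (hu.Pop (hB i)).sq.cont.aestronglyMeasurable
      · exact iV.const_mul _
      · intro i; refine Eventually.of_forall fun p => ?_
        rw [Real.norm_eq_abs, abs_of_nonneg (sq_nonneg _), ← sq_abs, ← mul_pow]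
        exact pow_le_pow_left₀ (abs_nonneg _) (Pop_le hδ (hB i).ell u p) 2
      · refine ae_restrict_of_ae ?_
        filter_upwards [ae_x0 hBA] with p hp
        refine Tendsto.pow ?_ 2
        unfold Pop
        refine tendsto_const_nhds.add (tendsto_finsetSum _ fun j _ => tendsto_finsetSum _ fun k _ => ?_)
        exact (hp j k).mul_const _
    exact ge_of_tendsto (t1.const_mul N) (Eventually.of_forall fun i => hL (B i) (hB i) u hu τ)
  have vb : ∫ p in Hs τ, (VV u p) ^ 2 ≤ N' * ∫ p in Hs τ, (Pop A u p) ^ 2 := by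
    have h0 : 0 ≤ ∫ p in Hs τ, (Pop A u p) ^ 2 := integral_nonneg fun p => sq_nonneg _
    calc ∫ p in Hs τ, (VV u p) ^ 2 ≤ ∫ p in Hs τ, ((1 + (n+1:ℝ)^2) * 2) *
          ((D et u p) ^ 2 + ∑ j, ∑ k, (Dd j k u p) ^ 2) := by
          refine integral_mono iV (tS.cmul _).int fun p => ?_
          unfold VV
          set X := ∑ j, ∑ k, |Dd j k u p|
          have h1 : X ^ 2 ≤ (n + 1 : ℝ) ^ 2 * ∑ j, ∑ k, (Dd j k u p) ^ 2 := by
            have h1 := sq_sum_le_card_mul_sum_sq (s := (Finset.univ : Finset (Ix n)))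
              (f := fun j => ∑ k, |Dd j k u p|)
            simp only [Finset.card_univ, Fintype.card_fin, Nat.cast_add, Nat.cast_one] at h1
            refine h1.trans ?_
            rw [pow_two (n + 1 : ℝ), mul_assoc]
            refine mul_le_mul_of_nonneg_left ?_ (by positivity)
            rw [Finset.mul_sum]
            refine Finset.sum_le_sum fun j _ => ?_
            have h2 := sq_sum_le_card_mul_sum_sq (s := (Finset.univ : Finset (Ix n)))
              (f := fun k => |Dd j k u p|)
            simpa using h2
          have h3 : 0 ≤ ∑ j, ∑ k, (Dd j k u p) ^ 2 := by positivity
          have h4 : 0 ≤ ((n:ℝ)+1)^2 * (D et u p) ^ 2 := by positivity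
          have h5 := sq_abs (D et u p)
          have h6 := sq_nonneg (|D et u p| - X)
          change (|D et u p| + X) ^ 2 ≤ _
          nlinarith
      _ ≤ (1 + (n+1:ℝ)^2) * 2 * (N * ∫ p in Hs τ, (Pop A u p) ^ 2) := by
          rw [integral_const_mul]; gcongr
      _ ≤ _ := by simp only [N']; nlinarith
  unfold nq
  rw [m1.eLpNorm_eq_integral_rpow_norm (by simp) (by simp),
    m2.eLpNorm_eq_integral_rpow_norm (by simp) (by simp)]
  simp only [toReal_ofReal (zero_le_two : (0:ℝ) ≤ 2), Real.rpow_two, Real.norm_eq_abs, sq_abs]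
  rw [show ((Real.toNNReal (N' ^ (1/2 : ℝ)) : NNReal) : ℝ≥0∞) = oR (N' ^ (1/2 : ℝ)) from rfl,
    ← ofReal_mul (by positivity)]
  refine ofReal_le_ofReal ?_
  have h0 : 0 ≤ ∫ p in Hs τ, (Pop A u p) ^ 2 := integral_nonneg fun p => sq_nonneg _
  rw [show (1/2:ℝ) = 2⁻¹ by norm_num, ← Real.mul_rpow hN' h0]
  exact Real.rpow_le_rpow (integral_nonneg fun p => sq_nonneg _) vb (by norm_num)

end

section
variable {n : ℕ}

theorem jensen_k {Y : Type*} [MeasurableSpace Y] (ν : Measure Y) {k f : Y → ℝ≥0∞}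
    (hk : Measurable k) (hf : Measurable f) {q : ℝ} (hq : 1 ≤ q) :
    (∫⁻ y, k y * f y ∂ν) ^ q ≤ (∫⁻ y, k y ∂ν) ^ (q - 1) * ∫⁻ y, k y * f y ^ q ∂ν := by
  have h1 := eLpNorm_le_eLpNorm_mul_rpow_measure_univ (μ := ν.withDensity k) (f := f) (p := 1)
    (q := oR q) (by simpa using hq) hf.aestronglyMeasurable
  have hq0 : (0:ℝ) < q := by linarith
  rw [eLpNorm_one_eq_lintegral_enorm, eLpNorm_eq_lintegral_rpow_enorm_toReal
    (by simpa using hq0) (by simp)] at h1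
  simp only [enorm_eq_self, toReal_ofReal hq0.le, toReal_one, withDensity_apply _
    MeasurableSet.univ, Measure.restrict_univ] at h1
  rw [lintegral_withDensity_eq_lintegral_mul _ hk hf,
    lintegral_withDensity_eq_lintegral_mul _ hk (hf.pow_const q)] at h1
  simp only [Pi.mul_apply] at h1
  refine (rpow_le_rpow h1 hq0.le).trans (le_of_eq ?_)
  rw [mul_rpow_of_nonneg _ _ hq0.le, ← rpow_mul, ← rpow_mul, mul_comm]
  congr 2
  · field_simp
  · field_simp; simp

theorem nq_eq {q : ℝ} (hq : 0 < q) (S : Set (E n)) (f : Fu n) :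
    nq q S f = (∫⁻ p in S, ‖f p‖ₑ ^ q) ^ (1 / q) := by
  unfold nq
  rw [eLpNorm_eq_lintegral_rpow_enorm_toReal (by simpa using hq) (by simp),
    toReal_ofReal hq.le]

theorem nq_rpow {q : ℝ} (hq : 0 < q) (S : Set (E n)) (f : Fu n) :
    nq q S f ^ q = ∫⁻ p in S, ‖f p‖ₑ ^ q := by
  rw [nq_eq hq, ← rpow_mul]; field_simp; simp

theorem shift_avg {Y : Type*} [MeasurableSpace Y] (ν : Measure Y) [SFinite ν] {s : Y → E n}
    (hs : Measurable s) {k : Y → ℝ≥0∞} (hk : Measurable k) (hk1 : ∫⁻ y, k y ∂ν ≠ ∞)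
    {S S' : Set (E n)} (hS : MeasurableSet S) (hS' : MeasurableSet S')
    (h : ∀ y, k y ≠ 0 → ∀ z ∈ S, z + s y ∈ S') {X : Fu n} (hX : Measurable X) {q : ℝ}
    (hq : 1 ≤ q) :
    eLpNorm (fun z => ∫⁻ y, k y * ‖X (z + s y)‖ₑ ∂ν) (oR q) (volume.restrict S) ≤
      (∫⁻ y, k y ∂ν) * nq q S' X := by
  have hq0 : (0:ℝ) < q := by linarith
  rw [eLpNorm_eq_lintegral_rpow_enorm_toReal (by simpa using hq0) (by simp),
    toReal_ofReal hq0.le, nq_eq hq0]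
  simp only [enorm_eq_self]
  have hm : Measurable fun (a : E n × Y) => ‖X (a.1 + s a.2)‖ₑ ^ q :=
    (hX.comp (measurable_fst.add (hs.comp measurable_snd))).enorm.pow_const q
  have key : ∫⁻ z in S, (∫⁻ y, k y * ‖X (z + s y)‖ₑ ∂ν) ^ q ≤
      (∫⁻ y, k y ∂ν) ^ q * ∫⁻ p in S', ‖X p‖ₑ ^ q := by
    calc ∫⁻ z in S, (∫⁻ y, k y * ‖X (z + s y)‖ₑ ∂ν) ^ q
        ≤ ∫⁻ z in S, (∫⁻ y, k y ∂ν) ^ (q - 1) * ∫⁻ y, k y * ‖X (z + s y)‖ₑ ^ q ∂ν :=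
          lintegral_mono fun z => jensen_k ν hk
            (hX.comp (measurable_const.add hs)).enorm hq
      _ = (∫⁻ y, k y ∂ν) ^ (q - 1) * ∫⁻ z in S, ∫⁻ y, k y * ‖X (z + s y)‖ₑ ^ q ∂ν := by
          rw [lintegral_const_mul']
          exact rpow_ne_top_of_nonneg (by linarith) hk1
      _ = (∫⁻ y, k y ∂ν) ^ (q - 1) * ∫⁻ y, k y * (∫⁻ z in S, ‖X (z + s y)‖ₑ ^ q) ∂ν := by
          rw [lintegral_lintegral_swap]
          · congr 1
            refine lintegral_congr fun y => ?_
            rw [lintegral_const_mul]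
            exact hm.comp (measurable_id.prodMk measurable_const)
          · exact ((hk.comp measurable_snd).mul hm).aemeasurable
      _ ≤ (∫⁻ y, k y ∂ν) ^ (q - 1) * ∫⁻ y, k y * (∫⁻ p in S', ‖X p‖ₑ ^ q) ∂ν := by
          refine mul_le_mul' le_rfl (lintegral_mono fun y => ?_)
          by_cases hy : k y = 0
          · simp [hy]
          refine mul_le_mul' le_rfl ?_
          rw [← lintegral_indicator hS, ← lintegral_indicator hS',
            ← lintegral_add_right_eq_self (S'.indicator _) (s y)]
          refine lintegral_mono fun z => ?_
          by_cases hz : z ∈ S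
          · simp [hz, h y hy z hz]
          · simp [hz]
      _ = (∫⁻ y, k y ∂ν) ^ q * ∫⁻ p in S', ‖X p‖ₑ ^ q := by
          rw [lintegral_mul_const _ hk, ← mul_assoc]
          congr 1
          by_cases h0 : ∫⁻ y, k y ∂ν = 0
          · rw [h0, zero_rpow_of_pos hq0, mul_zero]
          conv_lhs => rw [← rpow_one (∫⁻ y, k y ∂ν)]
          rw [← rpow_mul, ← rpow_add _ _ h0 hk1]
          congr 1; ring
  refine (rpow_le_rpow key (by positivity : 0 ≤ 1 / q)).trans (le_of_eq ?_)
  rw [mul_rpow_of_nonneg _ _ (by positivity), ← rpow_mul]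
  congr 1
  rw [mul_one_div_cancel hq0.ne', rpow_one]

noncomputable def Mm (μ : Measure (E n)) (u : Fu n) (z : E n) : ℝ := ∫ h, u (z + h) ∂μ

theorem Mm_conv (μ : Measure (E n)) (u : Fu n) :
    Mm μ u = convolution (fun _ => (1:ℝ)) u (ContinuousLinearMap.mul ℝ ℝ) (μ.map (fun h => - h)) := by
  funext z
  simp only [Mm, convolution]
  have := (MeasurableEquiv.neg (E n)).measurableEmbedding.integral_map (μ := μ)
    (fun t => ((ContinuousLinearMap.mul ℝ ℝ) 1) (u (z - t)))
  refine Eq.trans ?_ this.symm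
  simp

theorem Mm_D (μ : Measure (E n)) [IsFiniteMeasure μ] {u : Fu n} (hu : TF u) (v : E n) :
    D v (Mm μ u) = Mm μ (D v u) := by
  funext z
  have hc := hu.sm.continuous_fderiv (by simp)
  obtain ⟨C, hC⟩ := (hu.cs.fderiv ℝ).exists_bound_of_continuous hc
  obtain ⟨C', hC'⟩ := hu.cs.exists_bound_of_continuous hu.cont
  have hi : ∀ x, Integrable (fun h => fderiv ℝ u (x + h)) μ := fun x =>
    Integrable.of_bound (C := C) (hc.comp (by fun_prop)).aestronglyMeasurable
      (ae_of_all _ fun t => hC _)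
  have key := hasFDerivAt_integral_of_dominated_of_fderiv_le (μ := μ) (𝕜 := ℝ)
    (F := fun x h => u (x + h)) (F' := fun x h => fderiv ℝ u (x + h)) (x₀ := z)
    (bound := fun _ => C) (s := Set.univ) Filter.univ_mem
    (Filter.Eventually.of_forall fun x => (hu.cont.comp (by fun_prop)).aestronglyMeasurable)
    (Integrable.of_bound (C := C') (hu.cont.comp (by fun_prop)).aestronglyMeasurable
      (ae_of_all _ fun t => hC' _)) (hi z).1 (ae_of_all _ fun t x _ => hC _)
    (integrable_const C) (ae_of_all _ fun t x _ => by
      have := (hu.sm.diff (x + t)).hasFDerivAt.comp x ((hasFDerivAt_id x).add_const t)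
      simpa [Function.comp_def] using this)
  rw [D]
  change fderiv ℝ (fun x => ∫ h, u (x + h) ∂μ) z v = _
  rw [key.fderiv, ContinuousLinearMap.integral_apply (hi z)]
  rfl

theorem Mm_TF (μ : Measure (E n)) [IsFiniteMeasure μ] {K : Set (E n)} (hK : IsCompact K)
    (hμ : μ Kᶜ = 0) {u : Fu n} (hu : TF u) : TF (Mm μ u) := by
  constructor
  · rw [Sm, Mm_conv]
    exact hu.cs.contDiff_convolution_right (n := ⊤) _ (integrable_const 1).locallyIntegrable hu.sm
  · refine HasCompactSupport.intro (hu.cs.isCompact.add hK.neg) (fun z hz => ?_)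
    refine integral_eq_zero_of_ae ?_
    have : ∀ᵐ h ∂μ, h ∈ K := by rw [ae_iff]; exact hμ
    filter_upwards [this] with h hh
    refine image_eq_zero_of_notMem_tsupport fun hz' => hz ?_
    exact ⟨z + h, hz', -h, by simpa using hh, by simp⟩

end

section
variable {n : ℕ}

abbrev TT (n : ℕ) := ℝ × (Fin n → ℝ)

noncomputable def iota : TT n →L[ℝ] E n :=
  LinearMap.toContinuousLinearMap
    { toFun := fun h => (h.1, Fin.cons 0 h.2)
      map_add' := fun a b => by
        refine Prod.ext rfl ?_
        funext j; refine Fin.cases ?_ (fun i => ?_) j <;> simp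
      map_smul' := fun c b => by
        refine Prod.ext rfl ?_
        funext j; refine Fin.cases ?_ (fun i => ?_) j <;> simp }

theorem iota_fst (h : TT n) : (iota h).1 = h.1 := rfl
theorem iota_zero (h : TT n) : (iota h).2 0 = 0 := rfl
theorem iota_succ (h : TT n) (j : Fin n) : (iota h).2 j.succ = h.2 j := rfl

instance : (volume : Measure (TT n)).IsAddHaarMeasure := by
  rw [Measure.volume_eq_prod]; infer_instance

noncomputable def bumpT (n : ℕ) : ContDiffBump (((1/2 : ℝ), 0) : TT n) where
  rIn := 1/4
  rOut := 1/2
  rIn_pos := by norm_num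
  rIn_lt_rOut := by norm_num

noncomputable def eta (h : TT n) : ℝ := (bumpT n).normed volume h

theorem eta_nonneg (h : TT n) : 0 ≤ eta h := (bumpT n).nonneg_normed h
theorem eta_int : ∫ h : TT n, eta h = 1 := (bumpT n).integral_normed
theorem eta_sm : CD (eta (n := n)) := (bumpT n).contDiff_normed
theorem eta_cs : HasCompactSupport (eta (n := n)) := (bumpT n).hasCompactSupport_normed

structure Ker (κ : TT n → ℝ) : Prop where
  sm : CD κ
  cs : HasCompactSupport κ
  su : tsupport κ ⊆ Metric.closedBall ((1/2 : ℝ), 0) (1/2)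

theorem eta_ker : Ker (eta (n := n)) :=
  ⟨eta_sm, eta_cs, (bumpT n).tsupport_normed_eq.subset⟩

theorem Ker.D {κ : TT n → ℝ} (h : Ker κ) (v : TT n) : Ker (fun x => fderiv ℝ κ x v) :=
  ⟨(h.sm.fderiv_right (m := (⊤ : ℕ∞)) (by simp)).clm_apply contDiff_const,
    h.cs.fderiv_apply (𝕜 := ℝ) v, (tsupport_fderiv_apply_subset ℝ v).trans h.su⟩

theorem Ker.box {κ : TT n → ℝ} (h : Ker κ) {x : TT n} (hx : κ x ≠ 0) :
    0 ≤ x.1 ∧ x.1 ≤ 1 ∧ ∀ j, |x.2 j| ≤ 1 := by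
  have h1 := h.su (subset_tsupport κ hx)
  rw [Metric.mem_closedBall, Prod.dist_eq, max_le_iff, Real.dist_eq, abs_le] at h1
  obtain ⟨⟨h1, h2⟩, h3⟩ := h1
  refine ⟨by simp at h1; linarith, by simp at h2; linarith, fun j => ?_⟩
  have := (dist_le_pi_dist x.2 0 j).trans h3
  rw [Real.dist_eq] at this
  simp at this; linarith

noncomputable def Mk (κ : TT n → ℝ) (u : Fu n) (z : E n) : ℝ := ∫ h, κ h * u (z + iota h)

theorem Mk_le (κ : TT n → ℝ) (u : Fu n) (z : E n) :
    ‖Mk κ u z‖ₑ ≤ ∫⁻ h, ‖κ h‖ₑ * ‖u (z + iota h)‖ₑ := by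
  refine (enorm_integral_le_lintegral_enorm _).trans (le_of_eq ?_)
  simp [enorm_mul]

noncomputable def muEta (n : ℕ) : Measure (E n) :=
  (volume.withDensity (fun h : TT n => oR (eta h))).map iota

theorem eta_lint : ∫⁻ h : TT n, oR (eta h) = 1 := by
  rw [← ofReal_integral_eq_lintegral_ofReal, eta_int]
  · simp
  · exact (eta_sm.continuous).integrable_of_hasCompactSupport eta_cs
  · exact ae_of_all _ eta_nonneg

instance : IsFiniteMeasure (muEta n) := by
  refine ⟨?_⟩
  rw [muEta, Measure.map_apply iota.continuous.measurable MeasurableSet.univ]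
  simp [eta_lint]

theorem Mk_eta {u : Fu n} (hu : Continuous u) : Mk eta u = Mm (muEta n) u := by
  funext z
  have hc : Continuous fun h => u (z + h) := hu.comp (by fun_prop)
  rw [Mm, muEta, integral_map iota.continuous.aemeasurable hc.aestronglyMeasurable]
  rw [integral_withDensity_eq_integral_toReal_smul]
  · simp [toReal_ofReal (eta_nonneg _), Mk]
  · exact eta_sm.continuous.measurable.ennreal_ofReal
  · simp

theorem Mk_TF {u : Fu n} (hu : TF u) : TF (Mk eta u) := by
  rw [Mk_eta hu.cont]
  have hK : IsCompact (iota '' (tsupport (eta (n := n)))) := eta_cs.isCompact.image iota.continuous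
  refine Mm_TF _ hK ?_ hu
  rw [muEta, Measure.map_apply iota.continuous.measurable hK.isClosed.measurableSet.compl,
    withDensity_apply _ (iota.continuous.measurable hK.isClosed.measurableSet.compl)]
  rw [setLIntegral_eq_zero_iff (iota.continuous.measurable hK.isClosed.measurableSet.compl)
    (eta_sm.continuous.measurable.ennreal_ofReal)]
  refine ae_of_all _ fun h hh => ?_
  rw [image_eq_zero_of_notMem_tsupport (f := eta) (fun h' => hh ⟨h, h', rfl⟩)]
  simp

theorem Mk_D {u : Fu n} (hu : TF u) (v : E n) : D v (Mk eta u) = Mk eta (D v u) := by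
  rw [Mk_eta hu.cont, Mk_eta (hu.D v).cont, Mm_D _ hu]

theorem Mk_ibp {κ : TT n → ℝ} (hκ : Ker κ) {u : Fu n} (hu : TF u) (v : TT n) (z : E n) :
    Mk κ (D (iota v) u) z = - Mk (fun x => fderiv ℝ κ x v) u z := by
  have h1 : ∀ h, HasFDerivAt (fun h => u (z + iota h)) ((fderiv ℝ u (z + iota h)).comp iota) h :=
    fun h => (hu.sm.diff (z + iota h)).hasFDerivAt.comp h (iota.hasFDerivAt.const_add z)
  have hc : Continuous fun h => u (z + iota h) := hu.cont.comp (by fun_prop)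
  have key := integral_mul_fderiv_eq_neg_fderiv_mul_of_integrable (μ := (volume : Measure (TT n)))
    (f := κ) (g := fun h => u (z + iota h)) (v := v) ?_ ?_ ?_
    (fun x _ => hκ.sm.differentiable (by simp) x) (fun x _ => (h1 x).differentiableAt)
  · simp only [Mk, ← key]
    congr 1; funext h; rw [(h1 h).fderiv]; rfl
  · exact ((hκ.D v).sm.continuous.mul hc).integrable_of_hasCompactSupport (hκ.D v).cs.mul_right
  · have : (fun x => κ x * fderiv ℝ (fun h => u (z + iota h)) x v) =
      fun x => κ x * D (iota v) u (z + iota x) := by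
      funext h; rw [(h1 h).fderiv]; rfl
    rw [this]
    exact (hκ.sm.continuous.mul ((hu.D _).cont.comp (by fun_prop))).integrable_of_hasCompactSupport
      hκ.cs.mul_right
  · exact (hκ.sm.continuous.mul hc).integrable_of_hasCompactSupport hκ.cs.mul_right

theorem iota_et : iota ((1, 0) : TT n) = et := by
  refine Prod.ext rfl ?_
  funext j; refine Fin.cases ?_ (fun i => ?_) j <;> simp [iota_zero, iota_succ, et]
theorem iota_ex (k : Fin n) : iota ((0, Pi.single k 1) : TT n) = ex k.succ := by
  refine Prod.ext rfl ?_
  funext j; refine Fin.cases ?_ (fun i => ?_) j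
  · simp [iota_zero, ex]
  · simp only [iota_succ, ex, Pi.single_apply, Fin.succ_inj]

theorem meas_cons : Measurable fun a : ℝ × (Fin n → ℝ) => (Fin.cons a.1 a.2 : Ix n → ℝ) := by
  refine measurable_pi_iff.2 fun j => ?_
  refine Fin.cases ?_ (fun i => ?_) j
  · simpa using measurable_fst
  · simp only [Fin.cons_succ]; exact (measurable_pi_apply i).comp measurable_snd

theorem lint_E {G : E n → ℝ≥0∞} (hG : Measurable G) :
    ∫⁻ p, G p = ∫⁻ s : ℝ, ∫⁻ h : TT n, G (h.1, Fin.cons s h.2) := by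
  have hm := (volume_preserving_piFinSuccAbove (fun _ : Ix n => ℝ) 0)
  have hmE : Measurable fun a : ℝ × ℝ × (Fin n → ℝ) =>
      G (a.1, (Fin.cons a.2.1 a.2.2 : Ix n → ℝ)) :=
    hG.comp (measurable_fst.prodMk (meas_cons.comp measurable_snd))
  have h0 : ∀ t : ℝ, ∫⁻ x : Ix n → ℝ, G (t, x) = ∫⁻ s : ℝ, ∫⁻ y : Fin n → ℝ,
      G (t, Fin.cons s y) := by
    intro t
    have hmt : Measurable fun a : ℝ × (Fin n → ℝ) => G (t, (Fin.cons a.1 a.2 : Ix n → ℝ)) :=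
      hG.comp (measurable_const.prodMk meas_cons)
    have := hm.lintegral_comp hmt
    rw [Measure.volume_eq_prod, lintegral_prod _ hmt.aemeasurable] at this
    rw [← this]
    refine lintegral_congr fun x => ?_
    congr 2
    funext j; refine Fin.cases ?_ (fun i => ?_) j
    · rfl
    · rfl
  rw [Measure.volume_eq_prod, lintegral_prod _ hG.aemeasurable]
  simp_rw [h0]
  rw [lintegral_lintegral_swap]
  · refine lintegral_congr fun s => ?_
    rw [Measure.volume_eq_prod, lintegral_prod]
    exact (hG.comp (measurable_fst.prodMk (meas_cons.comp
      (measurable_const.prodMk measurable_snd)))).aemeasurable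
  · refine Measurable.aemeasurable ?_
    exact Measurable.lintegral_prod_right' (f := fun a : (ℝ × ℝ) × (Fin n → ℝ) =>
      G (a.1.1, (Fin.cons a.1.2 a.2 : Ix n → ℝ)))
      (hG.comp ((measurable_fst.comp measurable_fst).prodMk (meas_cons.comp
        ((measurable_snd.comp measurable_fst).prodMk measurable_snd))))

def Bx (z : E n) : Set (E n) := {p | z.1 ≤ p.1 ∧ p.1 ≤ z.1 + 1 ∧ ∀ j, |p.2 j - z.2 j| ≤ 1}

theorem measurableSet_Bx (z : E n) : MeasurableSet (Bx z) := by
  unfold Bx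
  refine (measurableSet_le measurable_const measurable_fst).inter
    ((measurableSet_le measurable_fst measurable_const).inter ?_)
  have : {p : E n | ∀ j, |p.2 j - z.2 j| ≤ 1} = ⋂ j, {p : E n | |p.2 j - z.2 j| ≤ 1} := by
    ext; simp
  change MeasurableSet {p : E n | ∀ j, |p.2 j - z.2 j| ≤ 1}
  rw [this]
  exact MeasurableSet.iInter fun j => measurableSet_le (by fun_prop) measurable_const

theorem ker_fub {κ : TT n → ℝ} (hκ : Ker κ) : ∃ C : NNReal, ∀ (X : Fu n), Continuous X → ∀ z : E n,
    ∫⁻ s in I01, ∫⁻ h, ‖κ h‖ₑ * ‖X (z + s • ex 0 + iota h)‖ₑ ≤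
      C * ∫⁻ p in Bx z, ‖X p‖ₑ := by
  obtain ⟨C, hC⟩ := hκ.cs.exists_bound_of_continuous hκ.sm.continuous
  refine ⟨C.toNNReal, fun X hX z => ?_⟩
  have hcn : ∀ h, ‖κ h‖ₑ ≤ (C.toNNReal : ℝ≥0∞) := fun h => by
    rw [← ofReal_norm]; exact ofReal_le_ofReal (hC h)
  rw [← lintegral_indicator (measurableSet_Bx z), ← lintegral_add_left_eq_self _ z,
    lint_E, ← lintegral_const_mul]
  · rw [← lintegral_indicator measurableSet_Ioc]
    refine lintegral_mono fun s => ?_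
    by_cases hs : s ∈ I01
    · simp only [hs, Set.indicator_of_mem]
      rw [← lintegral_const_mul']
      · refine lintegral_mono fun h => ?_
        by_cases hh : κ h = 0
        · simp [hh]
        have hb := hκ.box hh
        have he : z + s • ex 0 + iota h = z + ((h.1, Fin.cons s h.2) : E n) := by
          rw [add_assoc]; congr 1
          refine Prod.ext (by simp [ex, iota_fst]) ?_
          funext j; refine Fin.cases ?_ (fun i => ?_) j
          · simp [ex, iota_zero]
          · simp [ex, iota_succ]
        have hmem : z + ((h.1, Fin.cons s h.2) : E n) ∈ Bx z := by
          refine ⟨by simp [hb.1], by simp [hb.2.1], fun j => ?_⟩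
          refine Fin.cases ?_ (fun i => ?_) j
          · simp [abs_of_pos hs.1, hs.2]
          · simp [hb.2.2]
        rw [he, Set.indicator_of_mem hmem]
        exact mul_le_mul' (hcn h) le_rfl
      · simp
    · simp [hs]
  · have hm : Measurable ((Bx z).indicator fun p => ‖X p‖ₑ) :=
      hX.measurable.enorm.indicator (measurableSet_Bx z)
    exact Measurable.lintegral_prod_right' (f := fun a : ℝ × TT n => (Bx z).indicator (fun p => ‖X p‖ₑ)
      (z + ((a.2.1, Fin.cons a.1 a.2.2) : E n))) (hm.comp (measurable_const.add
        ((measurable_fst.comp measurable_snd).prodMk (meas_cons.comp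
          (measurable_fst.prodMk (measurable_snd.comp measurable_snd))))))
  · have hm : Measurable ((Bx z).indicator fun p => ‖X p‖ₑ) :=
      hX.measurable.enorm.indicator (measurableSet_Bx z)
    exact hm.comp (measurable_const.add measurable_id)

theorem hasDeriv_line {g : Fu n} (hg : Sm g) (z v : E n) (s : ℝ) :
    HasDerivAt (fun s : ℝ => g (z + s • v)) (D v g (z + s • v)) s := by
  have h1 : HasDerivAt (fun s : ℝ => z + s • v) v s := by
    simpa using ((hasDerivAt_id s).smul_const v).const_add z
  exact (hg.diff (z + s • v)).hasFDerivAt.comp_hasDerivAt s h1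

theorem cont_line {g : Fu n} (hg : Sm g) (z v : E n) : Continuous fun s : ℝ => g (z + s • v) :=
  hg.cont.comp (by fun_prop)

theorem oned1 {g : Fu n} (hg : Sm g) (z v : E n) :
    ‖g z‖ₑ ≤ ∫⁻ s in I01, (‖g (z + s • v)‖ₑ + ‖D v g (z + s • v)‖ₑ) := by
  have h := intervalIntegral.integral_eq_sub_of_hasDerivAt (a := 0) (b := 1)
    (f := fun s : ℝ => (s - 1) * g (z + s • v))
    (f' := fun s => g (z + s • v) + (s - 1) * D v g (z + s • v)) (fun s _ => by
      simpa using ((hasDerivAt_id' s).sub_const 1).fun_mul (hasDeriv_line hg z v s))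
    (Continuous.intervalIntegrable ((cont_line hg z v).add
      ((by fun_prop : Continuous fun s : ℝ => s - 1).mul (cont_line (hg.D v) z v))) _ _)
  simp only [sub_self, zero_mul, zero_smul, add_zero, zero_sub, neg_mul, one_mul, neg_neg] at h
  rw [← h, intervalIntegral.integral_of_le zero_le_one]
  refine (enorm_integral_le_lintegral_enorm _).trans (setLIntegral_mono' measurableSet_Ioc
    fun s hs => (enorm_add_le _ _).trans ?_)
  gcongr
  rw [enorm_mul]
  refine mul_le_of_le_one_left' ?_
  rw [← ofReal_norm, ofReal_le_one, Real.norm_eq_abs, abs_le]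
  constructor <;> linarith [hs.1, hs.2]

theorem oned2 {g : Fu n} (hg : Sm g) (z v : E n) :
    ‖g z‖ₑ ≤ ∫⁻ s in I01, (4 * ‖g (z + s • v)‖ₑ + ‖D v (D v g) (z + s • v)‖ₑ) := by
  have h := intervalIntegral.integral_eq_sub_of_hasDerivAt (a := 0) (b := 1)
    (f := fun s : ℝ => (s - 2 * s ^ 2 + s ^ 3) * D v g (z + s • v) -
      (1 - 4 * s + 3 * s ^ 2) * g (z + s • v))
    (f' := fun s => (s - 2 * s ^ 2 + s ^ 3) * D v (D v g) (z + s • v) -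
      (-4 + 6 * s) * g (z + s • v)) (fun s _ => by
      have e1 : HasDerivAt (fun s : ℝ => s - 2 * s ^ 2 + s ^ 3) (1 - 4 * s + 3 * s ^ 2) s := by
        have := ((hasDerivAt_id' s).fun_sub ((hasDerivAt_pow 2 s).const_mul 2)).fun_add (hasDerivAt_pow 3 s)
        refine this.congr_deriv ?_
        simp; ring
      have e2 : HasDerivAt (fun s : ℝ => 1 - 4 * s + 3 * s ^ 2) (-4 + 6 * s) s := by
        have := (((hasDerivAt_id' s).const_mul 4).const_sub 1).fun_add ((hasDerivAt_pow 2 s).const_mul 3)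
        refine this.congr_deriv ?_
        simp; ring
      have := (e1.fun_mul (hasDeriv_line (hg.D v) z v s)).fun_sub (e2.fun_mul (hasDeriv_line hg z v s))
      refine this.congr_deriv ?_
      ring)
    (Continuous.intervalIntegrable (((by fun_prop : Continuous fun s : ℝ => s - 2 * s ^ 2 + s ^ 3).mul
      (cont_line ((hg.D v).D v) z v)).sub
      ((by fun_prop : Continuous fun s : ℝ => -4 + 6 * s).mul (cont_line hg z v))) _ _)
  norm_num at h
  rw [← h, intervalIntegral.integral_of_le zero_le_one]
  refine (enorm_integral_le_lintegral_enorm _).trans (setLIntegral_mono' measurableSet_Ioc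
    fun s hs => (enorm_sub_le).trans ?_)
  rw [add_comm]
  have := hs.1
  have := hs.2
  gcongr
  · rw [enorm_mul]
    gcongr
    rw [← ofReal_norm, Real.norm_eq_abs]
    refine ofReal_le_of_le_toReal ?_
    rw [abs_le]; norm_num; constructor <;> linarith
  rw [enorm_mul]
  refine mul_le_of_le_one_left' ?_
  rw [← ofReal_norm, ofReal_le_one, Real.norm_eq_abs, abs_le]
  constructor <;> nlinarith [mul_nonneg hs.1.le (sq_nonneg (1 - s)), mul_nonneg hs.1.le (mul_nonneg hs.1.le (sub_nonneg.2 hs.2))]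

theorem VV_et (u : Fu n) (p : E n) : ‖D et u p‖ₑ ≤ ‖VV u p‖ₑ := by
  refine enorm_le_iff_norm_le.2 ?_
  rw [Real.norm_eq_abs, Real.norm_eq_abs, abs_of_nonneg (VV_nonneg u p), VV]
  have : 0 ≤ ∑ j, ∑ k, |Dd j k u p| := by positivity
  linarith
theorem VV_exr (u : Fu n) (p : E n) (j k) : |Dd j k u p| ≤ VV u p := by
  have h1 : |Dd j k u p| ≤ ∑ k, |Dd j k u p| :=
    Finset.single_le_sum (f := fun k => |Dd j k u p|) (fun _ _ => abs_nonneg _) (Finset.mem_univ k)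
  have h2 : ∑ k, |Dd j k u p| ≤ ∑ j, ∑ k, |Dd j k u p| :=
    Finset.single_le_sum (f := fun j => ∑ k, |Dd j k u p|) (fun _ _ => by positivity) (Finset.mem_univ j)
  have := abs_nonneg (D et u p)
  unfold VV; linarith
theorem VV_ex (u : Fu n) (p : E n) (j k) : ‖Dd j k u p‖ₑ ≤ ‖VV u p‖ₑ := by
  refine enorm_le_iff_norm_le.2 ?_
  rw [Real.norm_eq_abs, Real.norm_eq_abs, abs_of_nonneg (VV_nonneg u p)]
  exact VV_exr u p j k

theorem sup_jk (j : Ix n) (k : Fin n) : ∃ C : NNReal, ∀ (u : Fu n), TF u → ∀ z,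
    ‖D (ex j) (D (ex k.succ) (Mk eta u)) z‖ₑ ≤ C * ∫⁻ p in Bx z, ‖VV u p‖ₑ := by
  obtain ⟨C1, h1⟩ := ker_fub (eta_ker (n := n))
  obtain ⟨C2, h2⟩ := ker_fub ((eta_ker (n := n)).D (0, Pi.single k 1))
  refine ⟨C1 + C2, fun u hu z => ?_⟩
  have e1 : D (ex j) (D (ex k.succ) (Mk eta u)) = Mk eta (D (ex j) (D (ex k.succ) u)) := by
    rw [Mk_D hu, Mk_D (hu.D _)]
  have e2 : D (ex 0) (D (ex j) (D (ex k.succ) (Mk eta u))) =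
      fun z => - Mk (fun x => fderiv ℝ eta x (0, Pi.single k 1)) (Dd 0 j u) z := by
    rw [e1, Mk_D ((hu.D _).D _), D_comm (hu.sm) (ex j), D_comm ((hu.sm).D _) (ex 0), ← iota_ex]
    funext z
    rw [Mk_ibp eta_ker ((hu.D _).D _)]
  refine (oned1 (((Mk_TF hu).D _).D _).sm z (ex 0)).trans ?_
  rw [lintegral_add_left, coe_add, add_mul]
  · refine add_le_add ((lintegral_mono fun s => ?_).trans ((h1 _ ((hu.D (ex k.succ)).D (ex j)).cont z).trans
      (mul_le_mul' le_rfl (lintegral_mono fun p => VV_ex u p _ _))))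
      ((lintegral_mono fun s => ?_).trans ((h2 _ ((hu.D (ex j)).D (ex 0)).cont z).trans
      (mul_le_mul' le_rfl (lintegral_mono fun p => VV_ex u p _ _))))
    · rw [e1]; exact Mk_le _ _ _
    · rw [e2, enorm_neg]; exact Mk_le _ _ _
  · exact (cont_line (((Mk_TF hu).D _).D _).sm z (ex 0)).measurable.enorm

theorem sup_t : ∃ C : NNReal, ∀ (u : Fu n), TF u → ∀ z,
    ‖D et (Mk eta u) z‖ₑ ≤ C * ∫⁻ p in Bx z, ‖VV u p‖ₑ := by
  obtain ⟨C1, h1⟩ := ker_fub (eta_ker (n := n))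
  obtain ⟨C2, h2⟩ := ker_fub ((eta_ker (n := n)).D (1, 0))
  refine ⟨4 * C1 + C2, fun u hu z => ?_⟩
  have e1 : D et (Mk eta u) = Mk eta (D et u) := by
    rw [Mk_D hu]
  have e2 : D (ex 0) (D (ex 0) (D et (Mk eta u))) =
      fun z => - Mk (fun x => fderiv ℝ eta x (1, 0)) (Dd 0 0 u) z := by
    rw [e1, Mk_D (hu.D _), Mk_D ((hu.D _).D _), D_comm (hu.sm) (ex 0), D_comm ((hu.sm).D _) (ex 0),
      ← iota_et]
    funext z
    rw [Mk_ibp eta_ker ((hu.D _).D _)]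
  refine (oned2 (((Mk_TF hu).D _)).sm z (ex 0)).trans ?_
  rw [lintegral_add_left, coe_add, add_mul, lintegral_const_mul' _ _ (by simp), coe_mul,
    mul_assoc]
  · refine add_le_add (mul_le_mul' (by simp) ((lintegral_mono fun s => ?_).trans ((h1 _ (hu.D et).cont z).trans
      (mul_le_mul' le_rfl (lintegral_mono fun p => VV_et u p)))))
      ((lintegral_mono fun s => ?_).trans ((h2 _ ((hu.D (ex 0)).D (ex 0)).cont z).trans
      (mul_le_mul' le_rfl (lintegral_mono fun p => VV_ex u p _ _))))
    · rw [e1]; exact Mk_le _ _ _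
    · rw [e2, enorm_neg]; exact Mk_le _ _ _
  · exact (cont_line (((Mk_TF hu).D _)).sm z (ex 0)).measurable.enorm.const_mul _

end

section
variable {n : ℕ}

def Adm (v : E n) : Prop := 0 ≤ v.1 ∧ v.1 ≤ 1 ∧ ∀ j, |v.2 j| ≤ 1

theorem diff1 {g : Fu n} (hg : Sm g) (z v : E n) :
    ‖g (z + v) - g z‖ₑ ≤ ∫⁻ s in I01, ‖D v g (z + s • v)‖ₑ := by
  have h := intervalIntegral.integral_eq_sub_of_hasDerivAt (a := 0) (b := 1)
    (f := fun s : ℝ => g (z + s • v)) (f' := fun s => D v g (z + s • v))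
    (fun s _ => hasDeriv_line hg z v s)
    (Continuous.intervalIntegrable (cont_line (hg.D v) z v) _ _)
  simp only [one_smul, zero_smul, add_zero] at h
  rw [← h, intervalIntegral.integral_of_le zero_le_one]
  exact enorm_integral_le_lintegral_enorm _

theorem taylor2 {g : Fu n} (hg : Sm g) (z v : E n) :
    ∫ s in I01, (1 - s) * D v (D v g) (z + s • v) = g (z + v) - g z - D v g z := by
  have h := intervalIntegral.integral_eq_sub_of_hasDerivAt (a := 0) (b := 1)
    (f := fun s : ℝ => (1 - s) * D v g (z + s • v) + g (z + s • v))
    (f' := fun s => (1 - s) * D v (D v g) (z + s • v))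
    (fun s _ => by
      have := (((hasDerivAt_id' s).const_sub 1).fun_mul (hasDeriv_line (hg.D v) z v s)).fun_add
        (hasDeriv_line hg z v s)
      refine this.congr_deriv ?_
      ring)
    (Continuous.intervalIntegrable ((by fun_prop : Continuous fun s : ℝ => 1 - s).mul
      (cont_line ((hg.D v).D v) z v)) _ _)
  rw [← intervalIntegral.integral_of_le zero_le_one, h]
  simp; ring

theorem taylor2_le {g : Fu n} (hg : Sm g) (z v : E n) :
    ‖g (z + v) - g z - D v g z‖ₑ ≤ ∫⁻ s in I01, ‖D v (D v g) (z + s • v)‖ₑ := by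
  rw [← taylor2 hg]
  refine (enorm_integral_le_lintegral_enorm _).trans (setLIntegral_mono' measurableSet_Ioc
    fun s hs => ?_)
  rw [enorm_mul]
  refine mul_le_of_le_one_left' ?_
  rw [← ofReal_norm, ofReal_le_one, Real.norm_eq_abs, abs_le]
  constructor <;> linarith [hs.1, hs.2]

theorem D_smul (c : ℝ) (v : E n) (u : Fu n) : D (c • v) u = fun p => c * D v u p := by
  funext p; simp [D]

theorem D_lin {b : E n} (hb : b.1 = 0) (u : Fu n) : D b u = fun p => ∑ j, b.2 j * D (ex j) u p := by
  funext p
  have h : b = ∑ j, b.2 j • (ex j : E n) := by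
    refine Prod.ext ?_ ?_
    · simp [hb, ex, Prod.fst_sum]
    · funext i; simp [ex, Prod.snd_sum, Pi.single_apply]
  conv_lhs => rw [h]
  simp [D]

theorem DD_le {b : E n} (hb : b.1 = 0) (hb' : ∀ j, |b.2 j| ≤ 1) {u : Fu n} (hu : Sm u) (p : E n) :
    ‖D b (D b u) p‖ₑ ≤ ‖VV u p‖ₑ := by
  refine enorm_le_iff_norm_le.2 ?_
  rw [Real.norm_eq_abs, Real.norm_eq_abs, abs_of_nonneg (VV_nonneg u p), D_lin hb (D b u), D_lin hb u]
  have h1 : ∀ j, D (ex j) (fun p => ∑ k, b.2 k * D (ex k) u p) p =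
      ∑ k, b.2 k * Dd j k u p := by
    intro j
    rw [D_sum (fun k _ => (Sm.const _).mul (hu.D _))]
    refine Finset.sum_congr rfl fun k _ => ?_
    rw [D_cmul (hu.D _)]
  simp only [h1]
  have : |∑ j, b.2 j * ∑ k, b.2 k * Dd j k u p| ≤
      ∑ j, ∑ k, |Dd j k u p| := by
    refine (Finset.abs_sum_le_sum_abs _ _).trans (Finset.sum_le_sum fun j _ => ?_)
    rw [abs_mul]
    refine (mul_le_of_le_one_left (abs_nonneg _) (hb' j)).trans ?_
    refine (Finset.abs_sum_le_sum_abs _ _).trans (Finset.sum_le_sum fun k _ => ?_)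
    rw [abs_mul]
    exact (mul_le_of_le_one_left (abs_nonneg _) (hb' k))
  have := abs_nonneg (D et u p)
  unfold VV; linarith

theorem shift01 {s : ℝ → E n} (hs : Measurable s)
    {S S' : Set (E n)} (hS : MeasurableSet S) (hS' : MeasurableSet S')
    (h : ∀ y ∈ I01, ∀ z ∈ S, z + s y ∈ S') {X : Fu n} (hX : Measurable X) {q : ℝ}
    (hq : 1 ≤ q) :
    eLpNorm (fun z => ∫⁻ y in I01, ‖X (z + s y)‖ₑ) (oR q) (volume.restrict S) ≤
      nq q S' X := by
  have hi : ∫⁻ y in I01, (I01).indicator 1 y = (1 : ℝ≥0∞) := by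
    rw [lintegral_indicator measurableSet_Ioc]; simp
  have := shift_avg (volume.restrict (I01)) hs
    (k := (I01).indicator 1) (measurable_one.indicator measurableSet_Ioc)
    (by rw [hi]; simp) hS hS' (fun y hy => h y (by by_contra h'; simp [h'] at hy)) hX hq
  rw [hi, one_mul] at this
  refine le_trans (le_of_eq ?_) this
  congr 1; funext z
  refine setLIntegral_congr_fun measurableSet_Ioc fun y hy => ?_
  simp [hy]

theorem nq_le3 {q : ℝ} (hq : 1 ≤ q) {F : Fu n} {S : Set (E n)} {G1 G2 G3 : E n → ℝ≥0∞}
    (m1 : Measurable G1) (m2 : Measurable G2) (m3 : Measurable G3)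
    (h : ∀ z, ‖F z‖ₑ ≤ G1 z + G2 z + G3 z) {a b c : ℝ≥0∞}
    (h1 : eLpNorm G1 (oR q) (volume.restrict S) ≤ a)
    (h2 : eLpNorm G2 (oR q) (volume.restrict S) ≤ b)
    (h3 : eLpNorm G3 (oR q) (volume.restrict S) ≤ c) : nq q S F ≤ a + b + c := by
  have hq' : 1 ≤ oR q := by simpa using hq
  have e0 : nq q S F ≤ eLpNorm (G1 + G2 + G3) (oR q) (volume.restrict S) :=
    eLpNorm_mono_enorm fun z => by rw [enorm_eq_self]; exact h z
  refine e0.trans ((eLpNorm_add_le (m1.add m2).aestronglyMeasurable m3.aestronglyMeasurable hq').trans ?_)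
  exact add_le_add ((eLpNorm_add_le m1.aestronglyMeasurable m2.aestronglyMeasurable hq').trans
    (add_le_add h1 h2)) h3

theorem grad_bd {q : ℝ} (hq : 1 ≤ q) {g : Fu n} (hg : TF g) (v : E n) {S S' : Set (E n)}
    (hS : MeasurableSet S) (hS' : MeasurableSet S') (hSS : S ⊆ S')
    (h : ∀ s ∈ I01, ∀ z ∈ S, z + s • v ∈ S') :
    nq q S (D v g) ≤ 2 * nq q S' g + nq q S' (D v (D v g)) := by
  have hq' : 1 ≤ oR q := by simpa using hq
  have m1 : Measurable fun z => ∫⁻ s in I01, ‖D v (D v g) (z + s • v)‖ₑ := by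
    refine Measurable.lintegral_prod_right' (f := fun a : E n × ℝ => ‖D v (D v g) (a.1 + a.2 • v)‖ₑ) ?_
    exact ((hg.D v).D v).cont.measurable.enorm.comp (by fun_prop)
  have m2 : Measurable fun z => ‖g (z + v)‖ₑ := (hg.cont.comp (by fun_prop)).measurable.enorm
  have m3 : Measurable fun z => ‖g z‖ₑ := hg.cont.measurable.enorm
  have e1 : ∀ z, ‖D v g z‖ₑ ≤ ‖g (z + v)‖ₑ + ‖g z‖ₑ +
      ∫⁻ s in I01, ‖D v (D v g) (z + s • v)‖ₑ := by
    intro z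
    have := taylor2_le hg.sm z v
    have e : D v g z = (g (z + v) - g z) - (g (z + v) - g z - D v g z) := by ring
    rw [e]
    refine enorm_sub_le.trans (add_le_add enorm_sub_le this)
  have hs1 : eLpNorm (fun z => ‖g (z + v)‖ₑ) (oR q) (volume.restrict S) ≤ nq q S' g := by
    have := shift01 (s := fun _ => v) measurable_const hS hS' (fun y _ z hz => by
      simpa using h 1 (by simp) z hz) hg.cont.measurable hq
    refine le_trans (le_of_eq ?_) this
    congr 1; funext z; simp
  have hs2 : eLpNorm (fun z => ‖g z‖ₑ) (oR q) (volume.restrict S) ≤ nq q S' g := by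
    have := shift01 (s := fun _ => (0 : E n)) measurable_const hS hS' (fun y _ z hz => by
      simpa using hSS hz) hg.cont.measurable hq
    refine le_trans (le_of_eq ?_) this
    congr 1; funext z; simp
  have hs3 := shift01 (s := fun s => s • v) (by fun_prop) hS hS' h ((hg.D v).D v).cont.measurable hq
  rw [two_mul]
  exact nq_le3 hq m2 m3 m1 e1 hs1 hs2 hs3

theorem Mk_nq {q : ℝ} (hq : 1 ≤ q) {X : Fu n} (hX : Measurable X) {S S' : Set (E n)}
    (hS : MeasurableSet S) (hS' : MeasurableSet S')
    (h : ∀ v, Adm v → ∀ z ∈ S, z + v ∈ S') :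
    nq q S (Mk eta X) ≤ nq q S' X := by
  have hi : ∫⁻ h : TT n, ‖eta h‖ₑ = 1 := by
    rw [← eta_lint (n := n)]
    refine lintegral_congr fun h => ?_
    rw [Real.enorm_eq_ofReal (eta_nonneg h)]
  have := shift_avg (volume : Measure (TT n)) (s := fun h => iota h) iota.continuous.measurable
    (k := fun h => ‖eta h‖ₑ) eta_sm.continuous.measurable.enorm (by rw [hi]; simp) hS hS'
    (fun y hy => h _ ?_) hX hq
  · rw [hi, one_mul] at this
    refine le_trans (eLpNorm_mono_enorm fun z => ?_) this
    rw [enorm_eq_self]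
    exact Mk_le _ _ _
  · have hb := eta_ker.box (enorm_ne_zero.1 hy)
    refine ⟨hb.1, hb.2.1, fun j => ?_⟩
    refine Fin.cases ?_ (fun i => ?_) j
    · simp [iota_zero]
    · rw [iota_succ]; exact hb.2.2 i

end

section
variable {n : ℕ}

theorem eta_enorm : ∫⁻ h : TT n, ‖eta h‖ₑ = 1 := by
  rw [← eta_lint (n := n)]
  refine lintegral_congr fun h => ?_
  rw [Real.enorm_eq_ofReal (eta_nonneg h)]

theorem shiftT_meas {sh : TT n × ℝ → E n} (hs : Measurable sh) {X : Fu n} (hX : Measurable X) :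
    Measurable fun z => ∫⁻ h : TT n, ‖eta h‖ₑ * ∫⁻ s in I01, ‖X (z + sh (h, s))‖ₑ := by
  refine Measurable.lintegral_prod_right' (f := fun a : E n × TT n => ‖eta a.2‖ₑ *
    ∫⁻ s in I01, ‖X (a.1 + sh (a.2, s))‖ₑ) ?_
  refine Measurable.mul (eta_sm.continuous.measurable.enorm.comp measurable_snd) ?_
  refine Measurable.lintegral_prod_right' (f := fun a : (E n × TT n) × ℝ =>
    ‖X (a.1.1 + sh (a.1.2, a.2))‖ₑ) ?_
  exact hX.enorm.comp ((measurable_fst.comp measurable_fst).add (hs.comp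
    ((measurable_snd.comp measurable_fst).prodMk measurable_snd)))

theorem shiftT {sh : TT n × ℝ → E n} (hs : Measurable sh)
    {S S' : Set (E n)} (hS : MeasurableSet S) (hS' : MeasurableSet S')
    (hA : ∀ h s, eta h ≠ 0 → s ∈ I01 → Adm (sh (h, s)))
    (h : ∀ v, Adm v → ∀ z ∈ S, z + v ∈ S') {X : Fu n} (hX : Measurable X) {q : ℝ}
    (hq : 1 ≤ q) :
    eLpNorm (fun z => ∫⁻ h : TT n, ‖eta h‖ₑ * ∫⁻ s in I01, ‖X (z + sh (h, s))‖ₑ)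
      (oR q) (volume.restrict S) ≤ nq q S' X := by
  have hkm : Measurable fun a : TT n × ℝ => ‖eta a.1‖ₑ * (I01).indicator 1 a.2 :=
    (eta_sm.continuous.measurable.enorm.comp measurable_fst).mul
      ((measurable_one.indicator measurableSet_Ioc).comp measurable_snd)
  have hi : ∫⁻ a : TT n × ℝ, ‖eta a.1‖ₑ * (I01).indicator 1 a.2 = 1 := by
    rw [Measure.volume_eq_prod, lintegral_prod _ hkm.aemeasurable]
    have : ∀ x : TT n, ∫⁻ y : ℝ, ‖eta x‖ₑ * (I01).indicator 1 y = ‖eta x‖ₑ := by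
      intro x
      rw [lintegral_const_mul _ (measurable_one.indicator measurableSet_Ioc),
        lintegral_indicator measurableSet_Ioc]
      simp
    simp only [this, eta_enorm]
  have := shift_avg (volume : Measure (TT n × ℝ)) hs hkm (by rw [hi]; simp) hS hS' (fun y hy => h _ ?_) hX hq
  · rw [hi, one_mul] at this
    refine le_trans (le_of_eq ?_) this
    congr 1; funext z
    have hm : Measurable fun y : TT n × ℝ => ‖X (z + sh y)‖ₑ :=
      hX.enorm.comp (measurable_const.add hs)
    have hp : ∫⁻ y : TT n × ℝ, ‖eta y.1‖ₑ * (I01).indicator 1 y.2 * ‖X (z + sh y)‖ₑ =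
        ∫⁻ x : TT n, ∫⁻ y : ℝ, ‖eta x‖ₑ * (I01).indicator 1 y * ‖X (z + sh (x, y))‖ₑ :=
      lintegral_prod (fun y : TT n × ℝ => ‖eta y.1‖ₑ * (I01).indicator 1 y.2 * ‖X (z + sh y)‖ₑ)
        (hkm.mul hm).aemeasurable
    rw [hp]
    refine lintegral_congr fun x => ?_
    simp only [mul_assoc]
    rw [lintegral_const_mul]
    · rw [← lintegral_indicator measurableSet_Ioc]
      congr 2; funext y
      by_cases hy : y ∈ I01 <;> simp [hy]
    · exact ((measurable_one.indicator measurableSet_Ioc)).mul (hm.comp (measurable_const.prodMk measurable_id))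
  · refine hA y.1 y.2 (fun h0 => hy (by simp [h0])) ?_
    by_contra h0
    exact hy (by simp [h0])

noncomputable def bh (h : TT n) : E n := iota (0, h.2)

theorem bh_cont : Continuous (bh (n := n)) := iota.continuous.comp (by fun_prop)
theorem bh_fst (h : TT n) : (bh h).1 = 0 := rfl
theorem bh_abs {h : TT n} (hh : ∀ j, |h.2 j| ≤ 1) (j) : |(bh h).2 j| ≤ 1 := by
  refine Fin.cases ?_ (fun i => ?_) j
  · simp [bh, iota_zero]
  · exact hh i
theorem iota_bh (h : TT n) : iota h = h.1 • et + bh h := by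
  refine Prod.ext (by simp [iota_fst, et, bh]) ?_
  funext j; refine Fin.cases ?_ (fun i => ?_) j
  · simp [bh, iota_zero, et]
  · simp [bh, iota_succ, et]
theorem bh_refl (h : TT n) : bh ((1, 0) - h) = - bh h := by
  refine Prod.ext (by simp [bh_fst]) ?_
  funext j; refine Fin.cases ?_ (fun i => ?_) j
  · simp [bh, iota_zero]
  · simp [bh, iota_succ]

theorem eta_refl (h : TT n) : eta ((1, 0) - h) = eta h := by
  have := (bumpT n).normed_sub (μ := volume) (h - (1/2, 0))
  have e1 : ((1/2, 0) : TT n) - (h - (1/2, 0)) = (1, 0) - h := by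
    refine Prod.ext ?_ ?_
    · simp; ring
    · simp
  have e2 : ((1/2, 0) : TT n) + (h - (1/2, 0)) = h := by abel
  rw [e1, e2] at this
  exact this

theorem ek_int {F : TT n → ℝ} (hF : Continuous F) : Integrable fun h => eta h * F h :=
  (eta_sm.continuous.mul hF).integrable_of_hasCompactSupport eta_cs.mul_right

theorem w_id {u : Fu n} (hu : Continuous u) (z : E n) :
    u z - Mk eta u z = ∫ h : TT n, eta h * ((u z - u (z + (1/2:ℝ) • et)) +
      (1/2) * (2 * u (z + (1/2:ℝ) • et) - u (z + (1/2:ℝ) • et + bh h) - u (z + (1/2:ℝ) • et - bh h)) +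
      (u (z + (1/2:ℝ) • et + bh h) - u (z + iota h))) := by
  set y := z + (1/2:ℝ) • (et : E n)
  have hb := bh_cont (n := n)
  have c1 : Continuous fun h : TT n => u (y + bh h) := hu.comp (by fun_prop)
  have c2 : Continuous fun h : TT n => u (y - bh h) := hu.comp (by fun_prop)
  have c3 : Continuous fun h : TT n => u (z + iota h) := hu.comp (by fun_prop)
  have sy : ∫ h : TT n, eta h * u (y - bh h) = ∫ h : TT n, eta h * u (y + bh h) := by
    rw [← integral_sub_left_eq_self (fun h : TT n => eta h * u (y + bh h)) volume (1, 0)]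
    simp only [eta_refl, bh_refl]
    simp only [sub_eq_add_neg]
  have e : (fun h : TT n => eta h * ((u z - u y) + (1/2) * (2 * u y - u (y + bh h) - u (y - bh h)) +
      (u (y + bh h) - u (z + iota h)))) = fun h => u z * eta h + (1/2) * (eta h * u (y + bh h)) -
      (1/2) * (eta h * u (y - bh h)) - eta h * u (z + iota h) := by
    funext h; ring
  have i1 := ek_int c1
  have i2 := ek_int c2
  have i3 := ek_int c3
  have i0 : Integrable (eta (n := n)) := eta_sm.continuous.integrable_of_hasCompactSupport eta_cs
  have j1 : Integrable (fun h : TT n => u z * eta h + (1/2) * (eta h * u (y + bh h))) :=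
    (i0.const_mul _).add (i1.const_mul _)
  have j2 : Integrable (fun h : TT n => u z * eta h + (1/2) * (eta h * u (y + bh h)) -
      (1/2) * (eta h * u (y - bh h))) := j1.sub (i2.const_mul _)
  rw [e, integral_sub j2 i3, integral_sub j1 (i2.const_mul _),
    integral_add (i0.const_mul _) (i1.const_mul _), integral_const_mul, integral_const_mul,
    integral_const_mul, sy, eta_int, Mk]
  ring

theorem w_pt {u : Fu n} (hu : TF u) (z : E n) :
    ‖u z - Mk eta u z‖ₑ ≤
      (∫⁻ h : TT n, ‖eta h‖ₑ * ∫⁻ s in I01, ‖VV u (z + (s * (1/2)) • et)‖ₑ) +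
      ((∫⁻ h : TT n, ‖eta h‖ₑ * ∫⁻ s in I01, ‖VV u (z + ((1/2:ℝ) • et + s • bh h))‖ₑ) +
       (∫⁻ h : TT n, ‖eta h‖ₑ * ∫⁻ s in I01, ‖VV u (z + ((1/2:ℝ) • et - s • bh h))‖ₑ)) +
      (∫⁻ h : TT n, ‖eta h‖ₑ * ∫⁻ s in I01,
        ‖VV u (z + ((1/2 + s * (h.1 - 1/2)) • et + bh h))‖ₑ) := by
  have hV := hu.contV.measurable
  have hb := (bh_cont (n := n)).measurable
  have mm : ∀ (sh : TT n × ℝ → E n) (hs : Measurable sh), Measurable fun h : TT n => ‖eta h‖ₑ *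
      ∫⁻ s in I01, ‖VV u (z + sh (h, s))‖ₑ := by
    intro sh hs
    refine Measurable.mul (eta_sm.continuous.measurable.enorm) ?_
    refine Measurable.lintegral_prod_right' (f := fun a : TT n × ℝ => ‖VV u (z + sh a)‖ₑ) ?_
    exact hV.enorm.comp (measurable_const.add hs)
  have a1 := mm (fun a => (a.2 * (1/2)) • et) (by fun_prop)
  have a2 := mm (fun a => ((1/2:ℝ) • et + a.2 • bh a.1)) (by fun_prop)
  have a3 := mm (fun a => ((1/2:ℝ) • et - a.2 • bh a.1)) (by fun_prop)
  have a4 := mm (fun a => ((1/2 + a.2 * (a.1.1 - 1/2)) • et + bh a.1)) (by fun_prop)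
  rw [← lintegral_add_left a2, ← lintegral_add_left a1, ← lintegral_add_right _ a4, w_id hu.cont z]
  refine (enorm_integral_le_lintegral_enorm _).trans (lintegral_mono fun h => ?_)
  rw [enorm_mul, ← mul_add, ← mul_add, ← mul_add]
  by_cases hh : eta h = 0
  · simp [hh]
  obtain ⟨hb1, hb2, hb3⟩ := eta_ker.box hh
  refine mul_le_mul' le_rfl ((enorm_add_le _ _).trans (add_le_add ((enorm_add_le _ _).trans
    (add_le_add ?_ ?_)) ?_))
  · rw [← enorm_neg, neg_sub]
    refine (diff1 hu.sm z _).trans (lintegral_mono fun s => ?_)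
    rw [D_smul, smul_smul, enorm_mul]
    refine (mul_le_of_le_one_left' ?_).trans (VV_et _ _)
    rw [← ofReal_norm, ofReal_le_one]; norm_num
  · have t1 := taylor2_le hu.sm (z + (1/2:ℝ) • et) (bh h)
    have t2 := taylor2_le hu.sm (z + (1/2:ℝ) • et) (- bh h)
    have ed : D (-bh h) u (z + (1/2:ℝ) • et) = - D (bh h) u (z + (1/2:ℝ) • et) := by simp [D]
    have e : (1 / 2) * (2 * u (z + (1/2:ℝ) • et) - u (z + (1/2:ℝ) • et + bh h) - u (z + (1/2:ℝ) • et - bh h)) =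
      (-(1/2)) * (u (z + (1/2:ℝ) • et + bh h) - u (z + (1/2:ℝ) • et) - D (bh h) u (z + (1/2:ℝ) • et)) +
      (-(1/2)) * (u (z + (1/2:ℝ) • et + -bh h) - u (z + (1/2:ℝ) • et) - D (-bh h) u (z + (1/2:ℝ) • et)) := by
      rw [ed, sub_eq_add_neg (z + (1/2:ℝ) • et) (bh h)]; ring
    have hle : ‖(-(1/2) : ℝ)‖ₑ ≤ 1 := by
      rw [← ofReal_norm, ofReal_le_one]; norm_num
    rw [e]
    refine (enorm_add_le _ _).trans (add_le_add ?_ ?_)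
    · rw [enorm_mul]
      refine (mul_le_of_le_one_left' hle).trans (t1.trans (lintegral_mono fun s => ?_))
      rw [add_assoc]
      exact DD_le (bh_fst h) (bh_abs hb3) hu.sm _
    · rw [enorm_mul]
      refine (mul_le_of_le_one_left' hle).trans (t2.trans (lintegral_mono fun s => ?_))
      rw [add_assoc, smul_neg, ← sub_eq_add_neg]
      exact DD_le (by simp [bh_fst]) (fun j => by simpa using bh_abs hb3 j) hu.sm _
  · rw [← enorm_neg, neg_sub]
    have e : z + iota h = (z + (1/2:ℝ) • et + bh h) + (h.1 - 1/2) • et := by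
      rw [iota_bh, sub_smul]; abel
    rw [e]
    refine (diff1 hu.sm _ _).trans (lintegral_mono fun s => ?_)
    rw [D_smul, smul_smul, enorm_mul]
    have e2 : z + (1/2:ℝ) • et + bh h + (s * (h.1 - 1/2)) • et =
      z + ((1/2 + s * (h.1 - 1/2)) • et + bh h) := by
      rw [add_smul]; abel
    rw [e2]
    refine (mul_le_of_le_one_left' ?_).trans (VV_et _ _)
    rw [← ofReal_norm, ofReal_le_one, Real.norm_eq_abs, abs_le]
    constructor <;> linarith

theorem w_nq {q : ℝ} (hq : 1 ≤ q) {u : Fu n} (hu : TF u) {S S' : Set (E n)}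
    (hS : MeasurableSet S) (hS' : MeasurableSet S')
    (h : ∀ v, Adm v → ∀ z ∈ S, z + v ∈ S') :
    nq q S (fun z => u z - Mk eta u z) ≤ 4 * nq q S' (VV u) := by
  have hV := hu.contV.measurable
  have hb := (bh_cont (n := n)).measurable
  have k1 : Measurable (fun a : TT n × ℝ => ((a.2 * (1/2)) • et : E n)) := by fun_prop
  have k2 : Measurable (fun a : TT n × ℝ => ((1/2:ℝ) • et + a.2 • bh a.1 : E n)) := by fun_prop
  have k3 : Measurable (fun a : TT n × ℝ => ((1/2:ℝ) • et - a.2 • bh a.1 : E n)) := by fun_prop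
  have k4 : Measurable (fun a : TT n × ℝ => ((1/2 + a.2 * (a.1.1 - 1/2)) • et + bh a.1 : E n)) := by
    fun_prop
  have hs : ∀ {s : ℝ} {j} {h : TT n}, eta h ≠ 0 → s ∈ I01 → |s * (bh h).2 j| ≤ 1 := by
    intro s j h hh hs
    rw [abs_mul, abs_of_pos hs.1]
    exact mul_le_one₀ hs.2 (abs_nonneg _) (bh_abs (eta_ker.box hh).2.2 j)
  have l2 := shiftT k2 hS hS' (fun h s hh hs' => ⟨by simp [et, bh_fst], by simp [et, bh_fst]; norm_num,
    fun j => by simpa [et] using hs hh hs'⟩) h hV hq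
  have l3 := shiftT k3 hS hS' (fun h s hh hs' => ⟨by simp [et, bh_fst], by simp [et, bh_fst]; norm_num,
    fun j => by simpa [et] using hs hh hs'⟩) h hV hq
  have l1 := shiftT k1 hS hS' (fun h s hh hs' => ⟨by simp [et]; linarith [hs'.1],
    by simp [et]; linarith [hs'.2], fun j => by simp [et]⟩) h hV hq
  have l4 := shiftT k4 hS hS' (fun h s hh hs' => by
    obtain ⟨hb1, hb2, hb3⟩ := eta_ker.box hh
    obtain ⟨hs1, hs2⟩ := hs'
    refine ⟨?_, ?_, fun j => by simpa [et] using bh_abs hb3 j⟩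
    · simp [et, bh_fst]; nlinarith
    · simp [et, bh_fst]; nlinarith) h hV hq
  have hq' : 1 ≤ oR q := by simpa using hq
  have M2 := shiftT_meas (n := n) k2 hV
  have M3 := shiftT_meas (n := n) k3 hV
  have l23 := (eLpNorm_add_le (μ := volume.restrict S) M2.aestronglyMeasurable M3.aestronglyMeasurable hq').trans
    (add_le_add l2 l3)
  have := nq_le3 hq (shiftT_meas (n := n) k1 hV) (M2.add M3) (shiftT_meas (n := n) k4 hV)
    (fun z => w_pt hu z) l1 l23 l4
  refine this.trans (le_of_eq ?_)
  ring

end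

section
variable {n : ℕ}

def Cy (z : E n) (r : ℝ) : Set (E n) := {p | |p.1 - z.1| < r ^ 2 ∧ ∀ j, |p.2 j - z.2 j| < r}

def sc (z : E n) (r : ℝ) (p : E n) : E n := (z.1 + r ^ 2 * p.1, z.2 + r • p.2)

theorem Cy_prod (z : E n) {r : ℝ} : Cy z r =
    Set.Ioo (z.1 - r ^ 2) (z.1 + r ^ 2) ×ˢ Set.pi Set.univ fun j => Set.Ioo (z.2 j - r) (z.2 j + r) := by
  ext p
  simp only [Cy, Set.mem_setOf_eq, Set.mem_prod, Set.mem_pi, Set.mem_univ, true_implies, Set.mem_Ioo,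
    abs_lt]
  constructor
  · rintro ⟨⟨h1, h2⟩, h3⟩
    exact ⟨⟨by linarith, by linarith⟩, fun j => ⟨by linarith [(h3 j).1], by linarith [(h3 j).2]⟩⟩
  · rintro ⟨⟨h1, h2⟩, h3⟩
    exact ⟨⟨by linarith, by linarith⟩, fun j => ⟨by linarith [(h3 j).1], by linarith [(h3 j).2]⟩⟩

theorem isOpen_Cy (z : E n) (r : ℝ) : IsOpen (Cy z r) := by
  rw [Cy_prod]; exact isOpen_Ioo.prod (isOpen_set_pi Set.finite_univ fun j _ => isOpen_Ioo)

theorem meas_Cy (z : E n) (r : ℝ) : MeasurableSet (Cy z r) := (isOpen_Cy z r).measurableSet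

theorem vol_Cy (z : E n) {r : ℝ} (hr : 0 < r) :
    volume (Cy z r) = oR (2 ^ (n + 2) * r ^ (n + 3)) := by
  rw [Cy_prod, Measure.volume_eq_prod, Measure.prod_prod, Real.volume_Ioo, Real.volume_pi_Ioo]
  have : ∀ j : Ix n, z.2 j + r - (z.2 j - r) = 2 * r := fun j => by ring
  simp only [this]
  rw [Finset.prod_const, ← ofReal_pow (by positivity), ← ofReal_mul]
  · congr 1; simp; ring
  · nlinarith [sq_nonneg r]

theorem sc_cont (z : E n) (r : ℝ) : Continuous (sc z r) := by unfold sc; fun_prop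

theorem sc_map (z : E n) {r : ℝ} (hr : 0 < r) :
    Measure.map (sc z r) volume = oR ((r ^ (n + 3))⁻¹) • (volume : Measure (E n)) := by
  have key : ∀ {F : Type} [NormedAddCommGroup F] [NormedSpace ℝ F] [MeasurableSpace F] [BorelSpace F]
      [FiniteDimensional ℝ F] (μ : Measure F) [μ.IsAddHaarMeasure] (a : F) (c : ℝ), 0 < c →
      Measure.map (fun x => a + c • x) μ = oR ((c ^ (Module.finrank ℝ F))⁻¹) • μ := by
    intro F _ _ _ _ _ μ _ a c hc
    have : (fun x => a + c • x) = (fun x => a + x) ∘ (fun x : F => c • x) := rfl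
    rw [this, ← Measure.map_map (measurable_const_add a) (measurable_const_smul c),
      Measure.map_addHaar_smul μ hc.ne', Measure.map_smul, map_add_left_eq_self,
      abs_of_nonneg (by positivity)]
  have h1 := key (volume : Measure ℝ) z.1 (r ^ 2) (by positivity)
  have h2 := key (volume : Measure (Ix n → ℝ)) z.2 r hr
  have e : sc z r = Prod.map (fun x => z.1 + (r ^ 2) • x) (fun x => z.2 + r • x) := by
    funext p; simp [sc, Prod.map]
  rw [e, Measure.volume_eq_prod, ← Measure.map_prod_map _ _ (by fun_prop) (by fun_prop), h1, h2,
    Measure.prod_smul_left, Measure.prod_smul_right, smul_smul, ← ofReal_mul (by positivity)]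
  congr 2
  simp
  rw [← mul_inv]; ring

theorem sc_lint (z : E n) {r : ℝ} (hr : 0 < r) {f : E n → ℝ≥0∞} (hf : Measurable f) (S : Set (E n))
    (hS : MeasurableSet S) :
    ∫⁻ p in sc z r ⁻¹' S, f (sc z r p) = oR ((r ^ (n + 3))⁻¹) * ∫⁻ p in S, f p := by
  rw [← setLIntegral_map hS hf (sc_cont z r).measurable, sc_map z hr, Measure.restrict_smul,
    lintegral_smul_measure, smul_eq_mul]

theorem sc_Cy (z : E n) {r ρ : ℝ} (hr : 0 < r) : sc z r ⁻¹' (Cy z (r * ρ)) = Cy 0 ρ := by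
  ext p
  have h2 : 0 < r ^ 2 := by positivity
  simp only [Cy, sc, Set.mem_preimage, Set.mem_setOf_eq, add_sub_cancel_left, Prod.fst_zero, sub_zero,
    Prod.snd_zero, Pi.add_apply, Pi.smul_apply, smul_eq_mul, Pi.zero_apply, abs_mul, abs_of_pos hr,
    abs_of_pos h2, mul_pow, mul_lt_mul_iff_right₀ h2, mul_lt_mul_iff_right₀ hr]

theorem sc_Hs (z : E n) {r τ : ℝ} (hr : 0 < r) : sc z r ⁻¹' (Hs τ) = Hs ((τ - z.1) / r ^ 2) := by
  ext p
  have h2 : 0 < r ^ 2 := by positivity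
  simp only [Hs, sc, Set.mem_preimage, Set.mem_setOf_eq, div_lt_iff₀ h2]
  constructor <;> intro h <;> linarith

theorem sc_sm {u : Fu n} (hu : Sm u) (z : E n) (r : ℝ) : Sm (fun p => u (sc z r p)) :=
  ContDiff.comp hu (by unfold sc; fun_prop)

theorem sc_inj (z : E n) {r : ℝ} (hr : 0 < r) (q : E n) : sc z r ((q.1 - z.1) / r ^ 2, r⁻¹ • (q.2 - z.2)) = q := by
  refine Prod.ext ?_ ?_
  · simp only [sc]; field_simp; ring
  · simp [sc, smul_smul, hr.ne']

theorem sc_TF {u : Fu n} (hu : TF u) (z : E n) {r : ℝ} (hr : 0 < r) : TF (fun p => u (sc z r p)) := by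
  refine ⟨sc_sm hu.sm z r, ?_⟩
  have : IsCompact ((fun q : E n => (((q.1 - z.1) / r ^ 2, r⁻¹ • (q.2 - z.2)) : E n)) '' tsupport u) :=
    hu.cs.isCompact.image (by fun_prop)
  refine HasCompactSupport.intro this fun p hp => ?_
  refine image_eq_zero_of_notMem_tsupport fun h => hp ⟨_, h, ?_⟩
  have h2 : r ^ 2 ≠ 0 := by positivity
  refine Prod.ext ?_ ?_
  · simp only [sc]; field_simp; ring
  · simp [sc, smul_smul, hr.ne']

theorem sc_D {u : Fu n} (hu : Sm u) (z : E n) (r : ℝ) (v : E n) (p : E n) :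
    D v (fun p => u (sc z r p)) p = D (r ^ 2 * v.1, r • v.2) u (sc z r p) := by
  have h1 : HasFDerivAt (sc z r) ((r ^ 2 • ContinuousLinearMap.fst ℝ ℝ (Ix n → ℝ)).prod
      (r • ContinuousLinearMap.snd ℝ ℝ (Ix n → ℝ))) p := by
    refine HasFDerivAt.prodMk ?_ ?_
    · exact ((hasFDerivAt_fst.const_mul (r ^ 2))).const_add _
    · exact ((hasFDerivAt_snd.const_smul r)).const_add _
  have h2 := ((hu.diff (sc z r p)).hasFDerivAt.comp p h1).fderiv
  simp only [D]
  have : (fun p => u (sc z r p)) = u ∘ sc z r := rfl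
  rw [this, h2]
  simp

theorem sc_Dt {u : Fu n} (hu : Sm u) (z : E n) (r : ℝ) :
    D et (fun p => u (sc z r p)) = fun p => r ^ 2 * D et u (sc z r p) := by
  funext p
  rw [sc_D hu]
  have : ((r ^ 2 * (et : E n).1, r • (et : E n).2) : E n) = (r ^ 2) • et := by simp [et]
  rw [this, D_smul]

theorem sc_Dx {u : Fu n} (hu : Sm u) (z : E n) (r : ℝ) (j) :
    D (ex j) (fun p => u (sc z r p)) = fun p => r * D (ex j) u (sc z r p) := by
  funext p
  rw [sc_D hu]
  have : ((r ^ 2 * (ex j : E n).1, r • (ex j : E n).2) : E n) = r • ex j := by simp [ex]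
  rw [this, D_smul]

theorem sc_Dxx {u : Fu n} (hu : Sm u) (z : E n) (r : ℝ) (j k) :
    D (ex j) (D (ex k) (fun p => u (sc z r p))) = fun p => r ^ 2 * Dd j k u (sc z r p) := by
  rw [sc_Dx hu, D_cmul (sc_sm (hu.D _) z r), sc_Dx (hu.D _)]
  funext p; ring

noncomputable def Pa {n : ℕ} (a : E n → Mx n) (u : Fu n) : E n → ℝ :=
  fun p => D et u p + (∑ j, ∑ k, a p j k * Dd j k u p)

noncomputable def G1 {n : ℕ} (u : Fu n) (p : E n) : ℝ := |u p| + ∑ k, |D (ex k) u p|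

theorem G1_nonneg (u : Fu n) (p : E n) : 0 ≤ G1 u p := by unfold G1; positivity

theorem Pa_mul {a : E n → Mx n} {ζ u : Fu n} (hζ : Sm ζ) (hu : Sm u)
    (p : E n) : Pa a (fun p => ζ p * u p) p = ζ p * Pa a u p + (u p * Pa a ζ p +
      ∑ j, ∑ k, a p j k * (D (ex j) ζ p * D (ex k) u p + D (ex k) ζ p * D (ex j) u p)) := by
  unfold Pa
  have h1 : ∀ j k, D (ex j) (D (ex k) (fun p => ζ p * u p)) p = ζ p * Dd j k u p +
      u p * Dd j k ζ p + (D (ex j) ζ p * D (ex k) u p + D (ex k) ζ p * D (ex j) u p) := by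
    intro j k
    rw [D_mul hζ hu, D_add ((hζ.D _).mul hu) (hζ.mul (hu.D _)), D_mul (hζ.D _) hu, D_mul hζ (hu.D _)]
    ring
  simp only [h1]
  simp only [D_mul hζ hu, mul_add, Finset.sum_add_distrib, Finset.mul_sum]
  simp only [mul_left_comm]
  ring

theorem Pa_comm_le {a : E n → Mx n} {M B : ℝ} {ζ u : Fu n} (hζ : Sm ζ)
    (hu : Sm u) (p : E n) (hM : ∀ j k, |a p j k| ≤ M) (h0 : |D et ζ p| ≤ B)
    (h1 : ∀ j, |D (ex j) ζ p| ≤ B) (h2 : ∀ j k, |Dd j k ζ p| ≤ B) :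
    |Pa a (fun p => ζ p * u p) p - ζ p * Pa a u p| ≤ (1 + 2 * (n + 1) ^ 2 * M) * B * G1 u p := by
  have hB : 0 ≤ B := (abs_nonneg _).trans h0
  have hM0 : 0 ≤ M := (abs_nonneg _).trans (hM 0 0)
  rw [Pa_mul hζ hu, add_sub_cancel_left]
  have e1 : |Pa a ζ p| ≤ (1 + (n+1) ^ 2 * M) * B := by
    unfold Pa
    refine (abs_add_le _ _).trans ?_
    have : |∑ j, ∑ k, a p j k * Dd j k ζ p| ≤ ∑ j : Ix n, ∑ k : Ix n, M * B := by
      refine (Finset.abs_sum_le_sum_abs _ _).trans (Finset.sum_le_sum fun j _ =>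
        (Finset.abs_sum_le_sum_abs _ _).trans (Finset.sum_le_sum fun k _ => ?_))
      rw [abs_mul]; exact mul_le_mul (hM j k) (h2 j k) (abs_nonneg _) hM0
    simp at this
    nlinarith
  have e2 : |∑ j, ∑ k, a p j k * (D (ex j) ζ p * D (ex k) u p + D (ex k) ζ p * D (ex j) u p)| ≤
      ∑ j : Ix n, ∑ k : Ix n, M * (B * |D (ex k) u p| + B * |D (ex j) u p|) := by
    refine (Finset.abs_sum_le_sum_abs _ _).trans (Finset.sum_le_sum fun j _ =>
        (Finset.abs_sum_le_sum_abs _ _).trans (Finset.sum_le_sum fun k _ => ?_))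
    rw [abs_mul]
    refine mul_le_mul (hM j k) ((abs_add_le _ _).trans ?_) (abs_nonneg _) hM0
    rw [abs_mul, abs_mul]
    exact add_le_add (mul_le_mul_of_nonneg_right (h1 j) (abs_nonneg _)) (mul_le_mul_of_nonneg_right (h1 k) (abs_nonneg _))
  have e3 : ∑ j : Ix n, ∑ k : Ix n, M * (B * |D (ex k) u p| + B * |D (ex j) u p|) =
      2 * (n+1) * M * B * ∑ k, |D (ex k) u p| := by
    simp only [mul_add, Finset.sum_add_distrib, Finset.sum_const, Finset.card_univ, Fintype.card_fin,
      ← Finset.mul_sum, nsmul_eq_mul]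
    push_cast; ring
  rw [e3] at e2
  refine (abs_add_le _ _).trans ?_
  rw [abs_mul]
  have e4 := mul_le_mul_of_nonneg_left e1 (abs_nonneg (u p))
  unfold G1
  have s0 : 0 ≤ ∑ k, |D (ex k) u p| := by positivity
  have hn : (0:ℝ) ≤ n := by positivity
  have a1 : |u p| * ((1 + (n+1) ^ 2 * M) * B) ≤ (1 + 2 * (n + 1) ^ 2 * M) * B * |u p| := by
    rw [mul_comm]
    refine mul_le_mul_of_nonneg_right (mul_le_mul_of_nonneg_right ?_ hB) (abs_nonneg _)
    nlinarith [mul_nonneg (sq_nonneg ((n:ℝ)+1)) hM0]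
  have a2 : 2 * (n+1) * M * B * ∑ k, |D (ex k) u p| ≤ (1 + 2 * (n + 1) ^ 2 * M) * B * ∑ k, |D (ex k) u p| := by
    refine mul_le_mul_of_nonneg_right (mul_le_mul_of_nonneg_right ?_ hB) s0
    have : ((n:ℝ)+1) * M ≤ (n+1)^2 * M := mul_le_mul_of_nonneg_right (by nlinarith) hM0
    linarith
  linarith

theorem cutoff (n : ℕ) : ∃ B : ℝ, 0 < B ∧ ∀ (z : E n) (R : ℝ), 0 < R → ∃ ζ : E n → ℝ, TF ζ ∧ (∀ p, 0 ≤ ζ p) ∧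
    (∀ p, ζ p ≤ 1) ∧ (∀ p ∈ Cy z R, ζ p = 1) ∧ (tsupport ζ ⊆ Cy z (3 * R)) ∧
    (∀ p, |D et ζ p| ≤ B / R ^ 2) ∧ (∀ j p, |D (ex j) ζ p| ≤ B / R) ∧
    (∀ j k p, |Dd j k ζ p| ≤ B / R ^ 2) := by
  let b : ContDiffBump (0 : E n) := ⟨1, 2, by norm_num, by norm_num⟩
  have hb : TF (b : Fu n) := ⟨b.contDiff, b.hasCompactSupport⟩
  have bd : ∀ f : E n → ℝ, TF f → ∃ C, 0 ≤ C ∧ ∀ p, |f p| ≤ C := fun f hf => by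
    obtain ⟨C, hC⟩ := hf.cont.bounded_above_of_compact_support hf.cs
    exact ⟨C, (norm_nonneg _).trans (hC 0), hC⟩
  obtain ⟨Ct, ht0, ht⟩ := bd _ (hb.D et)
  choose Cx hx0 hx using fun j => bd _ (hb.D (ex j))
  choose Cxx hxx0 hxx using fun j k => bd _ ((hb.D (ex k)).D (ex j))
  have s1 : ∀ j, Cx j ≤ ∑ j, Cx j := fun j => Finset.single_le_sum (fun j _ => hx0 j) (Finset.mem_univ j)
  have s2 : ∀ j k, Cxx j k ≤ ∑ j, ∑ k, Cxx j k := fun j k =>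
    (Finset.single_le_sum (fun k _ => hxx0 j k) (Finset.mem_univ k)).trans
    (Finset.single_le_sum (f := fun j => ∑ k, Cxx j k) (fun j _ => Finset.sum_nonneg fun k _ => hxx0 j k) (Finset.mem_univ j))
  have p1 : 0 ≤ ∑ j, Cx j := Finset.sum_nonneg fun j _ => hx0 j
  have p2 : 0 ≤ ∑ j, ∑ k, Cxx j k := Finset.sum_nonneg fun j _ => Finset.sum_nonneg fun k _ => hxx0 j k
  refine ⟨Ct + ∑ j, Cx j + ∑ j, ∑ k, Cxx j k + 1, by positivity, fun z R hR => ?_⟩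
  set y : E n := (-z.1 / R ^ 2, -(R⁻¹ • z.2))
  have hsc : ∀ p : E n, sc y R⁻¹ p = ((p.1 - z.1) / R ^ 2, R⁻¹ • (p.2 - z.2)) := by
    intro p
    refine Prod.ext ?_ ?_
    · simp only [sc, y]; field_simp; ring
    · simp only [sc, y, smul_sub]; abel
  have hR' : 0 < R⁻¹ := by positivity
  refine ⟨fun p => b (sc y R⁻¹ p), sc_TF hb y hR', fun p => b.nonneg, fun p => b.le_one, ?_, ?_, ?_, ?_, ?_⟩
  · rintro p ⟨h1, h2⟩
    refine b.one_of_mem_closedBall ?_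
    rw [hsc, mem_closedBall_zero_iff, Prod.norm_def, max_le_iff, pi_norm_le_iff_of_nonneg (by positivity)]
    refine ⟨?_, fun j => ?_⟩
    · rw [Real.norm_eq_abs, abs_div, abs_of_pos (by positivity : 0 < R ^ 2), div_le_iff₀ (by positivity)]
      change _ ≤ 1 * _; linarith
    · simp only [Pi.smul_apply, Pi.sub_apply, norm_smul, Real.norm_eq_abs, abs_of_pos hR']
      rw [inv_mul_le_iff₀ hR]
      change _ ≤ R * 1; linarith [h2 j]
  · have hcl : IsClosed {p : E n | |p.1 - z.1| ≤ 2 * R ^ 2 ∧ ∀ j, |p.2 j - z.2 j| ≤ 2 * R} := by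
      simp only [Set.setOf_and, Set.setOf_forall]
      refine (isClosed_le (by fun_prop) (by fun_prop)).inter ?_
      exact isClosed_iInter fun j => isClosed_le (by fun_prop) (by fun_prop)
    have hss : Function.support (fun p => b (sc y R⁻¹ p)) ⊆
        {p : E n | |p.1 - z.1| ≤ 2 * R ^ 2 ∧ ∀ j, |p.2 j - z.2 j| ≤ 2 * R} := by
      intro p hp
      have : sc y R⁻¹ p ∈ Function.support b := hp
      rw [b.support_eq, mem_ball_zero_iff, hsc, Prod.norm_def, max_lt_iff,
        pi_norm_lt_iff (by change (0:ℝ) < 2; norm_num)] at this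
      obtain ⟨h1, h2⟩ := this
      rw [Real.norm_eq_abs, abs_div, abs_of_pos (by positivity : 0 < R ^ 2), div_lt_iff₀ (by positivity)] at h1
      refine ⟨h1.le, fun j => ?_⟩
      have := h2 j
      simp only [Pi.smul_apply, Pi.sub_apply, norm_smul, Real.norm_eq_abs, abs_of_pos hR'] at this
      rw [inv_mul_lt_iff₀ hR, mul_comm] at this
      exact this.le
    refine (closure_minimal hss hcl).trans ?_
    rintro p ⟨h1, h2⟩
    exact ⟨by nlinarith [mul_pos hR hR], fun j => by linarith [h2 j]⟩
  · intro p
    rw [sc_Dt hb.sm, abs_mul, abs_of_pos (by positivity), inv_pow, inv_mul_eq_div]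
    exact div_le_div_of_nonneg_right (by linarith [ht (sc y R⁻¹ p)]) (by positivity)
  · intro j p
    rw [sc_Dx hb.sm, abs_mul, abs_of_pos (by positivity), inv_mul_eq_div]
    exact div_le_div_of_nonneg_right (by linarith [hx j (sc y R⁻¹ p), s1 j]) (by positivity)
  · intro j k p
    rw [sc_Dxx hb.sm, abs_mul, abs_of_pos (by positivity), inv_pow, inv_mul_eq_div]
    exact div_le_div_of_nonneg_right (by linarith [hxx j k (sc y R⁻¹ p), s2 j k]) (by positivity)

end

section
variable {n : ℕ}

theorem nq_mono {q : ℝ} {S : Set (E n)} (hS : MeasurableSet S) {F G : Fu n}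
    (h : ∀ z ∈ S, |F z| ≤ |G z|) : nq q S F ≤ nq q S G := by
  refine eLpNorm_mono_ae ?_
  filter_upwards [ae_restrict_mem hS] with z hz using h z hz

theorem nq_set {q : ℝ} {S S' : Set (E n)} (h : S ⊆ S') (F : Fu n) : nq q S F ≤ nq q S' F :=
  eLpNorm_mono_measure _ (Measure.restrict_mono h le_rfl)

theorem nq_add {q : ℝ} (hq : 1 ≤ q) {S : Set (E n)} {F G : Fu n} (hF : Measurable F)
    (hG : Measurable G) : nq q S (fun z => F z + G z) ≤ nq q S F + nq q S G :=
  eLpNorm_add_le hF.aestronglyMeasurable hG.aestronglyMeasurable (by simpa using hq)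

theorem nq_sub {q : ℝ} (hq : 1 ≤ q) {S : Set (E n)} {F G : Fu n} (hF : Measurable F)
    (hG : Measurable G) : nq q S (fun z => F z - G z) ≤ nq q S F + nq q S G :=
  eLpNorm_sub_le hF.aestronglyMeasurable hG.aestronglyMeasurable (by simpa using hq)

theorem nq_abs {q : ℝ} {S : Set (E n)} (F : Fu n) : nq q S (fun z => |F z|) = nq q S F :=
  eLpNorm_norm F

theorem nq_cmul {q : ℝ} {S : Set (E n)} (c : ℝ) (F : Fu n) :
    nq q S (fun z => c * F z) = oR |c| * nq q S F := by
  have := eLpNorm_const_smul c F (oR q) (volume.restrict S)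
  rw [← ofReal_norm] at this
  exact this

theorem nq_supp {q : ℝ} {S H : Set (E n)} (hS : MeasurableSet S) {F : Fu n}
    (h : ∀ z, z ∉ S → F z = 0) : nq q H F ≤ nq q (S ∩ H) F := by
  have : F = S.indicator F := by
    funext z; by_cases hz : z ∈ S <;> simp [hz, h]
  unfold nq
  rw [this, eLpNorm_indicator_eq_eLpNorm_restrict hS, Measure.restrict_restrict hS, ← this]

theorem nq_sum {q : ℝ} (hq : 1 ≤ q) {S : Set (E n)} {ι : Type*} {s : Finset ι} {F : ι → E n → ℝ}
    (hF : ∀ i, Measurable (F i)) : nq q S (fun z => ∑ i ∈ s, F i z) ≤ ∑ i ∈ s, nq q S (F i) := by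
  have := eLpNorm_sum_le (μ := volume.restrict S) (f := F) (s := s) (p := oR q)
    (fun i _ => (hF i).aestronglyMeasurable) (by simpa using hq)
  have e : (∑ i ∈ s, F i) = fun z => ∑ i ∈ s, F i z := by funext z; simp
  rw [e] at this
  exact this

theorem nq_G1 {q : ℝ} (hq : 1 ≤ q) {S : Set (E n)} {w : Fu n} (hw : TF w) :
    nq q S (G1 w) ≤ nq q S w + ∑ k, nq q S (D (ex k) w) := by
  have h1 : ∀ k, Measurable fun z => |D (ex k) w z| := fun k => (hw.D (ex k)).cont.abs.measurable
  have h2 := nq_add (S := S) hq hw.cont.abs.measurable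
    (Finset.measurable_sum Finset.univ fun k _ => h1 k)
  refine h2.trans (add_le_add (nq_abs w).le ((nq_sum hq h1).trans (le_of_eq ?_)))
  simp only [nq_abs]

theorem D_congr {S : Set (E n)} (hS : IsOpen S) {f g : Fu n} (h : ∀ p ∈ S, f p = g p) (v : E n) :
    ∀ p ∈ S, D v f p = D v g p := by
  intro p hp
  have : f =ᶠ[nhds p] g := Filter.eventuallyEq_of_mem (hS.mem_nhds hp) h
  simp only [D, this.fderiv_eq]

theorem VV_congr {S : Set (E n)} (hS : IsOpen S) {f g : Fu n} (h : ∀ p ∈ S, f p = g p) :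
    ∀ p ∈ S, VV f p = VV g p := by
  intro p hp
  simp only [VV, D_congr hS h _ p hp, D_congr hS (D_congr hS h _) _ p hp]

theorem w_DD {u : Fu n} (hu : TF u) (v w : E n) : D v (D w fun z => u z - Mk eta u z) =
    fun z => D v (D w u) z - Mk eta (D v (D w u)) z := by
  rw [D_sub hu.sm (Mk_TF hu).sm, D_sub (hu.D _).sm ((Mk_TF hu).D _).sm, Mk_D hu, Mk_D (hu.D _)]

theorem Pop_w (A : ℝ → Mx n) {u : Fu n} (hu : TF u) (z : E n) :
    Pop A (fun z => u z - Mk eta u z) z = Pop A u z - Mk eta (Pop A u) z := by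
  have hM := Mk_TF hu
  have e : Mk eta (Pop A u) z = Mk eta (D et u) z +
      ∑ j, ∑ k, A (z.2 0) j k * Mk eta (Dd j k u) z := by
    have hc : ∀ {f : Fu n}, TF f → Integrable fun h : TT n => eta h * f (z + iota h) := fun hf =>
      ek_int (hf.cont.comp (by fun_prop))
    have h2 : ∀ j k, Integrable fun h : TT n => A (z.2 0) j k * (eta h * Dd j k u (z + iota h)) :=
      fun j k => (hc ((hu.D (ex k)).D (ex j))).const_mul _
    have h0 : ∀ h : TT n, (z + iota h).2 0 = z.2 0 := fun h => by simp [iota_zero]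
    have h3 : ∀ h : TT n, eta h * Pop A u (z + iota h) = eta h * D et u (z + iota h) +
        ∑ j, ∑ k, A (z.2 0) j k * (eta h * Dd j k u (z + iota h)) := by
      intro h
      unfold Pop
      rw [h0, mul_add, Finset.mul_sum]
      congr 1
      refine Finset.sum_congr rfl fun j _ => ?_
      rw [Finset.mul_sum]
      exact Finset.sum_congr rfl fun k _ => by ring
    simp only [Mk, h3]
    rw [integral_add (hc (hu.D et)) (integrable_finset_sum _ fun j _ => integrable_finset_sum _ fun k _ => h2 j k),
      integral_finset_sum _ (fun j _ => integrable_finset_sum _ fun k _ => h2 j k)]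
    congr 1
    refine Finset.sum_congr rfl fun j _ => ?_
    rw [integral_finset_sum _ (fun k _ => h2 j k)]
    simp only [integral_const_mul]
  rw [e]
  unfold Pop
  simp only [w_DD hu]
  simp only [D_sub hu.sm hM.sm, Mk_D hu, mul_sub, Finset.sum_sub_distrib]
  ring

theorem Cy_shift {ρ ρ' : ℝ} (h1 : 1 ≤ ρ) (h : ρ + 1 ≤ ρ') {z v : E n} (hz : z ∈ Cy 0 ρ)
    (hv : |v.1| ≤ 1 ∧ ∀ j, |v.2 j| ≤ 1) : z + v ∈ Cy 0 ρ' := by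
  obtain ⟨a, b⟩ := hz
  simp only [Prod.fst_zero, sub_zero, Prod.snd_zero, Pi.zero_apply] at a b
  refine ⟨?_, fun j => ?_⟩
  · simp only [Prod.fst_add, Prod.fst_zero, sub_zero]
    have := abs_add_le z.1 v.1
    nlinarith [hv.1]
  · simp only [Prod.snd_add, Prod.snd_zero, Pi.zero_apply, sub_zero, Pi.add_apply]
    have := abs_add_le (z.2 j) (v.2 j)
    linarith [hv.2 j, b j]

theorem CyH_shift {ρ ρ' τ : ℝ} (h1 : 1 ≤ ρ) (h : ρ + 1 ≤ ρ') (v : E n) (hv : Adm v) :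
    ∀ z ∈ Cy 0 ρ ∩ Hs τ, z + v ∈ Cy 0 ρ' ∩ Hs τ := fun z hz =>
  ⟨Cy_shift h1 h hz.1 ⟨abs_le.2 ⟨by linarith [hv.1], hv.2.1⟩, hv.2.2⟩, by
    have := hz.2; simp only [Hs, Set.mem_setOf_eq, Prod.fst_add] at *; linarith [hv.1]⟩

theorem Adm_zero : Adm (0 : E n) := by simp [Adm]

theorem CyH_sub {ρ ρ' τ : ℝ} (h1 : 1 ≤ ρ) (h : ρ + 1 ≤ ρ') :
    (Cy 0 ρ ∩ Hs τ : Set (E n)) ⊆ Cy 0 ρ' ∩ Hs τ := fun z hz => by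
  simpa using CyH_shift h1 h 0 Adm_zero z hz

theorem Adm_ex {s : ℝ} (hs : s ∈ I01) (j : Ix n) : Adm (s • (ex j : E n)) := by
  refine ⟨by simp [ex], by simp [ex], fun k => ?_⟩
  simp only [ex, Prod.smul_snd, Pi.smul_apply, smul_eq_mul, Pi.single_apply]
  split_ifs
  · simpa [abs_of_pos hs.1] using hs.2
  · simp

theorem w_G1 {q : ℝ} (hq : 1 ≤ q) {u : Fu n} (hu : TF u) {ρ τ : ℝ} (h1 : 1 ≤ ρ) :
    nq q (Cy 0 ρ ∩ Hs τ) (G1 fun z => u z - Mk eta u z) ≤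
      (4 + 10 * (n + 1 : ℕ)) * nq q (Cy 0 (ρ + 2) ∩ Hs τ) (VV u) := by
  have hw : TF fun z => u z - Mk eta u z := hu.sub (Mk_TF hu)
  have m : ∀ ρ : ℝ, MeasurableSet (Cy 0 ρ ∩ Hs τ : Set (E n)) := fun ρ => (meas_Cy 0 ρ).inter (measurableSet_Hs τ)
  have h12 : 1 ≤ ρ + 1 := by linarith
  have a1 := w_nq hq hu (m (ρ+1)) (m (ρ + 2)) (CyH_shift (τ := τ) (ρ' := ρ + 2) h12 (by linarith))
  have a0 := (nq_set (q := q) (CyH_sub h1 le_rfl) (fun z => u z - Mk eta u z)).trans a1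
  refine (nq_G1 hq hw).trans ?_
  have a2 : ∀ k, nq q (Cy 0 ρ ∩ Hs τ) (D (ex k) fun z => u z - Mk eta u z) ≤
      10 * nq q (Cy 0 (ρ + 2) ∩ Hs τ) (VV u) := by
    intro k
    have g := grad_bd hq hw (ex k) (m ρ) (m (ρ + 1)) (CyH_sub h1 le_rfl)
      (fun s hs => CyH_shift h1 le_rfl _ (Adm_ex hs k))
    have hkk := (hu.D (ex k)).D (ex k)
    have g1 : nq q (Cy 0 (ρ+1) ∩ Hs τ) (D (ex k) (D (ex k) fun z => u z - Mk eta u z)) ≤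
        2 * nq q (Cy 0 (ρ + 2) ∩ Hs τ) (VV u) := by
      rw [w_DD hu]
      refine (nq_sub hq hkk.cont.measurable (Mk_TF hkk).cont.measurable).trans ?_
      have l1 := Mk_nq hq hkk.cont.measurable (m (ρ+1)) (m (ρ + 2)) (CyH_shift (τ := τ) (ρ' := ρ + 2) h12 (by linarith))
      have l2 : nq q (Cy 0 (ρ + 2) ∩ Hs τ) (Dd k k u) ≤ nq q (Cy 0 (ρ + 2) ∩ Hs τ) (VV u) :=
        nq_mono (m _) fun z _ => (VV_exr u z k k).trans (le_abs_self _)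
      have l3 := nq_set (q := q) (CyH_sub (n := n) (τ := τ) (ρ' := ρ + 2) h12 (by linarith)) (Dd k k u)
      rw [two_mul]
      exact add_le_add (l3.trans l2) (l1.trans l2)
    refine g.trans ((add_le_add (mul_le_mul' le_rfl a1) g1).trans (le_of_eq ?_))
    ring
  refine (add_le_add a0 (Finset.sum_le_sum fun k _ => a2 k)).trans (le_of_eq ?_)
  simp
  ring

theorem stepA {δ q : ℝ} (hδ : 0 < δ) (hq : 1 ≤ q) (hQ : HQ n δ q) : ∃ N : NNReal, ∀ R : ℝ, 1 ≤ R →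
    ∀ A, MEll δ A → ∀ u : E n → ℝ, TF u → ∀ τ,
    nq q (Cy 0 R ∩ Hs τ) (VV fun z => u z - Mk eta u z) ≤ N * (nq q (Cy 0 (5 * R) ∩ Hs τ) (Pop A u) +
      oR R⁻¹ * nq q (Cy 0 (5 * R) ∩ Hs τ) (VV u)) := by
  obtain ⟨N, hN⟩ := hQ
  obtain ⟨B, hB0, hB⟩ := cutoff n
  set c : ℝ := (1 + 2 * (n + 1) ^ 2 * δ⁻¹) * B
  have hc : 0 ≤ c := by positivity
  refine ⟨N * (2 + Real.toNNReal c * (4 + 10 * (n + 1 : ℕ))), fun R hR A hA u hu τ => ?_⟩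
  have hR0 : 0 < R := by linarith
  obtain ⟨ζ, hζ, z0, z1, z2, z3, z4, z5, z6⟩ := hB 0 R hR0
  set w : E n → ℝ := fun z => u z - Mk eta u z
  have hw : TF w := hu.sub (Mk_TF hu)
  have hζw : TF fun p => ζ p * w p := hζ.mul hw
  have m : ∀ ρ : ℝ, MeasurableSet (Cy 0 ρ ∩ Hs τ : Set (E n)) := fun ρ => (meas_Cy 0 ρ).inter (measurableSet_Hs τ)
  have h1 : nq q (Cy 0 R ∩ Hs τ) (VV w) ≤ nq q (Hs τ) (VV fun p => ζ p * w p) := by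
    refine le_trans ?_ (nq_set (Set.inter_subset_right (s := Cy 0 R)) _)
    refine nq_mono (m R) fun z hz => le_of_eq ?_
    rw [VV_congr (isOpen_Cy 0 R) (f := w) (g := fun p => ζ p * w p) (fun p hp => by rw [z2 p hp, one_mul]) z hz.1]
  have hBR : B / R ^ 2 ≤ B / R := div_le_div_of_nonneg_left hB0.le hR0 (by nlinarith)
  have h2 : nq q (Hs τ) (Pop A fun p => ζ p * w p) ≤
      nq q (Cy 0 (3 * R) ∩ Hs τ) (Pop A w) + oR (c / R) * nq q (Cy 0 (3 * R) ∩ Hs τ) (G1 w) := by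
    refine (nq_supp (meas_Cy 0 (3 * R)) fun z hz => ?_).trans ?_
    · have hz' : ∀ p ∈ (tsupport ζ)ᶜ, ζ p * w p = 0 := fun p hp => by
        rw [image_eq_zero_of_notMem_tsupport hp, zero_mul]
      have hop : IsOpen (tsupport ζ)ᶜ := (isClosed_tsupport ζ).isOpen_compl
      have d1 := D_congr hop (g := fun _ => 0) hz'
      have hzz : z ∈ (tsupport ζ)ᶜ := fun h => hz (z3 h)
      simp only [Pop]
      simp only [D_congr hop (d1 _) _ z hzz, d1 _ z hzz, D_const, mul_zero, Finset.sum_const_zero, add_zero]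
    · have hcR : |c / R| = c / R := abs_of_nonneg (by positivity)
      have hG : Measurable (G1 w) := by
        unfold G1
        exact hw.cont.abs.measurable.add (Finset.measurable_sum _ fun k _ => (hw.D (ex k)).cont.abs.measurable)
      have := nq_add (S := Cy 0 (3 * R) ∩ Hs τ) hq ((Pop_meas hA hw).norm) (hG.const_mul (c / R))
      rw [nq_cmul, hcR] at this
      refine le_trans (nq_mono (m _) fun z _ => ?_) (this.trans (add_le_add (nq_abs _).le le_rfl))
      have k1 := Pa_comm_le (a := fun p => A (p.2 0)) (M := δ⁻¹) (B := B / R) hζ.sm hw.sm z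
        (fun j k => (hA.ell _).bdd hδ j k) ((z4 z).trans hBR) (fun j => z5 j z) (fun j k => (z6 j k z).trans hBR)
      have k2 : |ζ z * Pop A w z| ≤ |Pop A w z| := by
        rw [abs_mul, abs_of_nonneg (z0 z)]; exact mul_le_of_le_one_left (abs_nonneg _) (z1 z)
      have e : (1 + 2 * (n + 1) ^ 2 * δ⁻¹) * (B / R) = c / R := by simp only [c]; ring
      rw [e] at k1
      have k3 : |Pop A (fun p => ζ p * w p) z| ≤ |ζ z * Pop A w z| + c / R * G1 w z := by
        have := abs_sub_abs_le_abs_sub (Pop A (fun p => ζ p * w p) z) (ζ z * Pop A w z)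
        have k1' : |Pop A (fun p => ζ p * w p) z - ζ z * Pop A w z| ≤ c / R * G1 w z := k1
        linarith
      refine (k3.trans (add_le_add_left k2 _)).trans (le_abs_self _)
  have h12 : 1 ≤ 3 * R := by linarith
  have s3 : (Cy 0 (3 * R + 2) ∩ Hs τ : Set (E n)) ⊆ Cy 0 (5 * R) ∩ Hs τ := by
    rintro z ⟨⟨a, b⟩, hz⟩
    exact ⟨⟨a.trans_le (by nlinarith), fun j => (b j).trans_le (by linarith)⟩, hz⟩
  have h3 : nq q (Cy 0 (3 * R) ∩ Hs τ) (Pop A w) ≤ 2 * nq q (Cy 0 (5 * R) ∩ Hs τ) (Pop A u) := by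
    have e : Pop A w = fun z => Pop A u z - Mk eta (Pop A u) z := by funext z; exact Pop_w A hu z
    have mP := Pop_meas hA hu
    have mM : Measurable (Mk eta (Pop A u)) := by
      have : Mk eta (Pop A u) = fun z => Pop A u z - Pop A w z := by rw [e]; funext z; ring
      rw [this]; exact mP.sub (Pop_meas hA hw)
    rw [e, two_mul]
    refine (nq_sub hq mP mM).trans (add_le_add ?_ ?_)
    · exact nq_set (CyH_sub h12 (by linarith)) _
    · exact Mk_nq hq mP (m _) (m _) (CyH_shift h12 (by linarith))
  have h4 := (w_G1 hq hu (τ := τ) h12).trans (mul_le_mul' le_rfl (nq_set s3 (VV u)))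
  refine h1.trans ((hN A hA _ hζw τ).trans ?_)
  refine (mul_le_mul' le_rfl (h2.trans (add_le_add h3 (mul_le_mul' le_rfl h4)))).trans ?_
  have e5 : oR (c / R) = (Real.toNNReal c : ℝ≥0∞) * oR R⁻¹ := by
    rw [div_eq_mul_inv, ofReal_mul hc]; rfl
  rw [e5]
  push_cast
  set X := nq q (Cy 0 (5 * R) ∩ Hs τ) (Pop A u)
  set Y := nq q (Cy 0 (5 * R) ∩ Hs τ) (VV u)
  set C : ℝ≥0∞ := (Real.toNNReal c : ℝ≥0∞)
  have k : 2 * X + (C * (4 + 10 * ((n:ℝ≥0∞)+1))) * (oR R⁻¹ * Y) ≤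
      (2 + C * (4 + 10 * ((n:ℝ≥0∞)+1))) * (X + oR R⁻¹ * Y) := by
    rw [mul_add (2 + _) X]
    gcongr
    · exact le_self_add
    · exact le_add_self
  rw [mul_assoc (N : ℝ≥0∞)]
  refine mul_le_mul' le_rfl (le_trans (le_of_eq ?_) k)
  ring

end

section
variable {n : ℕ}

theorem Fin_cases0 {P : Ix n → Ix n → Prop} (h0 : P 0 0) (h1 : ∀ j (k : Fin n), P j k.succ)
    (h2 : ∀ (j : Fin n), P j.succ 0) : ∀ j k, P j k := by
  intro j k
  refine Fin.cases ?_ (fun k => h1 j k) k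
  exact Fin.cases h0 h2 j

theorem V_alg {δ : ℝ} (hδ : 0 < δ) {A : ℝ → Mx n} (hA : MEll δ A)
    {u : Fu n} (hu : TF u) (z : E n) {Y : ℝ} (ht : |D et u z| ≤ Y)
    (hx : ∀ j (k : Fin n), |D (ex j) (D (ex k.succ) u) z| ≤ Y) :
    VV u z ≤ (1 + (n+1)^2 + δ⁻¹ * (1 + δ⁻¹ * (n+1)^2)) * (|Pop A u z| + Y) := by
  have hY : 0 ≤ Y := (abs_nonneg _).trans ht
  set M := fun j k : Ix n => Dd j k u z
  have hx2 : ∀ j k, ¬ (j = 0 ∧ k = 0) → |M j k| ≤ Y := by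
    refine Fin_cases0 (fun h => absurd ⟨rfl, rfl⟩ h) (fun j k _ => hx j k) (fun j _ => ?_)
    simp only [M]
    rw [D_comm hu.sm]; exact hx 0 j
  have hi : 0 < δ⁻¹ := by positivity
  have hb := fun j k => (hA.ell (z.2 0)).bdd hδ j k
  have hd := (hA.ell (z.2 0)).diag 0
  have e : ∑ j, ∑ k, A (z.2 0) j k * M j k = A (z.2 0) 0 0 * M 0 0 +
      ∑ j, ∑ k, (if j = 0 ∧ k = 0 then 0 else A (z.2 0) j k * M j k) := by
    have : ∀ j k, A (z.2 0) j k * M j k = (if j = 0 then (if k = 0 then A (z.2 0) 0 0 * M 0 0 else 0) else 0) +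
      (if j = 0 ∧ k = 0 then 0 else A (z.2 0) j k * M j k) := by
      intro j k
      by_cases h1 : j = 0 <;> by_cases h2 : k = 0 <;> simp [h1, h2]
    rw [Finset.sum_congr rfl fun j _ => Finset.sum_congr rfl fun k _ => this j k]
    simp only [Finset.sum_add_distrib]
    simp
  have h3 : |∑ j, ∑ k, (if j = 0 ∧ k = 0 then 0 else A (z.2 0) j k * M j k)| ≤
      ∑ j : Ix n, ∑ k : Ix n, δ⁻¹ * Y := by
    refine (Finset.abs_sum_le_sum_abs _ _).trans (Finset.sum_le_sum fun j _ =>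
        (Finset.abs_sum_le_sum_abs _ _).trans (Finset.sum_le_sum fun k _ => ?_))
    split_ifs with h
    · simp; positivity
    · rw [abs_mul]; exact mul_le_mul (hb j k) (hx2 j k h) (abs_nonneg _) hi.le
  have h3' : ∑ j : Ix n, ∑ k : Ix n, δ⁻¹ * Y = (n+1)^2 * (δ⁻¹ * Y) := by simp; ring
  rw [h3'] at h3
  have hP : Pop A u z = D et u z + ∑ j, ∑ k, A (z.2 0) j k * M j k := rfl
  have h4 : A (z.2 0) 0 0 * |M 0 0| ≤ |Pop A u z| + Y + (n+1)^2 * (δ⁻¹ * Y) := by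
    have e2 : A (z.2 0) 0 0 * M 0 0 = Pop A u z - D et u z -
      ∑ j, ∑ k, (if j = 0 ∧ k = 0 then 0 else A (z.2 0) j k * M j k) := by rw [hP, e]; ring
    rw [← abs_of_pos (lt_of_lt_of_le hδ hd.1), ← abs_mul, e2]
    refine (abs_sub _ _).trans (add_le_add ((abs_sub _ _).trans (add_le_add le_rfl ht)) h3)
  have h5 : |M 0 0| ≤ δ⁻¹ * (|Pop A u z| + Y + (n+1)^2 * (δ⁻¹ * Y)) := by
    rw [le_inv_mul_iff₀ hδ]
    exact (mul_le_mul_of_nonneg_right hd.1 (abs_nonneg _)).trans h4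
  have h6 : ∑ j, ∑ k, |M j k| ≤ ∑ j : Ix n, ∑ k : Ix n,
      (if j = 0 then (if k = 0 then |M 0 0| else 0) else 0) + (n+1)^2 * Y := by
    have : ((n:ℝ)+1)^2 * Y = ∑ j : Ix n, ∑ k : Ix n, Y := by simp; ring
    rw [this]
    simp only [← Finset.sum_add_distrib]
    refine Finset.sum_le_sum fun j _ => Finset.sum_le_sum fun k _ => ?_
    by_cases h : j = 0 ∧ k = 0
    · simp [h, hY]
    · refine (hx2 j k h).trans (le_add_of_nonneg_left ?_)
      split_ifs <;> positivity
  have h7 : VV u z ≤ Y + (|M 0 0| + (n+1)^2 * Y) := by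
    refine add_le_add ht (h6.trans (le_of_eq ?_)); simp
  have hf := abs_nonneg (Pop A u z)
  have q1 : 0 ≤ (1 + ((n:ℝ)+1)^2 + δ⁻¹ * (δ⁻¹ * (n+1)^2)) * |Pop A u z| := by positivity
  nlinarith

theorem sup_all (n : ℕ) : ∃ C : NNReal, ∀ (u : Fu n), TF u → ∀ z,
    (‖D et (Mk eta u) z‖ₑ ≤ C * ∫⁻ p in Bx z, ‖VV u p‖ₑ) ∧ ∀ j (k : Fin n),
    ‖D (ex j) (D (ex k.succ) (Mk eta u)) z‖ₑ ≤ C * ∫⁻ p in Bx z, ‖VV u p‖ₑ := by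
  obtain ⟨C, hC⟩ := sup_t (n := n)
  choose C' hC' using fun j k => sup_jk (n := n) j k
  refine ⟨C + ∑ j, ∑ k, C' j k, fun u hu z => ⟨(hC u hu z).trans ?_, fun j k => (hC' j k u hu z).trans ?_⟩⟩
  · refine mul_le_mul' ?_ le_rfl
    exact_mod_cast le_self_add
  · refine mul_le_mul' ?_ le_rfl
    have h1 : C' j k ≤ ∑ k, C' j k := Finset.single_le_sum (f := fun k => C' j k) (fun _ _ => zero_le) (Finset.mem_univ k)
    have h2 : ∑ k, C' j k ≤ ∑ j, ∑ k, C' j k :=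
      Finset.single_le_sum (f := fun j => ∑ k, C' j k) (fun _ _ => zero_le) (Finset.mem_univ j)
    exact_mod_cast (h1.trans h2).trans le_add_self

theorem V_fin {u : Fu n} (hu : TF u) (S : Set (E n)) : ∫⁻ p in S, ‖VV u p‖ₑ ≠ ∞ :=
  ((hu.contV.integrable_of_hasCompactSupport hu.csV).integrableOn (s := S)).2.ne

theorem stepB {δ : ℝ} (hδ : 0 < δ) : ∃ N : NNReal, ∀ R : ℝ, 1 ≤ R →
    ∀ A, MEll δ A → ∀ u : E n → ℝ, TF u → ∀ τ, ∀ z ∈ Cy 0 R ∩ Hs τ,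
    ‖VV u z‖ₑ ≤ N * (‖Pop A u z‖ₑ + ‖VV (fun z => u z - Mk eta u z) z‖ₑ +
      ∫⁻ p in Cy 0 (5 * R) ∩ Hs τ, ‖VV u p‖ₑ) := by
  obtain ⟨C, hC⟩ := sup_all n
  set c : ℝ := 1 + (n+1)^2 + δ⁻¹ * (1 + δ⁻¹ * (n+1)^2)
  have hc : 0 ≤ c := by positivity
  refine ⟨Real.toNNReal c * (1 + C), fun R hR A hA u hu τ z hz => ?_⟩
  set I := ∫⁻ p in Cy 0 (5 * R) ∩ Hs τ, ‖VV u p‖ₑ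
  have hI : I ≠ ∞ := V_fin hu _
  set w : E n → ℝ := fun z => u z - Mk eta u z
  have hw : TF w := hu.sub (Mk_TF hu)
  have hB : ∫⁻ p in Bx z, ‖VV u p‖ₑ ≤ I := by
    refine lintegral_mono_set ?_
    rintro p ⟨h1, h2, h3⟩
    have hm := CyH_shift (ρ := R) (ρ' := 5 * R) (τ := τ) hR (by linarith) (p - z) ⟨by simpa using h1, by
      simp only [Prod.fst_sub]; linarith, fun j => by simpa using h3 j⟩ z hz
    simpa using hm
  obtain ⟨s1, s2⟩ := hC u hu z
  have rl : ∀ {x : ℝ}, ‖x‖ₑ ≤ C * ∫⁻ p in Bx z, ‖VV u p‖ₑ → |x| ≤ C * I.toReal := by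
    intro x hx
    have := hx.trans (mul_le_mul' le_rfl hB)
    have h2 := toReal_mono (mul_ne_top coe_ne_top hI) this
    simpa using h2
  have ut : u = fun z => w z + Mk eta u z := by funext z; simp [w]
  have v := V_alg hδ hA hu z (Y := VV w z + C * I.toReal) ?_ ?_
  · have e : ‖VV u z‖ₑ = oR (VV u z) := Real.enorm_eq_ofReal (VV_nonneg u z)
    rw [e]
    refine (ofReal_le_ofReal v).trans ?_
    rw [ofReal_mul hc, ofReal_add (abs_nonneg _) (add_nonneg (VV_nonneg _ _) (by positivity)),
      ofReal_add (VV_nonneg _ _) (by positivity), ofReal_mul (by positivity),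
      ofReal_toReal hI, ← Real.enorm_eq_ofReal (VV_nonneg w z), ← Real.norm_eq_abs, ofReal_norm]
    push_cast
    rw [mul_assoc]
    refine mul_le_mul' le_rfl ?_
    rw [ofReal_coe_nnreal, mul_add, mul_add, add_assoc]
    gcongr
    · exact le_mul_of_one_le_left' le_self_add
    · exact le_mul_of_one_le_left' le_self_add
    · exact le_add_self
  · have : D et u z = D et w z + D et (Mk eta u) z := by
      conv_lhs => rw [ut]
      rw [D_add hw.sm (Mk_TF hu).sm]
    rw [this]
    refine (abs_add_le _ _).trans (add_le_add ?_ (rl s1))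
    have := VV_et w z
    rw [enorm_le_iff_norm_le] at this
    simpa [abs_of_nonneg (VV_nonneg w z)] using this
  · intro j k
    have : D (ex j) (D (ex k.succ) u) z = D (ex j) (D (ex k.succ) w) z + D (ex j) (D (ex k.succ) (Mk eta u)) z := by
      conv_lhs => rw [ut]
      rw [D_add hw.sm (Mk_TF hu).sm, D_add (hw.D _).sm ((Mk_TF hu).D _).sm]
    rw [this]
    exact (abs_add_le _ _).trans (add_le_add (VV_exr w z j _) (rl (s2 j k)))

theorem badset {δ q : ℝ} (hδ : 0 < δ) (hq : 1 ≤ q) (hQ : HQ n δ q) : ∃ N : NNReal, ∀ R : ℝ, 1 ≤ R →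
    ∀ A, MEll δ A → ∀ u : E n → ℝ, TF u → ∀ τ, ∀ s : ℝ≥0∞,
    N * ∫⁻ p in Cy 0 (5 * R) ∩ Hs τ, ‖VV u p‖ₑ ≤ s →
    s ^ q * volume {z ∈ Cy 0 R ∩ Hs τ | s < ‖VV u z‖ₑ} ≤
      N * ((∫⁻ p in Cy 0 (5 * R) ∩ Hs τ, ‖Pop A u p‖ₑ ^ q) + oR R⁻¹ ^ q *
        ∫⁻ p in Cy 0 (5 * R) ∩ Hs τ, ‖VV u p‖ₑ ^ q) := by
  obtain ⟨NA, hNA⟩ := stepA hδ hq hQ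
  obtain ⟨NB, hNB⟩ := stepB (n := n) hδ
  have hq0 : 0 < q := by linarith
  refine ⟨2 * NB + (2 * NB) ^ q * ((1 + NA) ^ q * 2 ^ (q - 1)), fun R hR A hA u hu τ s hs => ?_⟩
  set S1 : Set (E n) := Cy 0 R ∩ Hs τ
  set S5 : Set (E n) := Cy 0 (5 * R) ∩ Hs τ
  have mS1 : MeasurableSet S1 := (meas_Cy 0 R).inter (measurableSet_Hs τ)
  set w : E n → ℝ := fun z => u z - Mk eta u z
  have hw : TF w := hu.sub (Mk_TF hu)
  have mP := Pop_meas hA hu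
  set T := {z ∈ S1 | s < ‖VV u z‖ₑ}
  by_cases hsT : s = ∞
  · have : T = ∅ := by ext z; simp [T, hsT]
    rw [this]; simp
  have mT : MeasurableSet T := mS1.inter (measurableSet_lt measurable_const hu.contV.measurable.enorm)
  have hpt : ∀ z ∈ T, s ≤ 2 * NB * ‖|Pop A u z| + VV w z‖ₑ := by
    rintro z ⟨hz, hsz⟩
    have h1 := hNB R hR A hA u hu τ z hz
    have e : ‖|Pop A u z| + VV w z‖ₑ = ‖Pop A u z‖ₑ + ‖VV w z‖ₑ := by
      rw [Real.enorm_eq_ofReal (add_nonneg (abs_nonneg _) (VV_nonneg _ _)), ofReal_add (abs_nonneg _) (VV_nonneg _ _),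
        Real.enorm_eq_ofReal (VV_nonneg w z), ← Real.norm_eq_abs, ofReal_norm]
    rw [e]
    set X := ‖Pop A u z‖ₑ + ‖VV w z‖ₑ
    set I := ∫⁻ p in S5, ‖VV u p‖ₑ
    have h2 : 2 * (NB * I) ≤ s := by
      refine le_trans ?_ hs
      push_cast
      rw [← mul_assoc]
      exact mul_le_mul' le_self_add le_rfl
    have h3 : 2 * s ≤ 2 * NB * X + s := by
      have : 2 * s ≤ 2 * (NB * (X + I)) := mul_le_mul' le_rfl (hsz.le.trans h1)
      refine this.trans (le_trans (le_of_eq (by ring : 2 * (NB * (X + I)) = 2 * NB * X + 2 * (NB * I))) (add_le_add le_rfl h2))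
    rw [two_mul] at h3
    exact (ENNReal.add_le_add_iff_right hsT).1 h3
  have c1 : s ^ q * volume T ≤ (2 * NB) ^ q * (nq q S1 fun z => |Pop A u z| + VV w z) ^ q := by
    rw [nq_rpow hq0]
    calc s ^ q * volume T = ∫⁻ z in T, s ^ q := by rw [setLIntegral_const]
      _ ≤ ∫⁻ z in T, (2 * NB) ^ q * ‖|Pop A u z| + VV w z‖ₑ ^ q := by
        refine setLIntegral_mono' mT fun z hz => ?_
        rw [← mul_rpow_of_nonneg _ _ hq0.le]
        exact rpow_le_rpow (hpt z hz) hq0.le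
      _ ≤ ∫⁻ z in S1, (2 * NB) ^ q * ‖|Pop A u z| + VV w z‖ₑ ^ q := lintegral_mono_set (fun z hz => hz.1)
      _ = _ := by
        rw [lintegral_const_mul]
        exact ((mP.abs.add hw.contV.measurable).enorm.pow_const q)
  have s15 : S1 ⊆ S5 := CyH_sub hR (by linarith)
  have c2 : (nq q S1 fun z => |Pop A u z| + VV w z) ≤ (1 + NA) * (nq q S5 (Pop A u) + oR R⁻¹ * nq q S5 (VV u)) := by
    refine (nq_add hq mP.abs hw.contV.measurable).trans ?_
    rw [add_mul, one_mul]
    refine add_le_add ((nq_abs _).le.trans ((nq_set s15 _).trans le_self_add)) (hNA R hR A hA u hu τ)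
  refine c1.trans ((mul_le_mul' le_rfl (rpow_le_rpow c2 hq0.le)).trans ?_)
  rw [mul_rpow_of_nonneg (1 + (NA : ℝ≥0∞)) _ hq0.le, ← nq_rpow hq0, ← nq_rpow hq0, ← mul_rpow_of_nonneg (oR R⁻¹) _ hq0.le]
  refine (mul_le_mul' le_rfl (mul_le_mul' le_rfl (rpow_add_le_mul_rpow_add_rpow _ _ hq))).trans ?_
  rw [← mul_assoc, ← mul_assoc]
  refine mul_le_mul' ?_ le_rfl
  push_cast
  rw [coe_rpow_of_nonneg _ hq0.le, coe_rpow_of_nonneg _ hq0.le, coe_rpow_of_nonneg _ (by linarith : 0 ≤ q - 1)]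
  push_cast
  rw [mul_assoc]
  exact le_add_self

theorem badset_r {δ q : ℝ} (hδ : 0 < δ) (hq : 1 ≤ q) (hQ : HQ n δ q) : ∃ N : NNReal, ∀ R : ℝ, 1 ≤ R →
    ∀ A, MEll δ A → ∀ u : E n → ℝ, TF u → ∀ τ, ∀ (z : E n) (r : ℝ), 0 < r → ∀ s : ℝ≥0∞,
    N * (oR ((r ^ (n + 3))⁻¹) * ∫⁻ p in Cy z (r * (5 * R)) ∩ Hs τ, ‖VV u p‖ₑ) ≤ s →
    s ^ q * volume {p ∈ Cy z (r * R) ∩ Hs τ | s < ‖VV u p‖ₑ} ≤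
      N * ((∫⁻ p in Cy z (r * (5 * R)) ∩ Hs τ, ‖Pop A u p‖ₑ ^ q) + oR R⁻¹ ^ q *
        ∫⁻ p in Cy z (r * (5 * R)) ∩ Hs τ, ‖VV u p‖ₑ ^ q) := by
  obtain ⟨N, hN⟩ := badset hδ hq hQ
  refine ⟨N, fun R hR A hA u hu τ z r hr s hs => ?_⟩
  set v : E n → ℝ := fun p => (r ^ 2)⁻¹ * u (sc z r p)
  have hus := sc_TF hu z hr
  have hv : TF v := hus.cmul _
  have h2 : r ^ 2 ≠ 0 := by positivity
  set A' : ℝ → Mx n := fun y => A (z.2 0 + r * y)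
  have hA' : MEll δ A' := ⟨fun j k => (hA.meas j k).comp (by fun_prop), fun y => hA.ell _⟩
  have et1 : ∀ p, D et v p = D et u (sc z r p) := fun p => by
    simp only [v]; rw [D_cmul hus.sm, sc_Dt hu.sm]; field_simp
  have ex1 : ∀ j k p, Dd j k v p = Dd j k u (sc z r p) := fun j k p => by
    simp only [v]; rw [D_cmul hus.sm, D_cmul (hus.D _).sm, sc_Dxx hu.sm]; field_simp
  have eV : ∀ p, VV v p = VV u (sc z r p) := fun p => by simp only [VV, et1, ex1]
  have eP : ∀ p, Pop A' v p = Pop A u (sc z r p) := fun p => by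
    simp only [Pop, et1, ex1]; rfl
  have pre : ∀ ρ, Cy 0 ρ ∩ Hs ((τ - z.1) / r ^ 2) = sc z r ⁻¹' (Cy z (r * ρ) ∩ Hs τ) := fun ρ => by
    rw [Set.preimage_inter, sc_Cy z hr, sc_Hs z hr]
  have mm : ∀ ρ, MeasurableSet (Cy z (r * ρ) ∩ Hs τ) := fun ρ => (meas_Cy _ _).inter (measurableSet_Hs τ)
  have mV := hu.contV.measurable.enorm
  have mP := (Pop_meas hA hu).enorm
  have key := hN R hR A' hA' v hv ((τ - z.1) / r ^ 2) s
  simp only [eV, eP, pre] at key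
  rw [sc_lint z hr mV _ (mm _), sc_lint z hr (mP.pow_const q) _ (mm _), sc_lint z hr (mV.pow_const q) _ (mm _)] at key
  have e1 : volume {p | p ∈ sc z r ⁻¹' (Cy z (r * R) ∩ Hs τ) ∧ s < ‖VV u (sc z r p)‖ₑ} =
      oR ((r ^ (n + 3))⁻¹) * volume {p ∈ Cy z (r * R) ∩ Hs τ | s < ‖VV u p‖ₑ} := by
    have mT : MeasurableSet {p ∈ Cy z (r * R) ∩ Hs τ | s < ‖VV u p‖ₑ} :=
      (mm R).inter (measurableSet_lt measurable_const mV)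
    have := Measure.map_apply (μ := volume) (sc_cont z r).measurable mT
    rw [sc_map z hr, Measure.smul_apply, smul_eq_mul] at this
    rw [this]; rfl
  rw [e1] at key
  have k2 := key hs
  set c := oR ((r ^ (n + 3))⁻¹)
  have hc0 : c ≠ 0 := by simp only [c, ne_eq, ofReal_eq_zero, not_le]; positivity
  have hc1 : c ≠ ∞ := ofReal_ne_top
  refine (ENNReal.mul_le_mul_iff_right hc0 hc1).1 (le_trans (le_of_eq ?_) (k2.trans (le_of_eq ?_)))
  · ring
  · ring

end

section
variable {n : ℕ}

theorem vol_Cy_pos (z : E n) {r : ℝ} (hr : 0 < r) : volume (Cy z r) ≠ 0 := by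
  rw [vol_Cy z hr, Ne, ofReal_eq_zero, not_le]; positivity

theorem vol_Cy_fin (z : E n) {r : ℝ} (hr : 0 < r) : volume (Cy z r) ≠ ∞ := by
  rw [vol_Cy z hr]; exact ofReal_ne_top

theorem self_Cy (z : E n) {r : ℝ} (hr : 0 < r) : z ∈ Cy z r := by
  refine ⟨?_, fun j => ?_⟩ <;> simp [hr]

theorem RV_sel {m : ℝ} (hm : 0 < m) {V g : Fu n} (hVm : ∀ z, 0 ≤ V z) (hV : ∀ z, V z ^ m ≤ g z)
    (lsc : ∀ z s, s < V z → ∃ r > 0, ∀ y ∈ Cy z r, s < V y)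
    (hg : ∫⁻ z, oR (g z) ≠ ∞) {s : ℝ} (hs : 0 < s) :
    ∃ B : ℝ, ∀ z, s < V z → ∃ r > 0, r ≤ B ∧
      oR (s ^ m) * volume (Cy z r) ≤ ∫⁻ p in Cy z r, oR (g p) ∧
      ∀ ρ, 2 * r ≤ ρ → ∫⁻ p in Cy z ρ, oR (g p) ≤ oR (s ^ m) * volume (Cy z ρ) := by
  set I := ∫⁻ z, oR (g z)
  have hsm : 0 < s ^ m := Real.rpow_pos_of_pos hs m
  set B := max 1 (I.toReal / s ^ m)
  have hbd : ∀ z r, 0 < r → oR (s ^ m) * volume (Cy z r) ≤ ∫⁻ p in Cy z r, oR (g p) →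
      r ≤ B := by
    intro z r hr h
    by_contra hB
    push Not at hB
    have h1 : 1 < r := lt_of_le_of_lt (le_max_left _ _) hB
    have h2 : I.toReal / s ^ m < r := lt_of_le_of_lt (le_max_right _ _) hB
    have h3 := h.trans (setLIntegral_le_lintegral _ _)
    rw [vol_Cy z hr, ← ofReal_mul hsm.le] at h3
    have h4 := (ofReal_le_iff_le_toReal hg).1 h3
    rw [div_lt_iff₀ hsm] at h2
    have h5 : r ≤ 2 ^ (n+2) * r ^ (n+3) := by
      have a1 : r ≤ r ^ (n+3) := le_self_pow₀ h1.le (by omega)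
      have a2 : (1:ℝ) ≤ 2 ^ (n+2) := one_le_pow₀ (by norm_num)
      nlinarith
    have h6 := mul_le_mul_of_nonneg_left h5 hsm.le
    change _ ≤ I.toReal at h4
    linarith
  refine ⟨B, fun z hz => ?_⟩
  set S := {r : ℝ | 0 < r ∧ oR (s ^ m) * volume (Cy z r) ≤ ∫⁻ p in Cy z r, oR (g p)}
  have hSb : BddAbove S := ⟨B, fun r hr => hbd z r hr.1 hr.2⟩
  obtain ⟨r0, hr0, h0⟩ := lsc z s hz
  have hr0S : r0 ∈ S := by
    refine ⟨hr0, ?_⟩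
    rw [← setLIntegral_const]
    refine setLIntegral_mono' (meas_Cy _ _) fun y hy => ofReal_le_ofReal ?_
    exact (Real.rpow_le_rpow hs.le (h0 y hy).le hm.le).trans (hV y)
  have hpos : 0 < sSup S := lt_of_lt_of_le hr0 (le_csSup hSb hr0S)
  obtain ⟨r, hr, hr2⟩ := exists_lt_of_lt_csSup ⟨r0, hr0S⟩ (half_lt_self hpos)
  refine ⟨r, hr.1, hbd z r hr.1 hr.2, hr.2, fun ρ hρ => ?_⟩
  by_contra hc
  have h5 : ρ ∈ S := ⟨by linarith [hr.1], (not_le.1 hc).le⟩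
  have h6 := le_csSup hSb h5
  linarith

theorem RV_lev {m κ : ℝ} (hm : 0 < m) (hκ : 1 ≤ κ) {ε : ℝ≥0∞} {V g : Fu n} (hVm : ∀ z, 0 ≤ V z)
    (hgm : Measurable g) (hV : ∀ z, V z ^ m ≤ g z)
    (lsc : ∀ z s, s < V z → ∃ r > 0, ∀ y ∈ Cy z r, s < V y)
    (hg : ∫⁻ z, oR (g z) ≠ ∞)
    (hB : ∀ z r s, 0 < r → 0 < s → (∀ ρ, 2 * r ≤ ρ → ∫⁻ p in Cy z ρ, oR (g p) ≤
      oR (s ^ m) * volume (Cy z ρ)) → volume {p ∈ Cy z (3 * r) | κ * s < V p} ≤ ε * volume (Cy z r))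
    {s : ℝ} (hs : 0 < s) :
    oR (s ^ m) * volume {p | κ * s < V p} ≤
      2 * ε * ∫⁻ p in {p | s ^ m / 2 < g p}, oR (g p) := by
  have hsm : 0 < s ^ m := Real.rpow_pos_of_pos hs m
  obtain ⟨B, hsel⟩ := RV_sel hm hVm hV lsc hg hs
  set t := {p | κ * s < V p}
  have ht : ∀ z ∈ t, s < V z := fun z hz => lt_of_le_of_lt (by nlinarith) hz
  choose! r hr0 hrB hrl hru using hsel
  obtain ⟨u, hut, hdis, hcov⟩ := Vitali.exists_disjoint_subfamily_covering_enlargement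
    (fun z => Cy z (r z)) t r 2 (by norm_num) (fun a ha => (hr0 a (ht a ha)).le) B (fun a ha => hrB a (ht a ha))
    (fun a ha => ⟨a, self_Cy a (hr0 a (ht a ha))⟩)
  have hr' : ∀ b ∈ u, 0 < r b := fun b hb => hr0 b (ht b (hut hb))
  have hc : u.Countable := hdis.countable_of_isOpen (fun i _ => isOpen_Cy _ _)
    (fun b hb => ⟨b, self_Cy b (hr' b hb)⟩)
  have hsub : t ⊆ ⋃ b ∈ u, {p ∈ Cy b (3 * r b) | κ * s < V p} := by
    intro z hz
    obtain ⟨b, hb, ⟨y, hy1, hy2⟩, hle⟩ := hcov z hz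
    refine Set.mem_biUnion hb ⟨?_, hz⟩
    have hrz := hr0 z (ht z hz)
    have hrb := hr' b hb
    refine ⟨?_, fun j => ?_⟩
    · have h1 := abs_lt.1 hy1.1
      have h2 := abs_lt.1 hy2.1
      have h3 : r z ^ 2 ≤ 4 * r b ^ 2 := by nlinarith
      rw [abs_lt]; constructor <;> nlinarith
    · have h1 := abs_lt.1 (hy1.2 j)
      have h2 := abs_lt.1 (hy2.2 j)
      rw [abs_lt]; constructor <;> linarith
  set W := {p | s ^ m / 2 < g p}
  have mW : MeasurableSet W := measurableSet_lt measurable_const hgm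
  have half : ∀ b ∈ u, oR (s ^ m) * volume (Cy b (r b)) ≤
      2 * ∫⁻ p in Cy b (r b), W.indicator (fun p => oR (g p)) p := by
    intro b hb
    have h1 := hrl b (ht b (hut hb))
    set X := ∫⁻ p in Cy b (r b), W.indicator (fun p => oR (g p)) p
    have h2 : ∫⁻ p in Cy b (r b), oR (g p) ≤ X + oR (s ^ m / 2) * volume (Cy b (r b)) := by
      rw [← setLIntegral_const, ← lintegral_add_right _ measurable_const]
      refine lintegral_mono fun p => ?_
      by_cases hp : p ∈ W
      · simp only [Set.indicator_of_mem hp]; exact le_self_add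
      · refine le_trans (ofReal_le_ofReal (not_lt.1 hp)) le_add_self
    have hf : oR (s ^ m / 2) * volume (Cy b (r b)) ≠ ∞ :=
      mul_ne_top ofReal_ne_top (vol_Cy_fin _ (hr' b hb))
    have e : oR (s ^ m) * volume (Cy b (r b)) = oR (s ^ m / 2) * volume (Cy b (r b)) +
        oR (s ^ m / 2) * volume (Cy b (r b)) := by
      rw [← add_mul, ← ofReal_add (by positivity) (by positivity), add_halves]
    have h3 := h1.trans h2
    rw [e, ENNReal.add_le_add_iff_right hf] at h3
    rw [e, two_mul]; exact add_le_add h3 h3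
  haveI := hc.to_subtype
  have hdis' : Pairwise (Function.onFun Disjoint fun b : u => Cy b.1 (r b.1)) := hdis.subtype _ _
  calc oR (s ^ m) * volume t
      ≤ oR (s ^ m) * ∑' b : u, ε * volume (Cy b.1 (r b.1)) := by
        refine mul_le_mul' le_rfl (((measure_mono hsub).trans (measure_biUnion_le _ hc _)).trans ?_)
        exact ENNReal.tsum_le_tsum fun b => hB _ _ _ (hr' _ b.2) hs (hru _ (ht _ (hut b.2)))
    _ = ε * ∑' b : u, oR (s ^ m) * volume (Cy b.1 (r b.1)) := by
        rw [ENNReal.tsum_mul_left, ENNReal.tsum_mul_left]; ring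
    _ ≤ ε * ∑' b : u, 2 * ∫⁻ p in Cy b.1 (r b.1), W.indicator (fun p => oR (g p)) p :=
        mul_le_mul' le_rfl (ENNReal.tsum_le_tsum fun b => half _ b.2)
    _ = 2 * ε * ∫⁻ p in ⋃ b : u, Cy b.1 (r b.1), W.indicator (fun p => oR (g p)) p := by
        rw [lintegral_iUnion (fun b => meas_Cy _ _) hdis', ENNReal.tsum_mul_left]; ring
    _ ≤ _ := by
        refine mul_le_mul' le_rfl ((setLIntegral_le_lintegral _ _).trans ?_)
        rw [lintegral_indicator mW]

theorem RV {m p κ : ℝ} (hm : 0 < m) (hp : m < p) (hκ : 1 ≤ κ) {ε : ℝ≥0∞} {V g : Fu n} (hVm : ∀ z, 0 ≤ V z)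
    (hVme : Measurable V) (hgm : Measurable g) (hV : ∀ z, V z ^ m ≤ g z)
    (lsc : ∀ z s, s < V z → ∃ r > 0, ∀ y ∈ Cy z r, s < V y)
    (hg : ∫⁻ z, oR (g z) ≠ ∞)
    (hB : ∀ z r s, 0 < r → 0 < s → (∀ ρ, 2 * r ≤ ρ → ∫⁻ p in Cy z ρ, oR (g p) ≤
      oR (s ^ m) * volume (Cy z ρ)) → volume {p ∈ Cy z (3 * r) | κ * s < V p} ≤ ε * volume (Cy z r)) :
    ∫⁻ z, oR (V z ^ p) ≤ oR (κ ^ p) * (oR (2 * p / (p - m) * 2 ^ ((p-m)/m)) *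
      (ε * ∫⁻ z, oR (g z ^ (p / m)))) := by
  have hp0 : 0 < p := hm.trans hp
  have hpm : 0 < p - m := by linarith
  have hκ0 : 0 < κ := by linarith
  have hg0 : ∀ z, 0 ≤ g z := fun z => (Real.rpow_nonneg (hVm z) m).trans (hV z)
  set W : E n → ℝ := fun z => (2 * g z) ^ (1 / m)
  have mW : Measurable W := (hgm.const_mul 2).pow_const _
  have hW0 : ∀ z, 0 ≤ W z := fun z => Real.rpow_nonneg (by linarith [hg0 z]) _
  have e1 : ∫⁻ z, oR (V z ^ p) = oR (κ ^ p) * ∫⁻ z, oR ((V z / κ) ^ p) := by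
    rw [← lintegral_const_mul _ ((hVme.div_const κ).pow_const p).ennreal_ofReal]
    refine lintegral_congr fun z => ?_
    rw [← ofReal_mul (by positivity), Real.div_rpow (hVm z) hκ0.le, mul_div_cancel₀ _ (by positivity)]
  rw [e1]
  refine mul_le_mul' le_rfl ?_
  rw [lintegral_rpow_eq_lintegral_meas_lt_mul volume (Filter.Eventually.of_forall fun z => div_nonneg (hVm z) hκ0.le)
    (hVme.div_const κ).aemeasurable hp0]
  set μ : Measure (E n) := volume.withDensity fun z => oR (g z)
  have e2 := lintegral_rpow_eq_lintegral_meas_lt_mul μ (Filter.Eventually.of_forall hW0) mW.aemeasurable hpm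
  have e3 : ∫⁻ z, oR (W z ^ (p - m)) ∂μ = oR (2 ^ ((p-m)/m)) * ∫⁻ z, oR (g z ^ (p / m)) := by
    rw [lintegral_withDensity_eq_lintegral_mul _ hgm.ennreal_ofReal (mW.pow_const _).ennreal_ofReal,
      ← lintegral_const_mul _ (hgm.pow_const _).ennreal_ofReal]
    refine lintegral_congr fun z => ?_
    simp only [Pi.mul_apply, W]
    rw [← ofReal_mul (hg0 z), ← ofReal_mul (by positivity), ← Real.rpow_mul (by linarith [hg0 z]),
      Real.mul_rpow (by norm_num) (hg0 z), show 1 / m * (p - m) = (p - m) / m by ring,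
      show p / m = 1 + (p - m) / m by field_simp; ring]
    congr 1
    rcases (hg0 z).eq_or_lt with h | h
    · rw [← h, Real.zero_rpow (by positivity), Real.zero_rpow (by positivity)]; ring
    · rw [Real.rpow_add h, Real.rpow_one]; ring
  have e4 : ∀ s ∈ Set.Ioi (0:ℝ), volume {a | s < V a / κ} * oR (s ^ (p - 1)) ≤
      2 * ε * (μ {a | s < W a} * oR (s ^ (p - m - 1))) := by
    intro s hs
    have hs : 0 < s := hs
    have l := RV_lev hm hκ hVm hgm hV lsc hg hB hs
    have a1 : {a | s < V a / κ} = {p | κ * s < V p} := by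
      ext z; simp only [Set.mem_setOf_eq]; rw [lt_div_iff₀ hκ0, mul_comm]
    have a2 : {a | s < W a} = {p | s ^ m / 2 < g p} := by
      ext z; simp only [Set.mem_setOf_eq, W]
      rw [one_div, Real.lt_rpow_inv_iff_of_pos hs.le (by linarith [hg0 z]) hm]
      constructor <;> intro h <;> linarith
    rw [a1, a2, withDensity_apply _ (measurableSet_lt measurable_const hgm),
      show s ^ (p - 1) = s ^ m * s ^ (p - m - 1) by rw [← Real.rpow_add hs]; congr 1; ring,
      ofReal_mul (by positivity), ← mul_assoc, ← mul_assoc, mul_comm (volume _)]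
    exact mul_le_mul' l le_rfl
  have mm : Measurable fun s : ℝ => μ {a | s < W a} * oR (s ^ (p - m - 1)) := by
    refine Measurable.mul (Antitone.measurable fun s t hst => measure_mono fun a ha => lt_of_le_of_lt hst ha) ?_
    fun_prop
  refine (mul_le_mul' le_rfl (setLIntegral_mono' measurableSet_Ioi e4)).trans ?_
  rw [lintegral_const_mul _ mm]
  have e5 : ∫⁻ t in Set.Ioi (0:ℝ), μ {a | t < W a} * oR (t ^ (p - m - 1)) =
      oR (p - m)⁻¹ * (oR (2 ^ ((p-m)/m)) * ∫⁻ z, oR (g z ^ (p / m))) := by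
    rw [← e3, e2, ← mul_assoc, ← ofReal_mul (by positivity), inv_mul_cancel₀ hpm.ne']; simp
  rw [e5]
  refine le_of_eq ?_
  rw [show 2 * p / (p - m) * 2 ^ ((p-m)/m) = 2 * (p * ((p - m)⁻¹ * 2 ^ ((p-m)/m))) by field_simp,
    ofReal_mul (by norm_num), ofReal_mul hp0.le, ofReal_mul (by positivity)]
  simp only [ofReal_ofNat]
  ring

end

section
variable {n : ℕ}

structure GEll (δ : ℝ) (a : E n → Mx n) : Prop where
  meas : ∀ j k, Measurable (fun s => a s j k)
  ell : ∀ s, Ell δ (a s)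

noncomputable def dA (A : ℝ → Mx n) (a : E n → Mx n)
    (p : E n) : ℝ := ∑ j, ∑ k, |A (p.2 0) j k - a p j k|

theorem dA_nonneg (A : ℝ → Mx n) (a : E n → Mx n)
    (p : E n) : 0 ≤ dA A a p := by unfold dA; positivity

theorem dA_meas {δ : ℝ} {A : ℝ → Mx n} {a : E n → Mx n}
    (hA : MEll δ A) (ha : GEll δ a) : Measurable (dA A a) := by
  unfold dA
  refine Finset.measurable_sum _ fun j _ => Finset.measurable_sum _ fun k _ => ?_
  exact (((hA.meas j k).comp ((measurable_pi_apply 0).comp measurable_snd)).sub (ha.meas j k)).abs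

theorem dA_le {δ : ℝ} (hδ : 0 < δ) {A : ℝ → Mx n} {a : E n → Mx n}
    (hA : MEll δ A) (ha : GEll δ a) (p : E n) : dA A a p ≤ (n+1)^2 * (2 * δ⁻¹) := by
  have : dA A a p ≤ ∑ j : Ix n, ∑ k : Ix n, 2 * δ⁻¹ := by
    refine Finset.sum_le_sum fun j _ => Finset.sum_le_sum fun k _ => ?_
    refine (abs_sub _ _).trans ?_
    have h1 := (hA.ell (p.2 0)).bdd hδ j k
    have h2 := (ha.ell p).bdd hδ j k
    linarith
  refine this.trans (le_of_eq ?_); simp; ring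

theorem Pa_meas {δ : ℝ} {a : E n → Mx n} (ha : GEll δ a)
    {u : Fu n} (hu : TF u) : Measurable (Pa a u) := by
  unfold Pa
  refine (hu.D et).cont.measurable.add (Finset.measurable_sum _ fun j _ =>
    Finset.measurable_sum _ fun k _ => ?_)
  exact (ha.meas j k).mul ((hu.D (ex k)).D (ex j)).cont.measurable

theorem Pa_le {δ : ℝ} (hδ : 0 < δ) {a : E n → Mx n} (ha : GEll δ a)
    (u : Fu n) (p : E n) : |Pa a u p| ≤ (1 + δ⁻¹) * VV u p :=
  Pop_le hδ (A := fun _ => a p) (fun _ => ha.ell p) u p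

theorem Pop_Pa (A : ℝ → Mx n) (a : E n → Mx n)
    (u : Fu n) (p : E n) : |Pop A u p| ≤ |Pa a u p| + dA A a p * VV u p := by
  have e : Pop A u p = Pa a u p + ∑ j, ∑ k, (A (p.2 0) j k - a p j k) * Dd j k u p := by
    unfold Pop Pa
    simp only [sub_mul, Finset.sum_sub_distrib]; ring
  rw [e]
  refine (abs_add_le _ _).trans (add_le_add le_rfl ?_)
  unfold dA
  rw [Finset.sum_mul]
  refine (Finset.abs_sum_le_sum_abs _ _).trans (Finset.sum_le_sum fun j _ => ?_)
  rw [Finset.sum_mul]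
  refine (Finset.abs_sum_le_sum_abs _ _).trans (Finset.sum_le_sum fun k _ => ?_)
  rw [abs_mul]
  exact mul_le_mul_of_nonneg_left (VV_exr u p j k) (abs_nonneg _)

theorem young_e {e m : ℝ} (he : 0 < e) (hem : e ≤ m) (h : ℝ≥0∞) {σ : ℝ≥0∞} (h0 : σ ≠ 0) (h1 : σ ≠ ∞) :
    h ^ e ≤ σ ^ e + σ ^ (e - m) * h ^ m := by
  rcases le_total h σ with hh | hh
  · exact (rpow_le_rpow hh he.le).trans le_self_add
  · refine le_trans ?_ le_add_self
    calc h ^ e = σ ^ (e - m) * (σ ^ (m - e) * h ^ e) := by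
          rw [← mul_assoc, ← rpow_add _ _ h0 h1]; simp
      _ ≤ σ ^ (e - m) * (h ^ (m - e) * h ^ e) := by
          exact mul_le_mul' le_rfl (mul_le_mul' (rpow_le_rpow hh (by linarith)) le_rfl)
      _ = _ := by rw [← rpow_add_of_nonneg _ _ (by linarith) he.le]; simp

theorem hold_e {e m : ℝ} (he : 0 < e) (hem : e ≤ m) {C : Set (E n)} {h : E n → ℝ≥0∞} (hh : Measurable h)
    {σ X : ℝ≥0∞} (h0 : σ ≠ 0) (h1 : σ ≠ ∞) (hC : volume C ≤ X) (hm : ∫⁻ p in C, h p ^ m ≤ σ ^ m * X) :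
    ∫⁻ p in C, h p ^ e ≤ 2 * (σ ^ e * X) := by
  calc ∫⁻ p in C, h p ^ e ≤ ∫⁻ p in C, (σ ^ e + σ ^ (e - m) * h p ^ m) :=
        lintegral_mono fun p => young_e he hem _ h0 h1
    _ = σ ^ e * volume C + σ ^ (e - m) * ∫⁻ p in C, h p ^ m := by
        rw [lintegral_add_left measurable_const, setLIntegral_const, lintegral_const_mul _ (hh.pow_const _)]
    _ ≤ σ ^ e * X + σ ^ (e - m) * (σ ^ m * X) := add_le_add (mul_le_mul' le_rfl hC) (mul_le_mul' le_rfl hm)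
    _ = _ := by
        rw [← mul_assoc (σ ^ (e - m)), ← rpow_add _ _ h0 h1, two_mul]; simp

theorem hold_a {q m : ℝ} (hq : 1 ≤ q) (hqm : q ≤ m) {C : Set (E n)} {v α : E n → ℝ≥0∞} (hv : Measurable v)
    (hα : Measurable α) {σ X M Λ γ : ℝ≥0∞} (h0 : σ ≠ 0) (h1 : σ ≠ ∞) (hL0 : Λ ≠ 0) (hL1 : Λ ≠ ∞)
    (hM : ∀ p, α p ≤ M) (hg : ∫⁻ p in C, α p ≤ γ * X)
    (hm : ∫⁻ p in C, v p ^ m ≤ σ ^ m * X) :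
    ∫⁻ p in C, (α p * v p) ^ q ≤ (M ^ (q - 1) * Λ ^ q * γ + M ^ q * Λ ^ (q - m)) * (σ ^ q * X) := by
  have hq0 : 0 < q := by linarith
  have hs0 : Λ * σ ≠ 0 := mul_ne_zero hL0 h0
  have hs1 : Λ * σ ≠ ∞ := mul_ne_top hL1 h1
  calc ∫⁻ p in C, (α p * v p) ^ q ≤
        ∫⁻ p in C, ((Λ * σ) ^ q * M ^ (q - 1) * α p + M ^ q * (Λ * σ) ^ (q - m) * v p ^ m) := by
        refine lintegral_mono fun p => ?_
        simp only
        rw [mul_rpow_of_nonneg _ _ hq0.le]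
        refine (mul_le_mul' le_rfl (young_e hq0 hqm (v p) hs0 hs1)).trans ?_
        rw [mul_add]
        refine add_le_add ?_ ?_
        · rw [mul_comm, mul_assoc]
          refine mul_le_mul' le_rfl ?_
          calc α p ^ q = α p ^ (q - 1) * α p := by
                conv_rhs => rw [← rpow_one (α p), ← rpow_mul, ← rpow_add_of_nonneg _ _ (by linarith) zero_le_one]
                simp
            _ ≤ _ := mul_le_mul' (rpow_le_rpow (hM p) (by linarith)) le_rfl
        · rw [mul_assoc]
          exact mul_le_mul' (rpow_le_rpow (hM p) hq0.le) le_rfl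
    _ = (Λ * σ) ^ q * M ^ (q - 1) * (∫⁻ p in C, α p) + M ^ q * (Λ * σ) ^ (q - m) * ∫⁻ p in C, v p ^ m := by
        rw [lintegral_add_left (hα.const_mul _), lintegral_const_mul _ hα, lintegral_const_mul _ (hv.pow_const _)]
    _ ≤ (Λ * σ) ^ q * M ^ (q - 1) * (γ * X) + M ^ q * (Λ * σ) ^ (q - m) * (σ ^ m * X) :=
        add_le_add (mul_le_mul' le_rfl hg) (mul_le_mul' le_rfl hm)
    _ = _ := by
        have e1 : (Λ * σ) ^ (q - m) * σ ^ m = Λ ^ (q - m) * σ ^ q := by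
          rw [mul_rpow_of_ne_top hL1 h1, mul_assoc, ← rpow_add _ _ h0 h1]; simp
        rw [show M ^ q * (Λ * σ) ^ (q - m) * (σ ^ m * X) = M ^ q * ((Λ * σ) ^ (q - m) * σ ^ m) * X by ring, e1,
          mul_rpow_of_ne_top hL1 h1]
        ring

theorem ball {δ q m : ℝ} (hδ : 0 < δ) (hq : 1 ≤ q) (hqm : q ≤ m) (hQ : HQ n δ q) : ∃ N : NNReal, 1 ≤ N ∧
    ∀ R : ℝ, 1 ≤ R → ∀ (Θ Λ : ℝ) (γ : ℝ≥0∞), 1 ≤ Θ → 1 ≤ Λ → ∀ a, GEll δ a → ∀ (S : Set (E n)), MeasurableSet S →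
    ∀ u : E n → ℝ, TF u → tsupport u ⊆ S → ∀ (z : E n) (r : ℝ), 0 < r → 
    (∃ A, MEll δ A ∧ ∫⁻ p in Cy z (15 * r) ∩ S, oR (dA A a p) ≤ γ * volume (Cy z (15 * r))) →
    ∀ τ (s : ℝ), 0 < s →
    ∫⁻ p in Cy z (15 * r) ∩ Hs τ, ‖VV u p‖ₑ ^ m ≤ oR s ^ m * volume (Cy z (15 * r)) →
    ∫⁻ p in Cy z (15 * r) ∩ Hs τ, ‖Pa a u p‖ₑ ^ m ≤ oR (Θ⁻¹ * s) ^ m * volume (Cy z (15 * r)) →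
    volume {p ∈ Cy z (3 * r) ∩ Hs τ | oR (N * R ^ (n+3) * s) < ‖VV u p‖ₑ} ≤
      oR (N * R ^ (n+3)) ^ (-q) * (N * (oR Θ ^ (-q) + (oR Λ ^ q * γ +
        oR Λ ^ (q - m)) + oR R ^ (-q)) * volume (Cy z r)) := by
  obtain ⟨N, hN⟩ := badset_r hδ hq hQ
  have hq0 : 0 < q := by linarith
  set Mr : ℝ := (n+1)^2 * (2 * δ⁻¹)
  have hMr : 0 ≤ Mr := by positivity
  set M : NNReal := ⟨Mr, hMr⟩
  set N1 : NNReal := N * 2 ^ (n+3) * 5 ^ (n+3) + N * 15 ^ (n+3) * (2 ^ (q-1) * (2 + M ^ (q-1) + M ^ q) + 2) + 1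
  refine ⟨N1, le_add_self, fun R hR Θ Λ γ hΘ hΛ a ha S hS u hu huS z r hr hfr τ s hs hV hF => ?_⟩
  obtain ⟨A, hA, hAg⟩ := hfr
  have hR0 : 0 < R := by linarith
  set C := Cy z (15 * r) ∩ Hs τ
  set X := volume (Cy z (15 * r))
  set σ := oR s
  have s0 : σ ≠ 0 := by simp only [σ, ne_eq, ofReal_eq_zero, not_le]; exact hs
  have s1 : σ ≠ ∞ := ofReal_ne_top
  have hCX : volume C ≤ X := measure_mono Set.inter_subset_left
  have mV := hu.contV.measurable.enorm
  have mF := (Pa_meas ha hu).enorm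
  have hX : X = oR (15 ^ (n+3)) * volume (Cy z r) := by
    simp only [X]
    rw [vol_Cy z hr, vol_Cy z (by positivity), ← ofReal_mul (by positivity)]; congr 1; ring
  have i1 : ∫⁻ p in C, ‖VV u p‖ₑ ≤ 2 * (σ * X) := by
    have := hold_e one_pos (hq.trans hqm) mV s0 s1 hCX hV
    simpa using this
  have i2 : ∫⁻ p in C, ‖VV u p‖ₑ ^ q ≤ 2 * (σ ^ q * X) := hold_e hq0 hqm mV s0 s1 hCX hV
  have i3 : ∫⁻ p in C, ‖Pa a u p‖ₑ ^ q ≤ 2 * (oR Θ ^ (-q) * (σ ^ q * X)) := by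
    have h := hold_e hq0 hqm mF (σ := oR (Θ⁻¹ * s)) (by
      simp only [ne_eq, ofReal_eq_zero, not_le]; positivity) ofReal_ne_top hCX hF
    rw [ofReal_mul (by positivity), mul_rpow_of_nonneg _ _ hq0.le,
      ofReal_inv_of_pos (by linarith), inv_rpow, ← rpow_neg] at h
    refine h.trans (le_of_eq (by ring))
  set α : E n → ℝ≥0∞ := S.indicator fun p => oR (dA A a p)
  have mα : Measurable α := (dA_meas hA ha).ennreal_ofReal.indicator hS
  have hαM : ∀ p, α p ≤ (M : ℝ≥0∞) := fun p => by
    refine (Set.indicator_le_self' (fun _ _ => zero_le) p).trans ?_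
    rw [ofReal_le_iff_le_toReal coe_ne_top]; exact dA_le hδ hA ha p
  have iα : ∫⁻ p in C, α p ≤ γ * X := by
    rw [setLIntegral_indicator hS]
    refine le_trans (lintegral_mono_set ?_) hAg
    exact fun p hp => ⟨hp.2.1, hp.1⟩
  have i4 := hold_a hq hqm mV mα s0 s1 (Λ := oR Λ) (by
      simp only [ne_eq, ofReal_eq_zero, not_le]; positivity) ofReal_ne_top hαM iα hV
  have hpt : ∀ p, ‖Pop A u p‖ₑ ≤ ‖Pa a u p‖ₑ + α p * ‖VV u p‖ₑ := by
    intro p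
    have h := Pop_Pa A a u p
    have : ‖Pop A u p‖ₑ ≤ ‖Pa a u p‖ₑ + oR (dA A a p) * ‖VV u p‖ₑ := by
      rw [← ofReal_norm, ← ofReal_norm (Pa a u p), Real.enorm_eq_ofReal (VV_nonneg u p),
        ← ofReal_mul (dA_nonneg _ _ _), ← ofReal_add (norm_nonneg _) (mul_nonneg (dA_nonneg _ _ _) (VV_nonneg _ _))]
      exact ofReal_le_ofReal h
    by_cases hp : p ∈ S
    · simpa only [α, Set.indicator_of_mem hp] using this
    · have h0 : VV u p = 0 := by
        have := VV_congr (S := (tsupport u)ᶜ) (isClosed_tsupport u).isOpen_compl (f := u) (g := fun _ => 0)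
          (fun y hy => image_eq_zero_of_notMem_tsupport hy) p (fun h => hp (huS h))
        rw [this]; simp [VV, D_const]
      simpa [h0] using this
  have i5 : ∫⁻ p in C, ‖Pop A u p‖ₑ ^ q ≤ 2 ^ (q-1) * ((∫⁻ p in C, ‖Pa a u p‖ₑ ^ q) + ∫⁻ p in C, (α p * ‖VV u p‖ₑ) ^ q) := by
    rw [← lintegral_add_left (mF.pow_const q), ← lintegral_const_mul' _ _ (rpow_ne_top_of_nonneg (by linarith) (by simp))]
    refine lintegral_mono fun p => (rpow_le_rpow (hpt p) hq0.le).trans ?_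
    exact rpow_add_le_mul_rpow_add_rpow _ _ hq
  set r' := 3 * r / R
  have hr' : 0 < r' := by positivity
  have rr1 : r' * (5 * R) = 15 * r := by simp only [r']; field_simp; ring
  have rr2 : r' * R = 3 * r := by simp only [r']; field_simp
  set κ : ℝ := N1 * R ^ (n+3)
  have hN1 : (1:ℝ) ≤ N1 := NNReal.coe_le_coe.2 (le_add_self : (1:NNReal) ≤ N1)
  have hκ : 0 < κ := by positivity
  have key := hN R hR A hA u hu τ z r' hr' (oR (κ * s)) ?_
  · rw [rr1, rr2] at key
    set T := volume {p ∈ Cy z (3 * r) ∩ Hs τ | oR (κ * s) < ‖VV u p‖ₑ}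
    have k0 : oR κ ≠ 0 := by simp only [ne_eq, ofReal_eq_zero, not_le]; exact hκ
    have k1 : oR κ ≠ ∞ := ofReal_ne_top
    rw [ofReal_mul hκ.le, mul_rpow_of_nonneg _ _ hq0.le] at key
    set P := oR Θ ^ (-q) + (oR Λ ^ q * γ + oR Λ ^ (q - m)) + oR R ^ (-q)
    have main : oR κ ^ q * σ ^ q * T ≤ σ ^ q * (N1 * P * volume (Cy z r)) := by
      refine key.trans ((mul_le_mul' le_rfl (add_le_add (i5.trans (mul_le_mul' le_rfl (add_le_add i3 i4)))
        (mul_le_mul' le_rfl i2))).trans ?_)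
      rw [ofReal_inv_of_pos hR0, inv_rpow, ← rpow_neg, hX]
      set t1 := oR Θ ^ (-q)
      set t2 := oR Λ ^ q
      set t3 := oR Λ ^ (q - m)
      set t4 := oR R ^ (-q)
      have b1 : (2:ℝ≥0∞) ^ (q-1) * (2 * t1 + ((M:ℝ≥0∞) ^ (q-1) * t2 * γ + (M:ℝ≥0∞) ^ q * t3)) + 2 * t4 ≤
          (2 ^ (q-1) * (2 + (M:ℝ≥0∞) ^ (q-1) + (M:ℝ≥0∞) ^ q) + 2) * P := by
        rw [add_mul _ _ P, mul_assoc _ _ P]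
        refine add_le_add (mul_le_mul' le_rfl ?_) (mul_le_mul' le_rfl le_add_self)
        rw [add_mul _ _ P, add_mul _ _ P, add_assoc]
        refine add_le_add (mul_le_mul' le_rfl ?_) (add_le_add ?_ (mul_le_mul' le_rfl ?_))
        · exact le_self_add.trans le_self_add
        · rw [mul_assoc]; refine mul_le_mul' le_rfl ?_
          exact (le_self_add.trans le_add_self).trans le_self_add
        · exact (le_add_self.trans le_add_self).trans le_self_add
      have b2 : (N:ℝ≥0∞) * oR (15 ^ (n+3)) * (2 ^ (q-1) * (2 + (M:ℝ≥0∞) ^ (q-1) + (M:ℝ≥0∞) ^ q) + 2) ≤ N1 := by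
        simp only [N1]
        push_cast
        rw [coe_rpow_of_nonneg _ hq0.le, coe_rpow_of_nonneg _ (by linarith : 0 ≤ q - 1), coe_rpow_of_nonneg _ (by linarith : 0 ≤ q - 1),
          ofReal_pow (by norm_num)]
        push_cast
        simp only [ofReal_ofNat]
        exact le_add_self.trans le_self_add
      calc _ = σ ^ q * ((N:ℝ≥0∞) * oR (15 ^ (n+3)) * ((2:ℝ≥0∞) ^ (q-1) * (2 * t1 + ((M:ℝ≥0∞) ^ (q-1) * t2 * γ + (M:ℝ≥0∞) ^ q * t3)) + 2 * t4) * volume (Cy z r)) := by ring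
        _ ≤ _ := by
          refine mul_le_mul' le_rfl (mul_le_mul' ((mul_le_mul' le_rfl b1).trans ?_) le_rfl)
          rw [← mul_assoc]; exact mul_le_mul' b2 le_rfl
    have sq0 : σ ^ q ≠ 0 := by simp [rpow_eq_zero_iff, s0, s1]
    have sq1 : σ ^ q ≠ ∞ := rpow_ne_top_of_nonneg hq0.le s1
    have m2 : oR κ ^ q * T ≤ N1 * P * volume (Cy z r) := by
      refine (ENNReal.mul_le_mul_iff_right sq0 sq1).1 (le_trans (le_of_eq (by ring)) main)
    calc T = oR κ ^ (-q) * (oR κ ^ q * T) := by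
          rw [← mul_assoc, ← rpow_add _ _ k0 k1]; simp
      _ ≤ _ := mul_le_mul' le_rfl m2
  · rw [rr1]
    refine (mul_le_mul' le_rfl (mul_le_mul' le_rfl i1)).trans ?_
    simp only [X, σ]
    rw [vol_Cy z (by positivity)]
    rw [show (2:ℝ≥0∞) = oR 2 by simp, ← ofReal_coe_nnreal (p := N), ← ofReal_mul hs.le,
      ← ofReal_mul (by norm_num), ← ofReal_mul (by positivity), ← ofReal_mul (by positivity)]
    refine ofReal_le_ofReal ?_
    have : (N:ℝ) * 2 ^ (n+3) * 5 ^ (n+3) ≤ N1 := by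
      have : N * 2 ^ (n+3) * 5 ^ (n+3) ≤ N1 := le_self_add.trans le_self_add
      exact_mod_cast this
    calc _ = ((N:ℝ) * 2 ^ (n+3) * 5 ^ (n+3)) * (R ^ (n+3) * s) := by
          simp only [r']
          have h15 : (15:ℝ)^(n+3) = 3^(n+3) * 5^(n+3) := by rw [← mul_pow]; norm_num
          rw [div_pow, mul_pow, mul_pow, h15]; field_simp; ring
      _ ≤ N1 * (R ^ (n+3) * s) := mul_le_mul_of_nonneg_right this (by positivity)
      _ = _ := by simp only [κ]; ring

end

section
variable {n : ℕ}

theorem Cy_nhds {U : Set (E n)} (hU : IsOpen U) {z : E n} (hz : z ∈ U) : ∃ r > 0, Cy z r ⊆ U := by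
  obtain ⟨ε, hε, hb⟩ := Metric.isOpen_iff.1 hU z hz
  have h0 : 0 < min ε 1 := lt_min hε one_pos
  refine ⟨min ε 1, h0, fun p hp => hb ?_⟩
  have h1 : min ε 1 ^ 2 ≤ ε := by nlinarith [min_le_left ε 1, min_le_right ε 1]
  rw [Metric.mem_ball, Prod.dist_eq, max_lt_iff, dist_pi_lt_iff hε]
  exact ⟨lt_of_lt_of_le hp.1 h1, fun j => lt_of_lt_of_le (hp.2 j) (min_le_left _ _)⟩

theorem pick {C : ℝ≥0∞} (hC : C ≠ ∞) {a : ℝ} (ha : 0 < a) : ∃ x : ℝ, 1 ≤ x ∧ C * oR x ^ (-a) ≤ 1 / 8 := by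
  have h := ((tendsto_rpow_neg_atTop ha).const_mul C.toReal)
  rw [mul_zero] at h
  have h2 := (h.eventually (gt_mem_nhds (show (0:ℝ) < 1/8 by norm_num))).and (Filter.eventually_ge_atTop 1)
  obtain ⟨x, hx, hx1⟩ := h2.exists
  refine ⟨x, hx1, ?_⟩
  rw [ofReal_rpow_of_pos (by linarith), ← ofReal_toReal hC, ← ofReal_mul (by positivity)]
  refine (ofReal_le_ofReal hx.le).trans ?_
  rw [ofReal_div_of_pos (by norm_num)]; simp

theorem TF.VVm {u : Fu n} (hu : TF u) {m : ℝ} (hm : 0 < m) (S : Set (E n)) : ∫⁻ p in S, ‖VV u p‖ₑ ^ m ≠ ∞ := by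
  rw [← nq_rpow hm]
  exact rpow_ne_top_of_nonneg hm.le hu.memV.2.ne

theorem RVcore {δ q m p : ℝ} (hδ : 0 < δ) (hq : 1 ≤ q) (hqm : q ≤ m) (hmp : m < p) (hQ : HQ n δ q) :
    ∃ B N : NNReal, 1 ≤ N ∧
    ∀ R : ℝ, 1 ≤ R → ∀ (Θ Λ : ℝ) (γ : ℝ≥0∞), 1 ≤ Θ → 1 ≤ Λ → ∀ a, GEll δ a → ∀ (S : Set (E n)), MeasurableSet S →
    ∀ u : E n → ℝ, TF u → tsupport u ⊆ S → 
    (∀ z r, 0 < r → ∃ A, MEll δ A ∧ ∫⁻ p in Cy z r ∩ S, oR (dA A a p) ≤ γ * volume (Cy z r)) →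
    ∀ τ, ∫⁻ z in Hs τ, ‖VV u z‖ₑ ^ p ≤
      B * oR (N * R ^ (n+3)) ^ (p-q) * (oR Θ ^ (-q) + (oR Λ ^ q * γ +
        oR Λ ^ (q - m)) + oR R ^ (-q)) *
      ((∫⁻ z in Hs τ, ‖VV u z‖ₑ ^ p) + oR Θ ^ p * ∫⁻ z in Hs τ, ‖Pa a u z‖ₑ ^ p) := by
  obtain ⟨N, hN1, hN⟩ := ball hδ hq hqm hQ
  have hm : 0 < m := by linarith
  have hp : 0 < p := by linarith
  have hpm : 1 ≤ p / m := by rw [le_div_iff₀ hm]; linarith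
  refine ⟨Real.toNNReal (2 * p / (p - m) * 2 ^ ((p-m)/m)) * N * 2 ^ (p / m - 1), N, hN1,
    fun R hR Θ Λ γ hΘ hΛ a ha S hS u hu huS hfr τ => ?_⟩
  set P := oR Θ ^ (-q) + (oR Λ ^ q * γ + oR Λ ^ (q - m)) + oR R ^ (-q)
  set κ : ℝ := N * R ^ (n+3)
  have hN1' : (1:ℝ) ≤ N := by exact_mod_cast hN1
  have hκ : 1 ≤ κ := one_le_mul_of_one_le_of_one_le hN1' (one_le_pow₀ hR)
  have hκ0 : 0 < κ := by linarith
  set V : E n → ℝ := (Hs τ).indicator (VV u)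
  set g : E n → ℝ := (Hs τ).indicator fun z => VV u z ^ m + (Θ * |Pa a u z|) ^ m
  have hV0 : ∀ z, 0 ≤ V z := fun z => Set.indicator_nonneg (fun z _ => VV_nonneg u z) z
  have mH := measurableSet_Hs (n := n) τ
  have mV := hu.contV.measurable
  have mF := Pa_meas ha hu
  have hΘ0 : 0 < Θ := by linarith
  have eV : ∀ z (e : ℝ), 0 ≤ e → oR (VV u z ^ e) = ‖VV u z‖ₑ ^ e := fun z e he => by
    rw [← ofReal_rpow_of_nonneg (VV_nonneg u z) he, Real.enorm_eq_ofReal (VV_nonneg u z)]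
  have eF : ∀ z (e : ℝ), 0 ≤ e → oR ((Θ * |Pa a u z|) ^ e) = oR Θ ^ e * ‖Pa a u z‖ₑ ^ e := fun z e he => by
    rw [← ofReal_rpow_of_nonneg (by positivity) he, ofReal_mul hΘ0.le, mul_rpow_of_nonneg _ _ he,
      ← Real.norm_eq_abs, ofReal_norm]
  have eg : ∀ z, oR (g z) = (Hs τ).indicator (fun z => ‖VV u z‖ₑ ^ m + oR Θ ^ m * ‖Pa a u z‖ₑ ^ m) z := by
    intro z
    by_cases hz : z ∈ Hs τ
    · simp only [g, Set.indicator_of_mem hz]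
      rw [ofReal_add (Real.rpow_nonneg (VV_nonneg u z) _) (by positivity), eV z m hm.le, eF z m hm.le]
    · simp only [g, Set.indicator_of_notMem hz]; simp
  have key := RV (n := n) hm hmp hκ (ε := oR κ ^ (-q) * (N * P)) (V := V) (g := g) hV0 (mV.indicator mH)
    (((mV.pow_const m).add ((mF.abs.const_mul Θ).pow_const m)).indicator mH) ?_ ?_ ?_ ?_
  · have l1 : ∫⁻ z, oR (V z ^ p) = ∫⁻ z in Hs τ, ‖VV u z‖ₑ ^ p := by
      rw [← lintegral_indicator mH]
      refine lintegral_congr fun z => ?_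
      by_cases hz : z ∈ Hs τ
      · simp only [V, Set.indicator_of_mem hz]; exact eV z p hp.le
      · simp only [V, Set.indicator_of_notMem hz]; simp [Real.zero_rpow hp.ne']
    have l2 : ∫⁻ z, oR (g z ^ (p / m)) ≤ 2 ^ (p/m - 1) *
        ((∫⁻ z in Hs τ, ‖VV u z‖ₑ ^ p) + oR Θ ^ p * ∫⁻ z in Hs τ, ‖Pa a u z‖ₑ ^ p) := by
      rw [← lintegral_const_mul _ (mF.enorm.pow_const p), ← lintegral_add_left (mV.enorm.pow_const p),
        ← lintegral_const_mul' _ _ (rpow_ne_top_of_nonneg (by linarith) (by simp)), ← lintegral_indicator mH]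
      refine lintegral_mono fun z => ?_
      simp only
      rw [← ofReal_rpow_of_nonneg ((Real.rpow_nonneg (hV0 z) m).trans ?_) (by positivity), eg]
      · by_cases hz : z ∈ Hs τ
        · simp only [Set.indicator_of_mem hz]
          refine (rpow_add_le_mul_rpow_add_rpow _ _ hpm).trans (le_of_eq ?_)
          rw [← rpow_mul, mul_rpow_of_nonneg _ _ (by positivity), ← rpow_mul, ← rpow_mul,
            mul_div_cancel₀ _ hm.ne']
        · simp only [Set.indicator_of_notMem hz]; rw [zero_rpow_of_pos (by positivity)]
      · by_cases hz : z ∈ Hs τ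
        · simp only [V, g, Set.indicator_of_mem hz]; exact le_add_of_nonneg_right (by positivity)
        · simp only [V, g, Set.indicator_of_notMem hz]; rw [Real.zero_rpow hm.ne']
    rw [l1] at key
    refine key.trans ((mul_le_mul' le_rfl (mul_le_mul' le_rfl (mul_le_mul' le_rfl l2))).trans (le_of_eq ?_))
    have k0 : oR κ ≠ 0 := by simp only [ne_eq, ofReal_eq_zero, not_le]; exact hκ0
    rw [← ofReal_rpow_of_pos hκ0, sub_eq_add_neg p q, rpow_add _ _ k0 ofReal_ne_top]
    push_cast
    rw [coe_rpow_of_nonneg _ (by linarith : 0 ≤ p / m - 1)]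
    simp only [ENNReal.ofReal]
    push_cast
    ring
  · intro z
    by_cases hz : z ∈ Hs τ
    · simp only [V, g, Set.indicator_of_mem hz]; exact le_add_of_nonneg_right (by positivity)
    · simp only [V, g, Set.indicator_of_notMem hz]; rw [Real.zero_rpow hm.ne']
  · intro z s hs
    by_cases hz : z ∈ Hs τ
    · obtain ⟨r, hr, h⟩ := Cy_nhds (U := Hs τ ∩ {y | s < VV u y}) (IsOpen.inter
        (isOpen_lt continuous_const continuous_fst) (isOpen_lt continuous_const hu.contV)) (z := z)
        ⟨hz, by change s < VV u z; simpa only [V, Set.indicator_of_mem hz] using hs⟩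
      refine ⟨r, hr, fun y hy => ?_⟩
      simp only [V, Set.indicator_of_mem (h hy).1]; exact (h hy).2
    · simp only [V, Set.indicator_of_notMem hz] at hs
      exact ⟨1, one_pos, fun y _ => lt_of_lt_of_le hs (hV0 y)⟩
  · simp only [eg]
    rw [lintegral_indicator mH, lintegral_add_left (mV.enorm.pow_const m), lintegral_const_mul _ (mF.enorm.pow_const m)]
    refine ENNReal.add_ne_top.2 ⟨hu.VVm hm _, mul_ne_top (rpow_ne_top_of_nonneg hm.le ofReal_ne_top) ?_⟩
    refine ne_top_of_le_ne_top (mul_ne_top (rpow_ne_top_of_nonneg hm.le (ofReal_ne_top (r := 1 + δ⁻¹))) (hu.VVm hm (Hs τ))) ?_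
    rw [← lintegral_const_mul _ (mV.enorm.pow_const m)]
    refine lintegral_mono fun z => ?_
    simp only
    rw [← mul_rpow_of_nonneg _ _ hm.le, ← ofReal_norm, Real.enorm_eq_ofReal (VV_nonneg u z),
      ← ofReal_mul (by positivity)]
    exact rpow_le_rpow (ofReal_le_ofReal (Pa_le hδ ha u z)) hm.le
  · intro z r s hr hs h
    have h15 := h (15 * r) (by linarith)
    simp only [eg] at h15
    rw [setLIntegral_indicator mH, Set.inter_comm, lintegral_add_left (mV.enorm.pow_const m),
      lintegral_const_mul _ (mF.enorm.pow_const m), ← ofReal_rpow_of_pos hs] at h15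
    have b := hN R hR Θ Λ γ hΘ hΛ a ha S hS u hu huS z r hr (hfr z (15 * r) (by positivity)) τ s hs
      (le_self_add.trans h15) ?_
    · refine (measure_mono ?_).trans (b.trans (le_of_eq (by ring)))
      rintro y ⟨hy, hsy⟩
      have hyH : y ∈ Hs τ := by
        by_contra hc
        simp only [V, Set.indicator_of_notMem hc] at hsy
        have : 0 < κ * s := by positivity
        linarith
      refine ⟨⟨hy, hyH⟩, ?_⟩
      simp only [V, Set.indicator_of_mem hyH] at hsy
      rw [Real.enorm_eq_ofReal (VV_nonneg u y)]
      exact (ofReal_lt_ofReal_iff_of_nonneg (by positivity)).2 hsy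
    · have h2 := le_add_self.trans h15
      have t0 : oR Θ ≠ 0 := by simp only [ne_eq, ofReal_eq_zero, not_le]; exact hΘ0
      rw [ofReal_mul (by positivity), mul_rpow_of_nonneg _ _ hm.le, ofReal_inv_of_pos hΘ0,
        inv_rpow, ← rpow_neg, mul_assoc]
      refine le_trans (le_of_eq ?_) (mul_le_mul' le_rfl h2)
      rw [← mul_assoc, ← rpow_add _ _ t0 ofReal_ne_top]; simp

def Frz (δ : ℝ) (γ : ℝ≥0∞) (a : E n → Mx n) (S : Set (E n)) : Prop :=
  ∀ z r, 0 < r → ∃ A, MEll δ A ∧ ∫⁻ p in Cy z r ∩ S, oR (dA A a p) ≤ γ * volume (Cy z r)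

theorem RVstep {δ q p : ℝ} (hδ : 0 < δ) (hq : 1 ≤ q) (hqp : q < p) (hpq : (n+3) * (p - q) < q) (hQ : HQ n δ q) :
    ∃ N γ : NNReal, 0 < γ ∧ ∀ a, GEll δ a → ∀ (S : Set (E n)), MeasurableSet S →
    ∀ u : E n → ℝ, TF u → tsupport u ⊆ S → Frz δ γ a S → ∀ τ, nq p (Hs τ) (VV u) ≤ N * nq p (Hs τ) (Pa a u) := by
  have hp : 0 < p := by linarith
  set m := (p + q) / 2
  obtain ⟨B, N, hN1, hN⟩ := RVcore hδ hq (show q ≤ m by simp only [m]; linarith) (show m < p by simp only [m]; linarith) hQ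
  have hN1' : (1:ℝ) ≤ N := by exact_mod_cast hN1
  obtain ⟨R, hR, hR2⟩ := pick (C := B * (N:ℝ≥0∞) ^ (p - q)) (mul_ne_top coe_ne_top
    (rpow_ne_top_of_nonneg (by linarith) coe_ne_top)) (a := q - (n+3) * (p - q)) (by linarith)
  have hR0 : 0 < R := by linarith
  have r0 : oR R ≠ 0 := by simp only [ne_eq, ofReal_eq_zero, not_le]; exact hR0
  set D := (B:ℝ≥0∞) * oR (N * R ^ (n+3)) ^ (p-q)
  have hD : D ≠ ∞ := mul_ne_top coe_ne_top
    (rpow_ne_top_of_nonneg (by linarith) ofReal_ne_top)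
  have dR : D * oR R ^ (-q) ≤ 1 / 8 := by
    refine le_trans (le_of_eq ?_) hR2
    simp only [D]
    rw [ofReal_mul (by positivity), ofReal_coe_nnreal, mul_rpow_of_nonneg _ _ (by linarith),
      ofReal_pow hR0.le, ← rpow_natCast, ← rpow_mul, ← mul_assoc, mul_assoc _ _ (_ ^ (-q)),
      ← rpow_add _ _ r0 ofReal_ne_top]
    congr 2; push_cast; ring
  obtain ⟨Θ, hΘ, dΘ⟩ := pick hD (a := q) (by linarith)
  obtain ⟨Λ, hΛ, dΛ⟩ := pick hD (a := m - q) (by simp only [m]; linarith)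
  set G := D * oR Λ ^ q
  have hG : G ≠ ∞ := mul_ne_top hD (rpow_ne_top_of_nonneg (by linarith) ofReal_ne_top)
  set γ : NNReal := (8 * (G.toNNReal + 1))⁻¹
  have dγ : G * γ ≤ 1 / 8 := by
    rw [← coe_toNNReal hG, ← coe_mul, show (1/8 : ℝ≥0∞) = ((1/8 : NNReal) : ℝ≥0∞) by
      rw [coe_div (by norm_num)]; simp]
    rw [coe_le_coe]
    simp only [γ]
    rw [mul_inv, mul_comm, mul_assoc, ← one_div]
    refine mul_le_of_le_one_right' ?_
    rw [mul_comm, ← div_eq_mul_inv]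
    exact div_le_one_of_le₀ le_self_add (by positivity)
  refine ⟨Real.toNNReal Θ, γ, by simp only [γ]; positivity, fun a ha S hS u hu huS hfr τ => ?_⟩
  have h := hN R hR Θ Λ γ hΘ hΛ a ha S hS u hu huS hfr τ
  set IV := ∫⁻ z in Hs τ, ‖VV u z‖ₑ ^ p
  set IF := ∫⁻ z in Hs τ, ‖Pa a u z‖ₑ ^ p
  have hIV : IV ≠ ∞ := hu.VVm hp _
  have h12 : D * (oR Θ ^ (-q) + (oR Λ ^ q * γ + oR Λ ^ (q - m)) + oR R ^ (-q)) ≤ 1 / 2 := by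
    rw [show q - m = -(m - q) by ring, mul_add, mul_add, mul_add, ← mul_assoc]
    refine (add_le_add (add_le_add dΘ (add_le_add dγ dΛ)) dR).trans (le_of_eq ?_)
    rw [← toReal_eq_toReal_iff' (by simp [div_eq_top]) (by simp)]
    rw [toReal_add, toReal_add, toReal_add] <;> simp <;> norm_num
  have h2 := h.trans (mul_le_mul' h12 le_rfl)
  have h3 : IV ≤ oR Θ ^ p * IF := by
    have e : IV = 1 / 2 * IV + 1 / 2 * IV := by rw [← add_mul, ENNReal.add_halves, one_mul]
    rw [mul_add] at h2
    nth_rw 1 [e] at h2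
    have hf : 1 / 2 * IV ≠ ∞ := mul_ne_top (by simp) hIV
    rw [ENNReal.add_le_add_iff_left hf] at h2
    exact (ENNReal.mul_le_mul_iff_right (by simp) (by simp)).1 h2
  rw [← rpow_le_rpow_iff hp, mul_rpow_of_nonneg _ _ hp.le, nq_rpow hp, nq_rpow hp]
  exact h3

end

section
variable {n : ℕ}

theorem HQ_step {δ q p : ℝ} (hδ : 0 < δ) (hq : 1 ≤ q) (hqp : q < p) (hpq : (n+3) * (p - q) < q) (hQ : HQ n δ q) :
    HQ n δ p := by
  obtain ⟨N, γ, _, h⟩ := RVstep hδ hq hqp hpq hQ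
  refine ⟨N, fun A hA u hu τ => ?_⟩
  refine h (fun z => A (z.2 0)) ⟨fun j k => (hA.meas j k).comp ((measurable_pi_apply 0).comp measurable_snd),
    fun s => hA.ell _⟩ Set.univ MeasurableSet.univ u hu (Set.subset_univ _) (fun z r _ => ⟨A, hA, ?_⟩) τ
  simp [dA]

theorem HQ_all {δ : ℝ} (hδ : 0 < δ) : ∀ p, 2 ≤ p → HQ n δ p := by
  set c : ℝ := 1 + 1 / (2 * (n + 3))
  have hc0 : (0:ℝ) < 1 / (2 * (n + 3)) := by positivity
  have hc : 1 < c := by simp only [c]; linarith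
  have main : ∀ k : ℕ, ∀ p, 2 ≤ p → p ≤ 2 * c ^ k → HQ n δ p := by
    intro k
    induction k with
    | zero =>
      intro p h1 h2
      have : p = 2 := by simp at h2; linarith
      rw [this]; exact HQ_two hδ
    | succ k ih =>
      intro p h1 h2
      have h3 : p / c ≤ 2 * c ^ k := by rw [div_le_iff₀ (by linarith)]; rw [pow_succ] at h2; linarith
      have h4 : HQ n δ (max 2 (p / c)) := ih _ (le_max_left _ _) (max_le (by
        have : 1 ≤ c ^ k := one_le_pow₀ hc.le
        linarith) h3)
      have h5 : p / c < p := div_lt_self (by linarith) hc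
      rcases h1.eq_or_lt with h | h
      · rw [← h]; exact HQ_two hδ
      · refine HQ_step hδ (le_trans (by norm_num) (le_max_left _ _)) (max_lt h h5) ?_ h4
        set q := max 2 (p / c)
        have h6 : p ≤ q * c := by rw [← div_le_iff₀ (by linarith)]; exact le_max_right _ _
        have hq : 2 ≤ q := le_max_left _ _
        have h7 : p - q ≤ q * (1 / (2 * (n + 3))) := by simp only [c] at h6; linarith
        have h8 : ((n:ℝ)+3) * (q * (1 / (2 * (n + 3)))) = q / 2 := by field_simp
        have := mul_le_mul_of_nonneg_left h7 (show (0:ℝ) ≤ n + 3 by positivity)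
        linarith
  intro p hp
  obtain ⟨k, hk⟩ := pow_unbounded_of_one_lt p hc
  exact main k p hp (by linarith)

def LF (δ : ℝ) (γ : ℝ≥0∞) (a : E n → Mx n) (R : ℝ) : Prop :=
  ∀ z r, 0 < r → r ≤ R → ∃ A, MEll δ A ∧ ∫⁻ p in Cy z r, oR (dA A a p) ≤ γ * volume (Cy z r)

theorem LF.frz {δ : ℝ} {γ : ℝ≥0∞} {a : E n → Mx n} {R : ℝ} (hR : 0 < R)
    (h : LF δ γ a R) (z0 : E n) : Frz δ γ a (Cy z0 R) := by
  intro z r hr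
  rcases le_or_gt r R with h1 | h1
  · obtain ⟨A, hA, hh⟩ := h z r hr h1
    exact ⟨A, hA, (lintegral_mono_set Set.inter_subset_left).trans hh⟩
  · obtain ⟨A, hA, hh⟩ := h z0 R hR le_rfl
    refine ⟨A, hA, (lintegral_mono_set Set.inter_subset_right).trans (hh.trans (mul_le_mul' le_rfl ?_))⟩
    rw [vol_Cy _ hR, vol_Cy _ hr]
    refine ofReal_le_ofReal ?_
    gcongr

theorem Cy_symm {z p : E n} {r : ℝ} : p ∈ Cy z r ↔ z ∈ Cy p r := by
  simp only [Cy, Set.mem_setOf_eq, abs_sub_comm]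

theorem tonelli_Cy {f : E n → ℝ≥0∞} (hf : Measurable f) {H : Set (E n)} (hH : MeasurableSet H) {r : ℝ} (hr : 0 < r) :
    ∫⁻ z : E n, ∫⁻ p in Cy z r ∩ H, f p = volume (Cy (0 : E n) r) * ∫⁻ p in H, f p := by
  set W : Set (E n × E n) := {x | |x.2.1 - x.1.1| < r ^ 2 ∧ ∀ j, |x.2.2 j - x.1.2 j| < r}
  have hW : MeasurableSet W := by
    have h1 : MeasurableSet {x : E n × E n | |x.2.1 - x.1.1| < r ^ 2} :=
      (isOpen_lt (by fun_prop) continuous_const).measurableSet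
    refine h1.inter ?_
    change MeasurableSet {x : E n × E n | ∀ j, |x.2.2 j - x.1.2 j| < r}
    rw [Set.setOf_forall]
    exact MeasurableSet.iInter fun j => measurableSet_lt (by fun_prop) measurable_const
  have mF : Measurable (fun x : E n × E n => W.indicator (fun x => f x.2) x) := (hf.comp measurable_snd).indicator hW
  calc ∫⁻ z : E n, ∫⁻ p in Cy z r ∩ H, f p = ∫⁻ z : E n, ∫⁻ p in H, W.indicator (fun x => f x.2) (z, p) := by
        refine lintegral_congr fun z => ?_
        rw [← setLIntegral_indicator (meas_Cy z r)]; rfl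
    _ = ∫⁻ p in H, ∫⁻ z : E n, W.indicator (fun x => f x.2) (z, p) := lintegral_lintegral_swap mF.aemeasurable
    _ = ∫⁻ p in H, volume (Cy (0 : E n) r) * f p := by
        refine lintegral_congr fun p => ?_
        have : ∀ z, W.indicator (fun x => f x.2) (z, p) = (Cy p r).indicator (fun _ => f p) z := by
          intro z
          by_cases hz : z ∈ Cy p r
          · rw [Set.indicator_of_mem hz, Set.indicator_of_mem (show (z, p) ∈ W from Cy_symm.2 hz)]
          · rw [Set.indicator_of_notMem hz, Set.indicator_of_notMem (show (z, p) ∉ W from fun h => hz (Cy_symm.1 h))]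
        simp only [this]
        rw [lintegral_indicator_const (meas_Cy p r), vol_Cy _ hr, vol_Cy _ hr, mul_comm]
    _ = _ := lintegral_const_mul _ hf

theorem G1_meas {u : Fu n} (hu : TF u) : Measurable (G1 u) :=
  hu.cont.abs.measurable.add (Finset.measurable_sum _ fun k _ => (hu.D (ex k)).cont.abs.measurable)

theorem LOC {δ p : ℝ} (hδ : 0 < δ) (hp : 2 < p) :
    ∃ N γ : NNReal, 0 < γ ∧ ∀ a, GEll δ a → ∀ (S : Set (E n)), MeasurableSet S →
    ∀ u : E n → ℝ, TF u → tsupport u ⊆ S → Frz δ γ a S → ∀ τ, nq p (Hs τ) (VV u) ≤ N * nq p (Hs τ) (Pa a u) := by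
  have h : ∃ q, 2 ≤ q ∧ q < p ∧ ((n:ℝ)+3) * (p - q) < q := by
    refine ⟨max 2 (p - 1 / (n + 3)), le_max_left _ _, max_lt hp (by simp; positivity), ?_⟩
    have h1 := le_max_left 2 (p - 1 / ((n:ℝ) + 3))
    have h2 : p - max 2 (p - 1 / ((n:ℝ) + 3)) ≤ 1 / (n+3) := by linarith [le_max_right 2 (p - 1 / ((n:ℝ) + 3))]
    have h3 := mul_le_mul_of_nonneg_left h2 (show (0:ℝ) ≤ n + 3 by positivity)
    have h4 : ((n:ℝ)+3) * (1 / (n+3)) = 1 := by field_simp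
    linarith
  obtain ⟨q, h1, h2, h3⟩ := h
  exact RVstep hδ (by linarith) h2 h3 (HQ_all hδ q h1)

theorem PU (n : ℕ) {δ p : ℝ} (hδ : 0 < δ) (hp : 2 < p) : ∃ γ : NNReal, 0 < γ ∧ ∀ R0 : ℝ, 0 < R0 → ∃ N : NNReal,
    ∀ a : E n → Mx n, GEll δ a → LF δ γ a R0 → ∀ u : E n → ℝ, TF u → ∀ τ,
    nq p (Hs τ) (VV u) ≤ N * (nq p (Hs τ) (Pa a u) + nq p (Hs τ) (G1 u)) := by
  obtain ⟨N, γ, hγ, hN⟩ := LOC (n := n) hδ hp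
  obtain ⟨B, hB, hcut⟩ := cutoff n
  have hp0 : 0 < p := by linarith
  have hp1 : 1 ≤ p := by linarith
  refine ⟨γ, hγ, fun R0 hR0 => ?_⟩
  set R := R0 / 3
  have hR : 0 < R := by positivity
  have hR3 : 3 * R = R0 := by simp only [R]; ring
  set B' := B / R ^ 2 + B / R
  set C0 : ℝ := (1 + 2 * (n+1)^2 * δ⁻¹) * B'
  have hC0 : 0 ≤ C0 := by positivity
  refine ⟨(3 ^ (n+3)) ^ (1/p) * N * (1 + Real.toNNReal C0), fun a ha hLF u hu τ => ?_⟩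
  have mH := measurableSet_Hs (n := n) τ
  have mP := Pa_meas ha hu
  have mG := G1_meas hu
  set F : E n → ℝ := fun z => |Pa a u z| + C0 * G1 u z
  have mF : Measurable F := mP.abs.add (mG.const_mul _)
  have mV := hu.contV.measurable
  have step : ∀ z, ∫⁻ y in Cy z R ∩ Hs τ, ‖VV u y‖ₑ ^ p ≤ (N:ℝ≥0∞) ^ p * ∫⁻ y in Cy z R0 ∩ Hs τ, ‖F y‖ₑ ^ p := by
    intro z
    obtain ⟨ζ, hζ, z0, z1, ze, zs, zt, zx, zxx⟩ := hcut z R hR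
    rw [hR3] at zs
    set w : E n → ℝ := fun y => ζ y * u y
    have hw : TF w := hζ.mul hu
    have hws : tsupport w ⊆ Cy z R0 := (tsupport_mul_subset_left (f := ζ) (g := u)).trans zs
    rw [← nq_rpow hp0, ← nq_rpow hp0, ← mul_rpow_of_nonneg _ _ hp0.le]
    refine rpow_le_rpow ?_ hp0.le
    have h1 := hN a ha (Cy z R0) (meas_Cy _ _) w hw hws (hLF.frz hR0 z) τ
    have h2 : nq p (Cy z R ∩ Hs τ) (VV u) ≤ nq p (Hs τ) (VV w) := by
      refine (nq_mono ((meas_Cy _ _).inter mH) fun y hy => ?_).trans (nq_set Set.inter_subset_right _)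
      rw [VV_congr (isOpen_Cy z R) (f := u) (g := w) (fun y hy => by simp [w, ze y hy]) y hy.1]
    refine h2.trans (h1.trans (mul_le_mul' le_rfl ?_))
    refine (nq_supp (meas_Cy z R0) fun y hy => ?_).trans (nq_mono ((meas_Cy _ _).inter mH) fun y hy => ?_)
    · have h0 := Pa_le hδ ha w y
      have : VV w y = 0 := by
        rw [VV_congr (S := (tsupport w)ᶜ) (isClosed_tsupport w).isOpen_compl (f := w) (g := fun _ => 0)
          (fun y hy => image_eq_zero_of_notMem_tsupport hy) y (fun h => hy (hws h))]; simp [VV, D_const]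
      rw [this, mul_zero] at h0
      exact abs_eq_zero.1 (le_antisymm h0 (abs_nonneg _))
    · have b1 : B / R ^ 2 ≤ B' := le_add_of_nonneg_right (by positivity)
      have b2 : B / R ≤ B' := le_add_of_nonneg_left (by positivity)
      have c := Pa_comm_le (a := a) hζ.sm hu.sm y (fun j k => (ha.ell y).bdd hδ j k) ((zt y).trans b1) (fun j => (zx j y).trans b2)
        (fun j k => (zxx j k y).trans b1)
      have hF : 0 ≤ F y := add_nonneg (abs_nonneg _) (mul_nonneg hC0 (G1_nonneg u y))
      rw [abs_of_nonneg hF]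
      have c2 : |ζ y * Pa a u y| ≤ |Pa a u y| := by
        rw [abs_mul, abs_of_nonneg (z0 y)]; exact mul_le_of_le_one_left (abs_nonneg _) (z1 y)
      have c3 : |Pa a w y| ≤ |ζ y * Pa a u y| + |Pa a w y - ζ y * Pa a u y| := by
        have := abs_add_le (ζ y * Pa a u y) (Pa a w y - ζ y * Pa a u y)
        rwa [add_sub_cancel] at this
      exact c3.trans (add_le_add c2 c)
  have int := lintegral_mono (μ := volume) step
  have e1 := tonelli_Cy (mF.enorm.pow_const p) mH hR0
  rw [tonelli_Cy (mV.enorm.pow_const p) mH hR, lintegral_const_mul' _ _ (rpow_ne_top_of_nonneg hp0.le coe_ne_top), e1] at int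
  have ev : volume (Cy (0 : E n) R0) = volume (Cy (0 : E n) R) * ((3 ^ (n+3) : NNReal) : ℝ≥0∞) := by
    rw [vol_Cy _ hR0, vol_Cy _ hR, ← hR3, ← ofReal_coe_nnreal, ← ofReal_mul (by positivity)]
    congr 1; push_cast; ring
  have fin : ∫⁻ z in Hs τ, ‖VV u z‖ₑ ^ p ≤ ((3 ^ (n+3) : NNReal) : ℝ≥0∞) * ((N:ℝ≥0∞) ^ p * ∫⁻ z in Hs τ, ‖F z‖ₑ ^ p) := by
    refine (ENNReal.mul_le_mul_iff_right (vol_Cy_pos (0 : E n) hR) (vol_Cy_fin (0 : E n) hR)).1 (int.trans (le_of_eq ?_))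
    rw [ev]; ring
  rw [← nq_rpow hp0, ← nq_rpow hp0, ← rpow_le_rpow_iff (z := 1/p) (by positivity),
    mul_rpow_of_nonneg _ _ (by positivity), mul_rpow_of_nonneg _ _ (by positivity),
    ← rpow_mul, ← rpow_mul, ← rpow_mul, mul_one_div_cancel hp0.ne', rpow_one, rpow_one, rpow_one] at fin
  refine fin.trans ?_
  push_cast
  rw [coe_rpow_of_nonneg _ (by positivity : 0 ≤ 1 / p), mul_assoc, mul_assoc]
  push_cast
  refine mul_le_mul' le_rfl (mul_le_mul' le_rfl ?_)
  refine (nq_add hp1 mP.abs (mG.const_mul _)).trans ?_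
  rw [nq_abs, nq_cmul, abs_of_nonneg hC0, add_mul, one_mul, mul_add]
  exact add_le_add le_self_add le_add_self

end

section
variable {n : ℕ}

noncomputable def OM (a : E n → Mx n) (τ : ℝ) (s₁ s₂ : TT n) : ℝ :=
  ⨆ j, ⨆ k, |a (s₁.1, Fin.cons τ s₁.2) j k - a (s₂.1, Fin.cons τ s₂.2) j k|

theorem OM_ge (a : E n → Mx n) (τ : ℝ) (s₁ s₂ : TT n) (j k) :
    |a (s₁.1, Fin.cons τ s₁.2) j k - a (s₂.1, Fin.cons τ s₂.2) j k| ≤ OM a τ s₁ s₂ := by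
  refine le_trans ?_ (le_ciSup (Set.finite_range _).bddAbove j)
  exact le_ciSup (f := fun k => |a (s₁.1, Fin.cons τ s₁.2) j k - a (s₂.1, Fin.cons τ s₂.2) j k|)
    (Set.finite_range _).bddAbove k

theorem OM_nonneg (a : E n → Mx n) (τ : ℝ) (s₁ s₂ : TT n) : 0 ≤ OM a τ s₁ s₂ :=
  (abs_nonneg _).trans (OM_ge a τ s₁ s₂ 0 0)

theorem OM_le {δ : ℝ} (hδ : 0 < δ) {a : E n → Mx n} (ha : GEll δ a) (τ : ℝ) (s₁ s₂ : TT n) :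
    ‖OM a τ s₁ s₂‖ ≤ 2 * δ⁻¹ := by
  rw [Real.norm_eq_abs, abs_of_nonneg (OM_nonneg _ _ _ _)]
  refine ciSup_le fun j => ciSup_le fun k => ?_
  have h1 := (ha.ell (s₁.1, Fin.cons τ s₁.2)).bdd hδ j k
  have h2 := (ha.ell (s₂.1, Fin.cons τ s₂.2)).bdd hδ j k
  exact (abs_sub _ _).trans (by linarith)

theorem OM_meas {δ : ℝ} {a : E n → Mx n} (ha : GEll δ a) :
    Measurable fun x : ℝ × TT n × TT n => OM a x.1 x.2.1 x.2.2 := by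
  refine Measurable.iSup fun j => Measurable.iSup fun k => Measurable.abs (Measurable.sub ?_ ?_)
  · refine (ha.meas j k).comp ((by fun_prop : Measurable fun x : ℝ × TT n × TT n => x.2.1.1).prodMk ?_)
    exact meas_cons.comp ((by fun_prop : Measurable fun x : ℝ × TT n × TT n => (x.1, x.2.1.2)))
  · refine (ha.meas j k).comp ((by fun_prop : Measurable fun x : ℝ × TT n × TT n => x.2.2.1).prodMk ?_)
    exact meas_cons.comp ((by fun_prop : Measurable fun x : ℝ × TT n × TT n => (x.1, x.2.2.2)))

theorem ballC_open (r : ℝ) (x : Fin n → ℝ) : IsOpen (ballC r x) :=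
  isOpen_lt (by fun_prop) continuous_const

theorem ballC_vol (r : ℝ) (x : Fin n → ℝ) : volume (ballC r x) = volume (ballC r (0 : Fin n → ℝ)) := by
  rw [← measure_preimage_add_right volume (-x) (ballC r 0)]
  congr 1
  ext y; simp [ballC, sub_eq_add_neg]

theorem ballC_le {r : ℝ} (hr : 0 < r) : volume (ballC r (0 : Fin n → ℝ)) ≤ oR ((2 * r) ^ n) := by
  have h : ballC r (0 : Fin n → ℝ) ⊆ Set.pi Set.univ fun _ => Set.Ioo (-r) r := by
    intro y hy j _
    have h1 : (y j) ^ 2 ≤ ∑ i, (y i - (0 : Fin n → ℝ) i) ^ 2 := by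
      simpa using Finset.single_le_sum (f := fun i => (y i) ^ 2) (fun i _ => sq_nonneg _) (Finset.mem_univ j)
    exact abs_lt.1 (abs_lt_of_sq_lt_sq (h1.trans_lt hy) hr.le)
  refine (measure_mono h).trans (le_of_eq ?_)
  rw [Real.volume_pi_Ioo, Finset.prod_const, Finset.card_univ, Fintype.card_fin, ofReal_pow (by positivity)]
  ring_nf

noncomputable def bv (n : ℕ) (r : ℝ) : ℝ := (volume (ballC r (0 : Fin n → ℝ))).toReal

theorem bv_pos {r : ℝ} (hr : 0 < r) : 0 < bv n r := by
  refine toReal_pos ?_ ((ballC_le hr).trans_lt ofReal_lt_top).ne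
  exact ((ballC_open r _).measure_pos volume ⟨0, by simp [ballC]; positivity⟩).ne'

theorem bv_le {r : ℝ} (hr : 0 < r) : bv n r ≤ (2 * r) ^ n :=
  toReal_le_of_le_ofReal (by positivity) (ballC_le hr)

theorem Gam_vol {r : ℝ} (hr : 0 < r) (t : ℝ) (x : Fin n → ℝ) : volume (GammaC r t x) = oR (r ^ 2 * bv n r) := by
  rw [GammaC, Measure.volume_eq_prod, Measure.prod_prod, ballC_vol, Real.volume_Ioo, ofReal_mul (by positivity), bv,
    ofReal_toReal ((ballC_le hr).trans_lt ofReal_lt_top).ne, add_sub_cancel_left]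

theorem Gam_meas (r t : ℝ) (x : Fin n → ℝ) : MeasurableSet (GammaC r t x) :=
  measurableSet_Ioo.prod (ballC_open r x).measurableSet

theorem OM_int {δ : ℝ} (hδ : 0 < δ) {a : E n → Mx n} (ha : GEll δ a) (μ : Measure ℝ)
    (ν : Measure (TT n)) [IsFiniteMeasure μ] [IsFiniteMeasure ν] :
    oR (∫ τ, ∫ s₁, ∫ s₂, OM a τ s₁ s₂ ∂ν ∂ν ∂μ) =
      ∫⁻ s₂, ∫⁻ τ, ∫⁻ s₁, oR (OM a τ s₁ s₂) ∂ν ∂μ ∂ν := by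
  have m := OM_meas ha
  have H : Integrable (fun x : ℝ × TT n × TT n => OM a x.1 x.2.1 x.2.2) (μ.prod (ν.prod ν)) :=
    Integrable.of_bound m.aestronglyMeasurable (2 * δ⁻¹) (Filter.Eventually.of_forall fun x => OM_le hδ ha _ _ _)
  have mτ : ∀ τ, Measurable fun y : TT n × TT n => OM a τ y.1 y.2 := fun τ =>
    m.comp (g := fun x : ℝ × TT n × TT n => OM a x.1 x.2.1 x.2.2) (f := fun y : TT n × TT n => (τ, y)) (by fun_prop)
  have J1 : ∫ τ, ∫ s₁, ∫ s₂, OM a τ s₁ s₂ ∂ν ∂ν ∂μ = ∫ x, OM a x.1 x.2.1 x.2.2 ∂(μ.prod (ν.prod ν)) := by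
    rw [integral_prod _ H]
    refine integral_congr_ae (Filter.Eventually.of_forall fun τ => ?_)
    refine (integral_prod (fun y : TT n × TT n => OM a τ y.1 y.2) ?_).symm
    exact Integrable.of_bound (mτ τ).aestronglyMeasurable (2 * δ⁻¹) (Filter.Eventually.of_forall fun x => OM_le hδ ha _ _ _)
  rw [J1, ofReal_integral_eq_lintegral_ofReal H (Filter.Eventually.of_forall fun x => OM_nonneg _ _ _ _),
    lintegral_prod _ m.ennreal_ofReal.aemeasurable]
  have mm : Measurable fun y : ℝ × TT n => ∫⁻ s₁, oR (OM a y.1 s₁ y.2) ∂ν := by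
    refine Measurable.lintegral_prod_right' (f := fun y : (ℝ × TT n) × TT n => oR (OM a y.1.1 y.2 y.1.2)) ?_
    exact (m.comp (by fun_prop : Measurable fun y : (ℝ × TT n) × TT n => (y.1.1, y.2, y.1.2))).ennreal_ofReal
  refine Eq.trans ?_ (lintegral_lintegral_swap (f := fun τ s₂ => ∫⁻ s₁, oR (OM a τ s₁ s₂) ∂ν) mm.aemeasurable)
  refine lintegral_congr fun τ => ?_
  exact lintegral_prod_symm _ (mτ τ).ennreal_ofReal.aemeasurable

theorem OM_m3 {δ : ℝ} {a : E n → Mx n} (ha : GEll δ a) (μ : Measure ℝ)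
    (ν : Measure (TT n)) [IsFiniteMeasure μ] [IsFiniteMeasure ν] :
    Measurable fun s₂ : TT n => ∫⁻ τ, ∫⁻ s₁, oR (OM a τ s₁ s₂) ∂ν ∂μ := by
  have m := OM_meas ha
  refine Measurable.lintegral_prod_right' (f := fun y : TT n × ℝ => ∫⁻ s₁, oR (OM a y.2 s₁ y.1) ∂ν) ?_
  refine Measurable.lintegral_prod_right' (f := fun y : (TT n × ℝ) × TT n => oR (OM a y.1.2 y.2 y.1.1)) ?_
  exact (m.comp (by fun_prop : Measurable fun y : (TT n × ℝ) × TT n => (y.1.2, y.2, y.1.1))).ennreal_ofReal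

theorem oscA_eq (a : E n → Mx n) (r t : ℝ) (x : Ix n → ℝ) : oscA a r t x =
    (r ^ 5)⁻¹ * (bv n r ^ 2)⁻¹ * ∫ τ in Set.Ioo (x 0 - r) (x 0 + r), ∫ s₁ in GammaC r t (fun j : Fin n => x j.succ),
      ∫ s₂ in GammaC r t (fun j : Fin n => x j.succ), OM a τ s₁ s₂ := rfl

theorem osc_key {δ : ℝ} (hδ : 0 < δ) {a : E n → Mx n} (ha : GEll δ a) {r : ℝ} (hr : 0 < r)
    (t : ℝ) (x : Ix n → ℝ) : ∃ s₂ : TT n, ∫⁻ τ in Set.Ioo (x 0 - r) (x 0 + r),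
      ∫⁻ s₁ in GammaC r t (fun j : Fin n => x j.succ), oR (OM a τ s₁ s₂) ≤
      oR (oscA a r t x * r ^ 3 * bv n r) := by
  set I := Set.Ioo (x 0 - r) (x 0 + r)
  set Γ := GammaC r t (fun j : Fin n => x j.succ)
  have hb := bv_pos (n := n) hr
  have vΓ : volume Γ = oR (r ^ 2 * bv n r) := Gam_vol hr _ _
  have : IsFiniteMeasure ((volume : Measure (TT n)).restrict Γ) := ⟨by simp [vΓ]⟩
  have : IsFiniteMeasure ((volume : Measure ℝ).restrict I) := ⟨by simp [I]⟩
  set μ := (volume : Measure ℝ).restrict I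
  set ν := (volume : Measure (TT n)).restrict Γ
  have p0 : 0 < r ^ 2 * bv n r := by positivity
  have v0 : volume Γ ≠ 0 := by rw [vΓ]; exact (ENNReal.ofReal_pos.2 p0).ne'
  obtain ⟨s₂, _, h⟩ := exists_le_setLAverage v0 (by rw [vΓ]; simp) (OM_m3 ha μ ν).aemeasurable
  refine ⟨s₂, h.trans (le_of_eq ?_)⟩
  rw [setLAverage_eq, ← OM_int hδ ha, vΓ, ← ofReal_div_of_pos p0, oscA_eq]
  congr 1
  field_simp
  rfl

theorem osc_bd {δ : ℝ} (hδ : 0 < δ) {a : E n → Mx n} (ha : GEll δ a) {r : ℝ} (hr : 0 < r)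
    (t : ℝ) (x : Ix n → ℝ) : oscA a r t x ≤ 4 * δ⁻¹ := by
  set Γ := GammaC r t (fun j : Fin n => x j.succ)
  have hb := bv_pos (n := n) hr
  have vΓ : volume Γ = oR (r ^ 2 * bv n r) := Gam_vol hr _ _
  have rΓ : volume.real Γ = r ^ 2 * bv n r := by
    rw [Measure.real, vΓ, toReal_ofReal (by positivity)]
  have fΓ : volume Γ < ∞ := by rw [vΓ]; simp
  have h1 : ∀ τ s₁, ‖∫ s₂ in Γ, OM a τ s₁ s₂‖ ≤ 2 * δ⁻¹ * volume.real Γ := fun τ s₁ =>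
    norm_setIntegral_le_of_norm_le_const fΓ fun s₂ _ => OM_le hδ ha _ _ _
  have h2 : ∀ τ, ‖∫ s₁ in Γ, ∫ s₂ in Γ, OM a τ s₁ s₂‖ ≤ 2 * δ⁻¹ * volume.real Γ * volume.real Γ := fun τ =>
    norm_setIntegral_le_of_norm_le_const fΓ fun s₁ _ => h1 τ s₁
  have h3 : ‖∫ τ in Set.Ioo (x 0 - r) (x 0 + r), ∫ s₁ in Γ, ∫ s₂ in Γ, OM a τ s₁ s₂‖ ≤
      2 * δ⁻¹ * volume.real Γ * volume.real Γ * volume.real (Set.Ioo (x 0 - r) (x 0 + r)) :=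
    norm_setIntegral_le_of_norm_le_const (by simp) fun τ _ => h2 τ
  rw [oscA_eq]
  refine (mul_le_mul_of_nonneg_left ((le_abs_self _).trans h3) (by positivity)).trans (le_of_eq ?_)
  rw [rΓ, Measure.real, Real.volume_Ioo, toReal_ofReal (by linarith)]
  field_simp
  ring

theorem osc_le_sharp {δ : ℝ} (hδ : 0 < δ) {a : E n → Mx n} (ha : GEll δ a) {r : ℝ} (hr : 0 < r)
    (t : ℝ) (x : Ix n → ℝ) : oscA a r t x ≤ aSharp a r := by
  have h1 : ∀ z : E n, ∀ s : {s : ℝ // 0 < s ∧ s ≤ r}, oscA a s.val z.1 z.2 ≤ 4 * δ⁻¹ := fun z s => osc_bd hδ ha s.2.1 _ _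
  refine le_trans ?_ (le_ciSup (f := fun z : E n => ⨆ s : {s : ℝ // 0 < s ∧ s ≤ r}, oscA a s.val z.1 z.2) ?_ (t, x))
  · exact le_ciSup (f := fun s : {s : ℝ // 0 < s ∧ s ≤ r} => oscA a s.val t x) ⟨4 * δ⁻¹, by
      rintro _ ⟨s, rfl⟩; exact h1 (t, x) s⟩ ⟨r, hr, le_rfl⟩
  · exact ⟨4 * δ⁻¹, by rintro _ ⟨z, rfl⟩; exact Real.iSup_le (h1 z) (by positivity)⟩

theorem freeze (n : ℕ) (hn : 1 ≤ n) {δ : ℝ} (hδ : 0 < δ) {ω : ℝ → ℝ} (hω : ContinuousOn ω (Set.Ici 0)) (hω0 : ω 0 = 0)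
    {γ : NNReal} (hγ : 0 < γ) : ∃ R0 : ℝ, 0 < R0 ∧ ∀ a : E n → Mx n, GEll δ a →
      (∀ R : ℝ, 0 ≤ R → aSharp a R ≤ ω R) → LF δ γ a R0 := by
  set ε : ℝ := γ / (n+1) ^ (n+5)
  have hε : 0 < ε := by positivity
  obtain ⟨η, hη, hh⟩ := Metric.continuousWithinAt_iff.1 (hω 0 (by simp)) ε hε
  have hn' : (1:ℝ) ≤ n := by exact_mod_cast hn
  refine ⟨η / (2 * (n+1)), by positivity, fun a ha hs z r hr hrR => ?_⟩
  set ρ : ℝ := (n+1) * r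
  have hρ : 0 < ρ := by positivity
  have hρη : ρ < η := by
    rw [le_div_iff₀ (by positivity)] at hrR
    simp only [ρ]; nlinarith
  have hωρ : ω ρ ≤ ε := by
    have := hh (x := ρ) hρ.le (by simpa [abs_of_pos hρ] using hρη)
    rw [hω0, Real.dist_eq, sub_zero] at this
    exact ((le_abs_self _).trans this.le)
  obtain ⟨s₂, hs₂⟩ := osc_key hδ ha hρ (z.1 - r ^ 2) z.2
  set A : ℝ → Mx n := fun s => a (s₂.1, Fin.cons s s₂.2)
  have hA : MEll δ A := ⟨fun j k => (ha.meas j k).comp (measurable_const.prodMk (meas_cons.comp (measurable_id.prodMk measurable_const))),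
    fun s => ha.ell _⟩
  refine ⟨A, hA, ?_⟩
  have mf : Measurable fun p => oR (dA A a p) := (dA_meas hA ha).ennreal_ofReal
  set I := Set.Ioo (z.2 0 - ρ) (z.2 0 + ρ)
  set Γ := GammaC ρ (z.1 - r ^ 2) (fun j : Fin n => z.2 j.succ)
  have hsub : ∀ s (h : TT n), ((h.1, Fin.cons s h.2) : E n) ∈ Cy z r → s ∈ I ∧ h ∈ Γ := by
    intro s h ⟨g1, g2⟩
    have rρ : r ≤ ρ := by simp only [ρ]; nlinarith
    have g0 : |s - z.2 0| < r := by simpa using g2 0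
    rw [abs_lt] at g0 g1
    refine ⟨⟨by linarith, by linarith⟩, ⟨⟨by simpa using by linarith, ?_⟩, ?_⟩⟩
    · have : 2 * r ^ 2 ≤ ρ ^ 2 := by simp only [ρ]; rw [mul_pow]; nlinarith [sq_nonneg r]
      simp only at g1
      linarith
    · have g3 : ∀ j : Fin n, (h.2 j - z.2 j.succ) ^ 2 ≤ r ^ 2 := fun j => by
        have := g2 j.succ
        simp only [Fin.cons_succ] at this
        exact sq_le_sq' (by linarith [(abs_lt.1 this).1]) (abs_lt.1 this).2.le
      have g4 : ∑ j : Fin n, (h.2 j - z.2 j.succ) ^ 2 ≤ n * r ^ 2 := by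
        refine (Finset.sum_le_sum fun j _ => g3 j).trans (le_of_eq ?_)
        simp
      refine g4.trans_lt ?_
      simp only [ρ]; rw [mul_pow]
      refine mul_lt_mul_of_pos_right ?_ (by positivity)
      nlinarith
  have dle : ∀ s (h : TT n), dA A a (h.1, Fin.cons s h.2) ≤ (n+1)^2 * OM a s h s₂ := by
    intro s h
    refine (Finset.sum_le_sum fun j _ => Finset.sum_le_sum fun k _ => show _ ≤ OM a s h s₂ from ?_).trans (le_of_eq ?_)
    · rw [abs_sub_comm]; exact OM_ge a s h s₂ j k
    · simp; ring
  calc ∫⁻ p in Cy z r, oR (dA A a p)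
      = ∫⁻ s : ℝ, ∫⁻ h : TT n, (Cy z r).indicator (fun p => oR (dA A a p)) (h.1, Fin.cons s h.2) := by
        rw [← lintegral_indicator (meas_Cy z r), lint_E (mf.indicator (meas_Cy z r))]
    _ ≤ ∫⁻ s : ℝ, I.indicator (fun s => ∫⁻ h, Γ.indicator (fun h => oR ((n+1)^2) * oR (OM a s h s₂)) h) s := by
        refine lintegral_mono fun s => ?_
        by_cases hs : s ∈ I
        · rw [Set.indicator_of_mem hs]
          refine lintegral_mono fun h => ?_
          by_cases hm : ((h.1, Fin.cons s h.2) : E n) ∈ Cy z r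
          swap
          · rw [Set.indicator_of_notMem hm]; exact zero_le
          rw [Set.indicator_of_mem hm, Set.indicator_of_mem (hsub s h hm).2, ← ofReal_mul (by positivity)]
          exact ofReal_le_ofReal (dle s h)
        · rw [Set.indicator_of_notMem hs, ← lintegral_zero (μ := (volume : Measure (TT n)))]
          refine lintegral_mono fun h => ?_
          exact (Set.indicator_of_notMem (fun hm => hs (hsub s h hm).1) _).le
    _ = oR ((n+1)^2) * ∫⁻ s in I, ∫⁻ h in Γ, oR (OM a s h s₂) := by
        rw [lintegral_indicator measurableSet_Ioo, ← lintegral_const_mul' _ _ ofReal_ne_top]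
        refine lintegral_congr fun s => ?_
        rw [lintegral_indicator (Gam_meas _ _ _), ← lintegral_const_mul' _ _ ofReal_ne_top]
    _ ≤ oR ((n+1)^2) * oR (oscA a ρ (z.1 - r ^ 2) z.2 * ρ ^ 3 * bv n ρ) := mul_le_mul' le_rfl hs₂
    _ ≤ γ * volume (Cy z r) := by
        rw [vol_Cy _ hr, ← ofReal_coe_nnreal, ← ofReal_mul (by positivity), ← ofReal_mul (by positivity)]
        refine ofReal_le_ofReal ?_
        have o1 : oscA a ρ (z.1 - r ^ 2) z.2 ≤ ε := (osc_le_sharp hδ ha hρ _ _).trans ((hs ρ hρ.le).trans hωρ)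
        have hb := bv_pos (n := n) hρ
        have o2 : oscA a ρ (z.1 - r ^ 2) z.2 * ρ ^ 3 * bv n ρ ≤ ε * ρ ^ 3 * (2 * ρ) ^ n := by
          refine mul_le_mul (mul_le_mul_of_nonneg_right o1 (by positivity)) (bv_le hρ) hb.le (by positivity)
        refine (mul_le_mul_of_nonneg_left o2 (by positivity)).trans ?_
        have e : ((n:ℝ)+1)^2 * (ε * ρ ^ 3 * (2 * ρ) ^ n) = γ * (2 ^ n * r ^ (n+3)) := by
          have : (γ:ℝ) = ε * (n+1)^(n+5) := by simp only [ε]; field_simp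
          rw [this]; simp only [ρ]; generalize (n:ℝ)+1 = m; rw [mul_pow, mul_pow, mul_pow]; ring
        rw [e]
        refine mul_le_mul_of_nonneg_left (mul_le_mul_of_nonneg_right ?_ (by positivity)) (by positivity)
        exact pow_le_pow_right₀ (by norm_num) (by omega)

end

section
variable {n : ℕ}

def pr (p : E (n+1)) : E n := (p.1, fun j => p.2 j.castSucc)
def ly (p : E (n+1)) : ℝ := p.2 (Fin.last _)
theorem pr_cont : Continuous (pr (n := n)) := by unfold pr; fun_prop
theorem ly_cont : Continuous (ly (n := n)) := by unfold ly; fun_prop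

theorem lint_pr0 {F : E n → ℝ≥0∞} (hF : Measurable F) {g : ℝ → ℝ≥0∞} (hg : Measurable g) :
    ∫⁻ p : E (n+1), F (pr p) * g (ly p) = (∫⁻ y, g y) * ∫⁻ q, F q := by
  have hm := (volume_preserving_piFinSuccAbove (fun _ : Fin (n+2) => ℝ) (Fin.last _))
  have h0 : ∀ t : ℝ, ∫⁻ x : Fin (n+2) → ℝ, F (t, fun j => x j.castSucc) * g (x (Fin.last _)) =
      (∫⁻ y, g y) * ∫⁻ x, F (t, x) := by
    intro t
    have hmt : Measurable fun x : Ix n → ℝ => F (t, x) := hF.comp (by fun_prop)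
    have := hm.lintegral_comp (f := fun a : ℝ × (Ix n → ℝ) => g a.1 * F (t, a.2))
      ((hg.comp measurable_fst).mul (hmt.comp measurable_snd))
    rw [Measure.volume_eq_prod, lintegral_prod_mul hg.aemeasurable hmt.aemeasurable] at this
    rw [← this]
    refine lintegral_congr fun x => ?_
    rw [mul_comm]
    congr 3
    funext j; simp [MeasurableEquiv.piFinSuccAbove, Fin.insertNthEquiv, Fin.init]
  rw [Measure.volume_eq_prod, lintegral_prod]
  · refine (lintegral_congr fun t => h0 t).trans ?_
    rw [Measure.volume_eq_prod, lintegral_prod _ hF.aemeasurable, lintegral_const_mul]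
    exact hF.lintegral_prod_right'
  · exact ((hF.comp pr_cont.measurable).mul (hg.comp ly_cont.measurable)).aemeasurable

theorem lint_pr {F : E n → ℝ≥0∞} (hF : Measurable F) {H : Set (E n)} (hH : MeasurableSet H) {I : Set ℝ} (hI : MeasurableSet I) :
    ∫⁻ p in {p | pr p ∈ H ∧ ly p ∈ I}, F (pr p) = volume I * ∫⁻ q in H, F q := by
  have := lint_pr0 (hF.indicator hH) (measurable_one.indicator hI)
  rw [lintegral_indicator hH, lintegral_indicator_one hI] at this
  have hS : MeasurableSet {p : E (n+1) | pr p ∈ H ∧ ly p ∈ I} := (pr_cont.measurable hH).inter (ly_cont.measurable hI)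
  rw [← this, ← lintegral_indicator hS]
  refine lintegral_congr fun p => ?_
  by_cases h1 : pr p ∈ H <;> by_cases h2 : ly p ∈ I <;> simp [Set.indicator, h1, h2]

theorem nq_pr {q : ℝ} (hq : 0 < q) {F : Fu n} (hF : Measurable F) (τ : ℝ) {I : Set ℝ} (hI : MeasurableSet I) :
    nq q {p | pr p ∈ Hs τ ∧ ly p ∈ I} (fun p => F (pr p)) = volume I ^ (1/q) * nq q (Hs τ) F := by
  rw [nq_eq hq, nq_eq hq, ← mul_rpow_of_nonneg _ _ (by positivity),
    ← lint_pr (hF.enorm.pow_const q) (measurableSet_Hs τ) hI]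

noncomputable def hat (B : Mx n) : Fin (n+2) → Fin (n+2) → ℝ := fun j k =>
  Fin.lastCases (motive := fun _ => ℝ) (Fin.lastCases (motive := fun _ => ℝ) 1 (fun _ => 0) k)
    (fun j' => Fin.lastCases (motive := fun _ => ℝ) 0 (fun k' => B j' k') k) j

@[simp] theorem hat_ll (B : Mx n) : hat B (Fin.last _) (Fin.last _) = 1 := by simp [hat]
@[simp] theorem hat_lc (B : Mx n) (k : Ix n) : hat B (Fin.last _) k.castSucc = 0 := by simp [hat]
@[simp] theorem hat_cl (B : Mx n) (k : Ix n) : hat B k.castSucc (Fin.last _) = 0 := by simp [hat]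
@[simp] theorem hat_cc (B : Mx n) (j k : Ix n) : hat B j.castSucc k.castSucc = B j k := by simp [hat]

theorem Ell.hat {δ : ℝ} (hδ : 0 < δ) (hδ1 : δ ≤ 1) {B : Mx n} (h : Ell δ B) : Ell δ (hat B) := by
  have key : ∀ θ : Fin (n+2) → ℝ, ∑ j, ∑ k, _root_.hat B j k * θ j * θ k =
      (∑ j : Ix n, ∑ k : Ix n, B j k * θ j.castSucc * θ k.castSucc) + θ (Fin.last _) ^ 2 := by
    intro θ
    rw [Fin.sum_univ_castSucc]
    simp only [Fin.sum_univ_castSucc (n := n+1), hat_cc, hat_cl, hat_lc, hat_ll]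
    simp; ring
  refine ⟨fun j k => ?_, fun θ => ?_, fun θ => ?_⟩
  · refine Fin.lastCases ?_ (fun j => ?_) j <;> refine Fin.lastCases ?_ (fun k => ?_) k <;> simp
    exact h.symm _ _
  · rw [key, Fin.sum_univ_castSucc (n := n+1) (f := fun j => θ j ^ 2), mul_add]
    have := h.lo fun j => θ j.castSucc
    nlinarith [sq_nonneg (θ (Fin.last _))]
  · rw [key, Fin.sum_univ_castSucc (n := n+1) (f := fun j => θ j ^ 2), mul_add]
    have := h.hi fun j => θ j.castSucc
    have h1 : 1 ≤ δ⁻¹ := (one_le_inv₀ hδ).2 hδ1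
    nlinarith [sq_nonneg (θ (Fin.last _))]

theorem hat_meas {X : Type*} [MeasurableSpace X] {B : X → Mx n} (h : ∀ j k, Measurable fun x => B x j k)
    (j k) : Measurable fun x => hat (B x) j k := by
  refine Fin.lastCases ?_ (fun j => ?_) j <;> refine Fin.lastCases ?_ (fun k => ?_) k <;> simp [h]

theorem GEll.hat {δ : ℝ} (hδ : 0 < δ) (hδ1 : δ ≤ 1) {a : E n → Mx n} (h : GEll δ a) :
    GEll δ (fun p : E (n+1) => hat (a (pr p))) :=
  ⟨hat_meas fun j k => (h.meas j k).comp pr_cont.measurable, fun p => (h.ell _).hat hδ hδ1⟩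

theorem LF.hat {δ : ℝ} (hδ : 0 < δ) (hδ1 : δ ≤ 1) {γ : ℝ≥0∞} {a : E n → Mx n} (ha : GEll δ a) {R : ℝ}
    (h : LF δ γ a R) : LF δ γ (fun p : E (n+1) => hat (a (pr p))) R := by
  intro z r hr hrR
  obtain ⟨A, hA, hh⟩ := h (pr z) r hr hrR
  refine ⟨fun s => _root_.hat (A s), ⟨hat_meas hA.meas, fun s => (hA.ell s).hat hδ hδ1⟩, ?_⟩
  have e1 : ∀ p : E (n+1), dA (fun s => _root_.hat (A s)) (fun p => _root_.hat (a (pr p))) p = dA A a (pr p) := by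
    intro p
    unfold dA
    rw [Fin.sum_univ_castSucc]
    simp only [Fin.sum_univ_castSucc (n := n+1), hat_cc, hat_cl, hat_lc, hat_ll]
    simp [pr]
  have e2 : Cy z r = {p | pr p ∈ Cy (pr z) r ∧ ly p ∈ Set.Ioo (ly z - r) (ly z + r)} := by
    ext p
    simp only [Cy, Set.mem_setOf_eq, Fin.forall_fin_succ' (n := n+1), pr, ly, Set.mem_Ioo, abs_lt]
    constructor
    · rintro ⟨g1, g2, g3, g4⟩; exact ⟨⟨g1, g2⟩, by linarith, by linarith⟩
    · rintro ⟨⟨g1, g2⟩, g3, g4⟩; exact ⟨g1, g2, by linarith, by linarith⟩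
  simp only [e1]
  have e3 : volume (Cy z r) = volume (Set.Ioo (ly z - r) (ly z + r)) * volume (Cy (pr z) r) := by
    have := lint_pr (F := fun _ => 1) measurable_const (meas_Cy (pr z) r) (measurableSet_Ioo (a := ly z - r) (b := ly z + r))
    rw [← e2] at this; simpa using this
  rw [e3, e2, lint_pr (dA_meas hA ha).ennreal_ofReal (meas_Cy _ _) measurableSet_Ioo, mul_left_comm]
  exact mul_le_mul' le_rfl hh

def UU (u : Fu n) (φ : ℝ → ℝ) (p : E (n+1)) : ℝ := u (pr p) * φ (ly p)

theorem UU_D {u : Fu n} (hu : Sm u) {φ : ℝ → ℝ} (hφ : CD φ) (v : E (n+1)) :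
    D v (UU u φ) = fun p => UU (D (pr v) u) φ p + ly v * UU u (deriv φ) p := by
  funext p
  have d1 : HasFDerivAt (fun p : E (n+1) => u (pr p)) ((fderiv ℝ u (pr p)).comp
      ((ContinuousLinearMap.fst ℝ _ _).prod (ContinuousLinearMap.pi fun j : Ix n =>
        (ContinuousLinearMap.proj j.castSucc).comp (ContinuousLinearMap.snd ℝ ℝ (Fin (n+2) → ℝ))))) p :=
    (hu.diff (pr p)).hasFDerivAt.comp p (ContinuousLinearMap.hasFDerivAt
      ((ContinuousLinearMap.fst ℝ _ _).prod (ContinuousLinearMap.pi fun j : Ix n =>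
        (ContinuousLinearMap.proj j.castSucc).comp (ContinuousLinearMap.snd ℝ ℝ (Fin (n+2) → ℝ)))))
  have d2 : HasFDerivAt (fun p : E (n+1) => φ (ly p)) (deriv φ (ly p) •
      ((ContinuousLinearMap.proj (Fin.last _)).comp (ContinuousLinearMap.snd ℝ ℝ (Fin (n+2) → ℝ)))) p :=
    ((hφ.differentiable (by simp)) (ly p)).hasDerivAt.comp_hasFDerivAt p (ContinuousLinearMap.hasFDerivAt
      ((ContinuousLinearMap.proj (Fin.last _)).comp (ContinuousLinearMap.snd ℝ ℝ (Fin (n+2) → ℝ))))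
  have := (d1.fun_mul d2).fderiv
  change fderiv ℝ (fun p : E (n+1) => u (pr p) * φ (ly p)) p v = _
  rw [this]
  have e : ((ContinuousLinearMap.fst ℝ _ _).prod (ContinuousLinearMap.pi fun j : Ix n =>
        (ContinuousLinearMap.proj j.castSucc).comp (ContinuousLinearMap.snd ℝ ℝ (Fin (n+2) → ℝ)))) v = pr v := rfl
  have e' : ((ContinuousLinearMap.proj (Fin.last _)).comp (ContinuousLinearMap.snd ℝ ℝ (Fin (n+2) → ℝ))) v = ly v := rfl
  simp only [add_apply, ContinuousLinearMap.smul_apply, ContinuousLinearMap.comp_apply, e, smul_eq_mul, UU, D]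
  change u (pr p) * (deriv φ (ly p) * ly v) + φ (ly p) * _ = _
  ring

theorem UU_TF {u : Fu n} (hu : TF u) {φ : ℝ → ℝ} (hφ : CD φ) (hφ' : HasCompactSupport φ) : TF (UU u φ) := by
  constructor
  · have h1 : CD (pr (n := n)) := by unfold pr; fun_prop
    have h2 : CD (ly (n := n)) := by unfold ly; fun_prop
    exact (ContDiff.comp hu.sm h1).mul (hφ.comp h2)
  · have hc : Continuous fun x : E n × ℝ => ((x.1.1, Fin.snoc (α := fun _ => ℝ) x.1.2 x.2) : E (n+1)) :=
      (continuous_fst.comp continuous_fst).prodMk (Continuous.finSnoc (A := fun _ => ℝ) (continuous_snd.comp continuous_fst) continuous_snd)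
    refine HasCompactSupport.intro ((hu.cs.prod hφ').image hc) fun p hp => ?_
    by_contra hne
    refine hp ⟨(pr p, ly p), ⟨?_, ?_⟩, ?_⟩
    · exact subset_tsupport _ (left_ne_zero_of_mul hne)
    · exact subset_tsupport _ (right_ne_zero_of_mul hne)
    · refine Prod.ext rfl ?_
      funext j; refine Fin.lastCases ?_ (fun j => ?_) j <;> simp [pr, ly]

theorem pr_et : pr (et : E (n+1)) = et := rfl
theorem ly_et : ly (et : E (n+1)) = 0 := rfl
theorem pr_exc (j : Ix n) : pr (ex j.castSucc : E (n+1)) = ex j := by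
  simp only [pr, ex, Prod.mk.injEq, true_and]
  funext k; simp [Pi.single_apply]
theorem ly_exc (j : Ix n) : ly (ex j.castSucc : E (n+1)) = 0 := by
  simp [ly, ex, Pi.single_apply, (Fin.castSucc_lt_last j).ne']
theorem pr_exl : pr (ex (Fin.last _) : E (n+1)) = 0 := by
  refine Prod.ext rfl ?_
  funext k; simp [pr, ex, Pi.single_apply, (Fin.castSucc_lt_last k).ne]
theorem ly_exl : ly (ex (Fin.last _) : E (n+1)) = 1 := by simp [ly, ex]

theorem UU_t {u : Fu n} (hu : Sm u) {φ : ℝ → ℝ} (hφ : CD φ) : D et (UU u φ) = UU (D et u) φ := by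
  rw [UU_D hu hφ, pr_et, ly_et]; simp
theorem UU_c {u : Fu n} (hu : Sm u) {φ : ℝ → ℝ} (hφ : CD φ) (j : Ix n) : D (ex j.castSucc) (UU u φ) = UU (D (ex j) u) φ := by
  rw [UU_D hu hφ, pr_exc, ly_exc]; simp
theorem UU_l {u : Fu n} (hu : Sm u) {φ : ℝ → ℝ} (hφ : CD φ) : D (ex (Fin.last _)) (UU u φ) = UU u (deriv φ) := by
  rw [UU_D hu hφ, pr_exl, ly_exl]; funext p; simp [UU, D]

theorem UU_Pa {u : Fu n} (hu : Sm u) {φ : ℝ → ℝ} (hφ : CD φ) (hφ' : CD (deriv φ))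
    (a : E n → Mx n) (p : E (n+1)) :
    Pa (fun p : E (n+1) => hat (a (pr p))) (UU u φ) p = Pa a u (pr p) * φ (ly p) + u (pr p) * deriv (deriv φ) (ly p) := by
  unfold Pa
  rw [Fin.sum_univ_castSucc]
  simp only [Fin.sum_univ_castSucc (n := n+1), hat_cc, hat_cl, hat_lc, hat_ll]
  simp only [UU_t hu hφ, UU_c hu hφ, UU_l hu hφ, UU_l hu hφ', UU_c (hu.D _) hφ, zero_mul, add_zero, one_mul,
    Finset.sum_const_zero, zero_add]
  simp only [UU, add_mul, Finset.sum_mul, mul_assoc, add_assoc]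

theorem UU_G1 {u : Fu n} (hu : Sm u) {φ : ℝ → ℝ} (hφ : CD φ) (p : E (n+1)) :
    G1 (UU u φ) p = G1 u (pr p) * |φ (ly p)| + |u (pr p)| * |deriv φ (ly p)| := by
  unfold G1
  rw [Fin.sum_univ_castSucc]
  simp only [UU_c hu hφ, UU_l hu hφ, UU, abs_mul, add_mul, Finset.sum_mul, add_assoc]

end

section
variable {n : ℕ}

theorem cut1 : ∃ C : ℝ, 1 ≤ C ∧ ∃ ζ : ℝ → ℝ, CD ζ ∧ HasCompactSupport ζ ∧ (∀ y, |ζ y| ≤ 1) ∧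
    (∀ y ∈ Set.Ioo (-1:ℝ) 1, ζ y = 1 ∧ deriv ζ y = 0 ∧ deriv (deriv ζ) y = 0) ∧
    (∀ y, y ∉ Set.Icc (-2:ℝ) 2 → ζ y = 0 ∧ deriv ζ y = 0 ∧ deriv (deriv ζ) y = 0) ∧
    ∀ y, |deriv ζ y| ≤ C ∧ |deriv (deriv ζ) y| ≤ C := by
  let f : ContDiffBump (0:ℝ) := ⟨1, 2, by norm_num, by norm_num⟩
  have h1 : CD f := f.contDiff
  have h2 : HasCompactSupport f := f.hasCompactSupport
  have h1' : CD (deriv f) := ContDiff.iterate_deriv 1 h1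
  have h1'' : CD (deriv (deriv f)) := ContDiff.iterate_deriv 2 h1
  obtain ⟨C1, hC1⟩ := h2.deriv.exists_bound_of_continuous h1'.continuous
  obtain ⟨C2, hC2⟩ := h2.deriv.deriv.exists_bound_of_continuous h1''.continuous
  have e0 : ∀ y ∈ Set.Ioo (-1:ℝ) 1, f y = 1 := fun y hy => f.one_of_mem_closedBall (by
    rw [mem_closedBall_zero_iff]; exact (abs_lt.2 hy).le)
  have e1 : ∀ y ∈ Set.Ioo (-1:ℝ) 1, deriv f y = 0 := fun y hy => by
    rw [Filter.EventuallyEq.deriv_eq (f := fun _ => (1:ℝ)) (Filter.eventuallyEq_of_mem (isOpen_Ioo.mem_nhds hy) e0), deriv_const]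
  have e2 : ∀ y ∈ Set.Ioo (-1:ℝ) 1, deriv (deriv f) y = 0 := fun y hy => by
    rw [Filter.EventuallyEq.deriv_eq (f := fun _ => (0:ℝ)) (Filter.eventuallyEq_of_mem (isOpen_Ioo.mem_nhds hy) e1), deriv_const]
  refine ⟨max 1 (max C1 C2), le_max_left _ _, f, h1, h2, fun y => ?_, fun y hy => ⟨e0 y hy, e1 y hy, e2 y hy⟩, fun y hy => ?_,
    fun y => ⟨(hC1 y).trans ((le_max_left _ _).trans (le_max_right _ _)), (hC2 y).trans ((le_max_right _ _).trans (le_max_right _ _))⟩⟩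
  · rw [abs_of_nonneg f.nonneg]; exact f.le_one
  · have g : y ∉ tsupport f := by
      rw [f.tsupport_eq, mem_closedBall_zero_iff]
      exact fun h => hy (abs_le.1 h)
    have g1 : y ∉ tsupport (deriv f) := fun h => g (tsupport_deriv_subset h)
    exact ⟨image_eq_zero_of_notMem_tsupport g, image_eq_zero_of_notMem_tsupport g1,
      image_eq_zero_of_notMem_tsupport fun h => g1 (tsupport_deriv_subset h)⟩

structure Trig (s : ℝ) (e g : ℝ → ℝ) : Prop where
  sm : CD e
  de : ∀ y, HasDerivAt e (s * g y) y
  dg : ∀ y, HasDerivAt g (-s * e y) y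
  be : ∀ y, |e y| ≤ 1
  bg : ∀ y, |g y| ≤ 1

theorem trig_cos (s : ℝ) : Trig s (fun y => Real.cos (s * y)) (fun y => - Real.sin (s * y)) := by
  have d : ∀ y, HasDerivAt (fun y => s * y) s y := fun y => by simpa using (hasDerivAt_id y).const_mul s
  refine ⟨by fun_prop, fun y => ?_, fun y => ?_, fun y => Real.abs_cos_le_one _, fun y => by rw [abs_neg]; exact Real.abs_sin_le_one _⟩
  · exact ((Real.hasDerivAt_cos _).comp y (d y)).congr_deriv (by ring)
  · exact ((Real.hasDerivAt_sin _).comp y (d y)).fun_neg.congr_deriv (by ring)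

theorem trig_sin (s : ℝ) : Trig s (fun y => Real.sin (s * y)) (fun y => Real.cos (s * y)) := by
  have d : ∀ y, HasDerivAt (fun y => s * y) s y := fun y => by simpa using (hasDerivAt_id y).const_mul s
  refine ⟨by fun_prop, fun y => ?_, fun y => ?_, fun y => Real.abs_sin_le_one _, fun y => Real.abs_cos_le_one _⟩
  · exact ((Real.hasDerivAt_sin _).comp y (d y)).congr_deriv (by ring)
  · exact ((Real.hasDerivAt_cos _).comp y (d y)).congr_deriv (by ring)

theorem nq_up {q : ℝ} (hq : 1 ≤ q) {F : Fu n} (hF : Measurable F) {G : E (n+1) → ℝ} (τ : ℝ)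
    (h0 : ∀ p, ly p ∉ Set.Icc (-2:ℝ) 2 → G p = 0) (h : ∀ p, |G p| ≤ |F (pr p)|) :
    nq q (Hs τ) G ≤ 4 * nq q (Hs τ) F := by
  have q0 : 0 < q := by linarith
  have mI : MeasurableSet {p : E (n+1) | ly p ∈ Set.Icc (-2:ℝ) 2} := ly_cont.measurable measurableSet_Icc
  have hS : {p : E (n+1) | ly p ∈ Set.Icc (-2:ℝ) 2} ∩ Hs τ = {p | pr p ∈ Hs τ ∧ ly p ∈ Set.Icc (-2:ℝ) 2} := by
    ext p; exact and_comm
  refine (nq_supp mI h0).trans ?_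
  refine (nq_mono (mI.inter (measurableSet_Hs τ)) (G := fun p => F (pr p)) fun p _ => h p).trans ?_
  rw [hS, nq_pr q0 hF τ measurableSet_Icc, Real.volume_Icc]
  refine mul_le_mul' ?_ le_rfl
  have : (4:ℝ≥0∞) ^ (1/q) ≤ 4 ^ (1:ℝ) := rpow_le_rpow_of_exponent_le (by norm_num) (by rw [div_le_one q0]; exact hq)
  norm_num at this ⊢
  exact this

theorem AG (n : ℕ) {δ p : ℝ} (hδ : 0 < δ) (hδ1 : δ ≤ 1) (hp : 2 < p) : ∃ γ : NNReal, 0 < γ ∧ ∀ R0 : ℝ, 0 < R0 → ∃ N : NNReal,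
    ∀ a : E n → Mx n, GEll δ a → LF δ γ a R0 → ∀ u : E n → ℝ, TF u → ∀ τ, ∀ s, 0 ≤ s →
    nq p (Hs τ) (fun q => VV u q + s ^ 2 * |u q|) ≤ N * (nq p (Hs τ) (fun q => Pa a u q - s ^ 2 * u q)
      + oR (1 + s) * nq p (Hs τ) u + ∑ k, nq p (Hs τ) (D (ex k) u)) := by
  obtain ⟨γ, hγ, hPU⟩ := PU (n+1) hδ hp
  obtain ⟨C, hC, ζ, zs, zc, z1, zJ, zI, zC⟩ := cut1
  refine ⟨γ, hγ, fun R0 hR0 => ?_⟩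
  obtain ⟨N, hN⟩ := hPU R0 hR0
  have hp1 : 1 ≤ p := by linarith
  have hp0 : 0 < p := by linarith
  refine ⟨2 * (2 * (N * (4 * (3 * Real.toNNReal C + 1)))), fun a ha hLF u hu τ s hs => ?_⟩
  have mP := Pa_meas ha hu
  have mu := hu.cont.measurable
  set X := nq p (Hs τ) (fun q => Pa a u q - s ^ 2 * u q)
  set U := nq p (Hs τ) u
  set S := ∑ k, nq p (Hs τ) (D (ex k) u)
  set σ := oR (1 + s)
  have σ1 : 1 ≤ σ := by rw [← ofReal_one]; exact ofReal_le_ofReal (by linarith)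
  have zd : ∀ y, HasDerivAt ζ (deriv ζ y) y := fun y => ((zs.differentiable (by simp)) y).hasDerivAt
  have zs' : CD (deriv ζ) := ContDiff.iterate_deriv 1 zs
  have zd' : ∀ y, HasDerivAt (deriv ζ) (deriv (deriv ζ) y) y := fun y => ((zs'.differentiable (by simp)) y).hasDerivAt
  have d1 : ∀ {e g : ℝ → ℝ}, Trig s e g → deriv (fun y => ζ y * e y) = fun y => deriv ζ y * e y + s * (ζ y * g y) :=
    fun ht => funext fun y => (((zd y).fun_mul (ht.de y)).congr_deriv (by ring)).deriv
  have d2 : ∀ {e g : ℝ → ℝ}, Trig s e g → deriv (deriv (fun y => ζ y * e y)) =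
      fun y => deriv (deriv ζ) y * e y + 2 * s * (deriv ζ y * g y) - s ^ 2 * (ζ y * e y) := by
    intro e g ht
    rw [d1 ht]
    exact funext fun y => ((((zd' y).fun_mul (ht.de y)).fun_add (((zd y).fun_mul (ht.dg y)).const_mul s)).congr_deriv (by ring)).deriv
  have side : ∀ {e g : ℝ → ℝ}, Trig s e g → nq p (Hs τ) (VV (UU u fun y => ζ y * e y)) ≤
      N * (4 * ((3 * oR C + 1) * (X + σ * U + S))) := by
    intro e g ht
    set φ : ℝ → ℝ := fun y => ζ y * e y
    have hφ : CD φ := zs.mul ht.sm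
    have hφ' : CD (deriv φ) := ContDiff.iterate_deriv 1 hφ
    have hT := UU_TF hu hφ (zc.mul_right (f' := e))
    refine (hN _ (ha.hat hδ hδ1) (hLF.hat hδ hδ1 ha) _ hT τ).trans (mul_le_mul' le_rfl ?_)
    have be := ht.be
    have bg := ht.bg
    have bφ : ∀ y, |φ y| ≤ 1 := fun y => by
      simp only [φ, abs_mul]; exact mul_le_one₀ (z1 y) (abs_nonneg _) (be y)
    have bm : ∀ {x y c : ℝ}, |x| ≤ c → |y| ≤ 1 → |x * y| ≤ c := fun {x y c} hx hy => by
      rw [abs_mul]; nlinarith [abs_nonneg x, abs_nonneg y]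
    have q1 : nq p (Hs τ) (Pa (fun p : E (n+1) => hat (a (pr p))) (UU u φ)) ≤
        4 * nq p (Hs τ) (fun q => |Pa a u q - s ^ 2 * u q| + (2 * C * (1 + s)) * |u q|) := by
      refine nq_up hp1 ((mP.sub (mu.const_mul _)).abs.add (mu.abs.const_mul _)) τ (fun p hp => ?_) fun p => ?_
      · obtain ⟨g1, g2, g3⟩ := zI _ hp
        rw [UU_Pa hu.sm hφ hφ', d2 ht]; simp [φ, g1, g2, g3]
      · have e1 : Pa (fun p : E (n+1) => hat (a (pr p))) (UU u φ) p = (Pa a u (pr p) - s ^ 2 * u (pr p)) * φ (ly p) +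
            u (pr p) * (deriv (deriv ζ) (ly p) * e (ly p) + 2 * s * (deriv ζ (ly p) * g (ly p))) := by
          rw [UU_Pa hu.sm hφ hφ', d2 ht]; simp only [φ]; ring
        have C0 : 0 < C := by linarith
        have r0 : 0 ≤ |Pa a u (pr p) - s ^ 2 * u (pr p)| + (2 * C * (1 + s)) * |u (pr p)| := by positivity
        refine le_trans ?_ (le_abs_self (|Pa a u (pr p) - s ^ 2 * u (pr p)| + (2 * C * (1 + s)) * |u (pr p)|))
        rw [e1]
        refine (abs_add_le _ _).trans (add_le_add (bm le_rfl (bφ _)) ?_)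
        rw [abs_mul, mul_comm]
        refine mul_le_mul_of_nonneg_right ((abs_add_le _ _).trans ?_) (abs_nonneg _)
        have i1 := bm (zC (ly p)).2 (be (ly p))
        have i2 := bm (zC (ly p)).1 (bg (ly p))
        rw [abs_mul (2 * s), abs_of_nonneg (by positivity : 0 ≤ 2 * s)]
        nlinarith
    have q2 : nq p (Hs τ) (G1 (UU u φ)) ≤ 4 * nq p (Hs τ) (fun q => G1 u q + (C * (1 + s)) * |u q|) := by
      refine nq_up hp1 ((G1_meas hu).add (mu.abs.const_mul _)) τ (fun p hp => ?_) fun p => ?_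
      · obtain ⟨g1, g2, g3⟩ := zI _ hp
        rw [UU_G1 hu.sm hφ, d1 ht]; simp [φ, g1, g2]
      · have hG := G1_nonneg u (pr p)
        refine le_trans ?_ (le_abs_self (G1 u (pr p) + (C * (1 + s)) * |u (pr p)|))
        rw [abs_of_nonneg (G1_nonneg _ _), UU_G1 hu.sm hφ, d1 ht]
        refine add_le_add (mul_le_of_le_one_right hG (bφ _)) ?_
        rw [mul_comm]
        refine mul_le_mul_of_nonneg_right ((abs_add_le _ _).trans ?_) (abs_nonneg _)
        have i1 := bm (zC (ly p)).1 (be (ly p))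
        have i2 := bm (z1 (ly p)) (bg (ly p))
        rw [abs_mul s, abs_of_nonneg hs]
        nlinarith
    refine (add_le_add q1 q2).trans ?_
    rw [← mul_add]
    refine mul_le_mul' le_rfl ?_
    have r1 : nq p (Hs τ) (fun q => |Pa a u q - s ^ 2 * u q| + (2 * C * (1 + s)) * |u q|) ≤ X + 2 * oR C * σ * U := by
      refine (nq_add hp1 (mP.sub (mu.const_mul _)).abs (mu.abs.const_mul _)).trans (add_le_add (nq_abs _).le (le_of_eq ?_))
      rw [nq_cmul, nq_abs, abs_of_nonneg (by positivity), ofReal_mul (by positivity), ofReal_mul (by positivity)]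
      simp [σ, U]
    have r2 : nq p (Hs τ) (fun q => G1 u q + (C * (1 + s)) * |u q|) ≤ (U + S) + oR C * σ * U := by
      refine (nq_add hp1 (G1_meas hu) (mu.abs.const_mul _)).trans (add_le_add (nq_G1 hp1 hu) (le_of_eq ?_))
      rw [nq_cmul, nq_abs, abs_of_nonneg (by positivity), ofReal_mul (by positivity)]
    refine (add_le_add r1 r2).trans ?_
    have r3 : U ≤ σ * U := le_mul_of_one_le_left zero_le σ1
    generalize oR C = c
    calc X + 2 * c * σ * U + (U + S + c * σ * U) ≤ X + 2 * c * σ * U + (σ * U + S + c * σ * U) := by gcongr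
      _ ≤ (X + 2 * c * σ * U + (σ * U + S + c * σ * U)) + 3 * c * (X + S) := le_self_add
      _ = (3 * c + 1) * (X + σ * U + S) := by ring
  have hc := side (trig_cos s)
  have hsn := side (trig_sin s)
  set Z := (X + σ * U + S)
  set uc := UU u fun y => ζ y * Real.cos (s * y)
  set us := UU u fun y => ζ y * Real.sin (s * y)
  have Tc : TF uc := UU_TF hu (zs.mul (trig_cos s).sm) (zc.mul_right (f' := fun y => Real.cos (s * y)))
  have Ts : TF us := UU_TF hu (zs.mul (trig_sin s).sm) (zc.mul_right (f' := fun y => Real.sin (s * y)))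
  have lowB : ∀ {e g : ℝ → ℝ}, Trig s e g → ∀ p, ly p ∈ Set.Ioo (-1:ℝ) 1 →
      |e (ly p)| * (VV u (pr p) + s ^ 2 * |u (pr p)|) ≤ VV (UU u fun y => ζ y * e y) p := by
    intro e g ht p hJ
    obtain ⟨g1, g2, g3⟩ := zJ _ hJ
    have hφ : CD (fun y => ζ y * e y) := zs.mul ht.sm
    have hφ' : CD (deriv fun y => ζ y * e y) := ContDiff.iterate_deriv 1 hφ
    have hl : |D (ex (Fin.last _)) (D (ex (Fin.last _)) (UU u fun y => ζ y * e y)) p| = |e (ly p)| * (s ^ 2 * |u (pr p)|) := by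
      rw [UU_l hu.sm hφ, UU_l hu.sm hφ', d2 ht]
      simp only [UU, g1, g2, g3]
      rw [abs_mul, show 0 * e (ly p) + 2 * s * (0 * g (ly p)) - s ^ 2 * (1 * e (ly p)) = - (s^2 * e (ly p)) by ring, abs_neg, abs_mul,
        abs_of_nonneg (sq_nonneg s)]
      ring
    have key : VV (UU u fun y => ζ y * e y) p = (|D et (UU u fun y => ζ y * e y) p| + ∑ j : Ix n, ∑ k : Ix n,
        |D (ex j.castSucc) (D (ex k.castSucc) (UU u fun y => ζ y * e y)) p|)
        + (∑ i : Ix n, |D (ex i.castSucc) (D (ex (Fin.last _)) (UU u fun y => ζ y * e y)) p|)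
        + (∑ i : Ix n, |D (ex (Fin.last _)) (D (ex i.castSucc) (UU u fun y => ζ y * e y)) p|)
        + |D (ex (Fin.last _)) (D (ex (Fin.last _)) (UU u fun y => ζ y * e y)) p| := by
      unfold VV
      rw [Fin.sum_univ_castSucc]
      simp only [Fin.sum_univ_castSucc (n := n+1), Finset.sum_add_distrib]
      ring
    have k2 : |D et (UU u fun y => ζ y * e y) p| + (∑ j : Ix n, ∑ k : Ix n,
        |D (ex j.castSucc) (D (ex k.castSucc) (UU u fun y => ζ y * e y)) p|) = |e (ly p)| * VV u (pr p) := by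
      simp only [UU_t hu.sm hφ, UU_c hu.sm hφ, UU_c (hu.sm.D _) hφ]
      rw [mul_comm]
      simp only [UU, g1, one_mul, abs_mul, VV, add_mul, Finset.sum_mul]
    rw [key, k2, hl, mul_add]
    have p1 : 0 ≤ ∑ i : Ix n, |D (ex i.castSucc) (D (ex (Fin.last _)) (UU u fun y => ζ y * e y)) p| := by positivity
    have p2 : 0 ≤ ∑ i : Ix n, |D (ex (Fin.last _)) (D (ex i.castSucc) (UU u fun y => ζ y * e y)) p| := by positivity
    linarith
  have low : nq p (Hs τ) (fun q => VV u q + s ^ 2 * |u q|) ≤ 2 * (nq p (Hs τ) (VV uc) + nq p (Hs τ) (VV us)) := by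
    have mW : Measurable (fun q => VV u q + s ^ 2 * |u q|) := hu.contV.measurable.add (mu.abs.const_mul _)
    have l1 : nq p (Hs τ) (fun q => VV u q + s ^ 2 * |u q|) ≤ nq p {p | pr p ∈ Hs τ ∧ ly p ∈ Set.Ioo (-1:ℝ) 1}
        (fun p => VV u (pr p) + s ^ 2 * |u (pr p)|) := by
      rw [nq_pr hp0 mW τ measurableSet_Ioo, Real.volume_Ioo]
      refine le_mul_of_one_le_left zero_le (one_le_rpow ?_ (by positivity))
      norm_num
    have hS : MeasurableSet {p : E (n+1) | pr p ∈ Hs τ ∧ ly p ∈ Set.Ioo (-1:ℝ) 1} :=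
      (pr_cont.measurable (measurableSet_Hs τ)).inter (ly_cont.measurable measurableSet_Ioo)
    refine l1.trans ((nq_mono hS (G := fun p => 2 * (VV uc p + VV us p)) fun p hp' => ?_).trans
      ((nq_set (fun p hp' => hp'.1) _).trans (?_ : nq p (Hs τ) _ ≤ _)))
    · have i1 : |Real.cos (s * ly p)| * _ ≤ VV uc p := lowB (trig_cos s) p hp'.2
      have i2 := lowB (trig_sin s) p hp'.2
      have hW : 0 ≤ VV u (pr p) + s ^ 2 * |u (pr p)| := add_nonneg (VV_nonneg _ _) (by positivity)
      have hv1 := VV_nonneg uc p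
      have hv2 := VV_nonneg us p
      rw [abs_of_nonneg hW, abs_of_nonneg (show (0:ℝ) ≤ 2 * (VV uc p + VV us p) by linarith)]
      have tr : 1 ≤ |Real.cos (s * ly p)| + |Real.sin (s * ly p)| := by
        have t1 := Real.abs_cos_le_one (s * ly p)
        have t2 := Real.abs_sin_le_one (s * ly p)
        have t3 := Real.sin_sq_add_cos_sq (s * ly p)
        rw [← sq_abs, ← sq_abs (Real.cos _)] at t3
        nlinarith [abs_nonneg (Real.cos (s * ly p)), abs_nonneg (Real.sin (s * ly p))]
      have := mul_le_mul_of_nonneg_right tr hW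
      rw [add_mul, one_mul] at this
      linarith
    · rw [nq_cmul, abs_of_pos (by norm_num : (0:ℝ) < 2), ofReal_ofNat]
      exact mul_le_mul' le_rfl (nq_add hp1 Tc.contV.measurable Ts.contV.measurable)
  refine low.trans ?_
  push_cast
  have := add_le_add hc hsn
  refine (mul_le_mul' le_rfl this).trans (le_of_eq ?_)
  rw [← two_mul]
  change _ = 2 * (2 * (↑N * (4 * (3 * oR C + 1)))) * Z
  ring

end

section
variable {n : ℕ}

theorem TF.fin {u : Fu n} (hu : TF u) (q : ℝ) (S : Set (E n)) : nq q S u ≠ ⊤ :=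
  ((hu.cont.memLp_of_hasCompactSupport hu.cs).restrict S).eLpNorm_ne_top

theorem LpN {p : ℝ} (hp : 0 < p) {f : Fu n} (hf : Measurable f) (s : Set (E n)) :
    LpNormOn p s f = (nq p s f).toReal := by
  unfold LpNormOn
  rw [nq_eq hp, ← toReal_rpow, integral_eq_lintegral_of_nonneg_ae (Filter.Eventually.of_forall fun _ => by positivity)
    ((hf.abs.pow_const p).aestronglyMeasurable)]
  congr 2
  refine lintegral_congr fun x => ?_
  rw [← ofReal_rpow_of_nonneg (abs_nonneg _) hp.le, ← Real.norm_eq_abs, ofReal_norm]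

theorem zer {t0 : ℝ} {g : Fu n} (hg : Sm g) (h : ∀ q : E n, t0 ≤ q.1 → g q = 0) (v : E n) :
    ∀ q : E n, t0 ≤ q.1 → D v g q = 0 := by
  intro q hq
  have h1 : ∀ z ∈ {z : E n | t0 < z.1}, D v g z = 0 := fun z hz => by
    rw [D_congr (g := fun _ => 0) (isOpen_lt continuous_const continuous_fst) (fun p hp => h p (le_of_lt hp)) v z hz]
    simp [D]
  have hc : Continuous fun ε : ℝ => D v g (q.1 + ε, q.2) := (hg.D v).cont.comp (by fun_prop)
  have h2 : Set.EqOn (fun ε : ℝ => D v g (q.1 + ε, q.2)) (fun _ => 0) (closure (Set.Ioi 0)) :=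
    Set.EqOn.closure (fun ε hε => h1 _ (by change t0 < q.1 + ε; have : 0 < ε := hε; linarith)) hc continuous_const
  rw [closure_Ioi] at h2
  simpa using h2 (Set.self_mem_Ici (a := (0:ℝ)))

noncomputable def LL (a : E n → Mx n) (b : E n → Ix n → ℝ) (c : Fu n) (lam : ℝ)
    (u : Fu n) (q : E n) : ℝ := Pa a u q + (∑ j, b q j * D (ex j) u q) + c q * u q - lam * u q

theorem low_bd {b : E n → Ix n → ℝ} {c : Fu n} {K : ℝ} (hb : ∀ q j, |b q j| ≤ K) (hc : ∀ q, |c q| ≤ K)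
    (u : Fu n) (q : E n) : |(∑ j, b q j * D (ex j) u q) + c q * u q| ≤ K * G1 u q := by
  unfold G1
  rw [mul_add, Finset.mul_sum, add_comm]
  refine (abs_add_le _ _).trans (add_le_add ?_ ((Finset.abs_sum_le_sum_abs _ _).trans (Finset.sum_le_sum fun j _ => ?_)))
  · rw [abs_mul]; exact mul_le_mul_of_nonneg_right (hc q) (abs_nonneg _)
  · rw [abs_mul]; exact mul_le_mul_of_nonneg_right (hb q j) (abs_nonneg _)

theorem LL_meas {δ : ℝ} {a : E n → Mx n} (ha : GEll δ a) {b : E n → Ix n → ℝ} {c : Fu n}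
    (mb : ∀ j, Measurable fun q => b q j) (mc : Measurable c) (lam : ℝ) {u : Fu n} (hu : TF u) : Measurable (LL a b c lam u) := by
  unfold LL
  exact (((Pa_meas ha hu).add (Finset.measurable_sum _ fun j _ => (mb j).mul (hu.D (ex j)).cont.measurable)).add
    (mc.mul hu.cont.measurable)).sub (hu.cont.measurable.const_mul lam)

theorem interp {p μ : ℝ} (hp : 1 ≤ p) (hμ : 0 < μ) {u : Fu n} (hu : TF u) (τ : ℝ) (k) :
    (nq p (Hs τ) (D (ex k) u)).toReal ≤ 2 / μ * (nq p (Hs τ) u).toReal + μ * (nq p (Hs τ) (VV u)).toReal := by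
  have h := grad_bd hp hu (μ • ex k) (measurableSet_Hs τ) (measurableSet_Hs τ) subset_rfl (fun s _ z hz => by
    simpa [Hs, ex] using hz)
  have e2 : D (μ • ex k) (D (μ • ex k) u) = fun q => μ * (μ * Dd k k u q) := by
    rw [D_smul, D_smul]; funext q; rw [D_cmul]; exact (hu.D _).sm
  rw [e2, D_smul, nq_cmul, nq_cmul, nq_cmul, abs_of_pos hμ] at h
  have m : nq p (Hs τ) (Dd k k u) ≤ nq p (Hs τ) (VV u) := nq_mono (measurableSet_Hs τ) fun z _ => by
    rw [abs_of_nonneg (VV_nonneg u z)]; exact VV_exr u z k k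
  have f1 := hu.fin p (Hs τ)
  have f2 := (hu.D (ex k)).fin p (Hs τ)
  have f3 : nq p (Hs τ) (VV u) ≠ ⊤ := hu.memV.eLpNorm_ne_top
  have h' := h.trans (add_le_add le_rfl (mul_le_mul' le_rfl (mul_le_mul' le_rfl m)))
  have h2 := toReal_mono (by finiteness) h'
  rw [toReal_add (by finiteness) (by finiteness)] at h2
  simp only [toReal_mul, toReal_ofReal hμ.le, toReal_ofNat] at h2
  have : μ * (nq p (Hs τ) (D (ex k) u)).toReal ≤ μ * (2 / μ * (nq p (Hs τ) u).toReal + μ * (nq p (Hs τ) (VV u)).toReal) := by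
    refine h2.trans (le_of_eq ?_)
    field_simp
  exact le_of_mul_le_mul_left this hμ

theorem core (n : ℕ) (hn : 1 ≤ n) {δ : ℝ} (hδ : 0 < δ) (hδ1 : δ ≤ 1) {K : ℝ} (hK : 0 < K) {p : ℝ} (hp : 2 < p)
    {ω : ℝ → ℝ} (hω : ContinuousOn ω (Set.Ici 0)) (hω0 : ω 0 = 0) : ∃ s0 N : ℝ, 0 ≤ s0 ∧ 0 ≤ N ∧
    ∀ (a : E n → Mx n) (b : E n → Ix n → ℝ) (c : Fu n), GEll δ a →
    (∀ j, Measurable fun q => b q j) → Measurable c → (∀ q j, |b q j| ≤ K) → (∀ q, |c q| ≤ K) →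
    (∀ R : ℝ, 0 ≤ R → aSharp a R ≤ ω R) → ∀ s, s0 ≤ s → ∀ u, TF u →
    nq p (Hs 0) (LL a b c (s ^ 2) u) ≠ ⊤ ∧ nq p (Hs 0) (fun q => VV u q + s ^ 2 * |u q|) ≠ ⊤ ∧
    (nq p (Hs 0) (fun q => VV u q + s ^ 2 * |u q|)).toReal ≤ N * (nq p (Hs 0) (LL a b c (s ^ 2) u)).toReal := by
  obtain ⟨γ, hγ, hAG⟩ := AG n hδ hδ1 hp
  obtain ⟨R0, hR0, hfr⟩ := freeze n hn hδ hω hω0 hγ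
  obtain ⟨N, hN⟩ := hAG R0 hR0
  have hp1 : 1 ≤ p := by linarith
  set A : ℝ := N * (1 + K) * (n + 1)
  have A0 : 0 ≤ A := by positivity
  set μ : ℝ := 1 / (4 * (A + 1))
  have hμ : 0 < μ := by positivity
  have Aμ : A * μ ≤ 1 / 4 := by
    simp only [μ]; rw [mul_one_div, div_le_div_iff₀ (by positivity) (by norm_num)]; linarith
  set B : ℝ := N * (1 + K) + A * (2 / μ)
  have B0 : 0 ≤ B := by positivity
  refine ⟨4 * (B + N) + 4, 2 * N, by positivity, by positivity, fun a b c ha mb mc hb hc hs s hs0 u hu => ?_⟩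
  have N0 : (0:ℝ) ≤ N := N.2
  have s1 : 1 ≤ s := by linarith
  have s00 : 0 ≤ s := by linarith
  have mL := LL_meas ha mb mc (s ^ 2) hu
  have mu := hu.cont.measurable
  have mV := hu.contV.measurable
  have mG := G1_meas hu
  have fU := hu.fin p (Hs 0)
  have fV : nq p (Hs 0) (VV u) ≠ ⊤ := hu.memV.eLpNorm_ne_top
  have fS : ∑ k, nq p (Hs 0) (D (ex k) u) ≠ ⊤ := ENNReal.sum_ne_top.2 fun k _ => (hu.D (ex k)).fin _ _
  have hG := nq_G1 (S := Hs 0) hp1 hu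
  have fG : nq p (Hs 0) (G1 u) ≠ ⊤ := ne_top_of_le_ne_top (by finiteness) hG
  have lb := low_bd hb hc u
  have fX : nq p (Hs 0) (LL a b c (s ^ 2) u) ≠ ⊤ := by
    refine ne_top_of_le_ne_top ?_ ((nq_mono (measurableSet_Hs 0) (G := fun q => (1 + δ⁻¹) * VV u q + (K + s ^ 2) * G1 u q)
      fun z _ => ?_).trans (nq_add hp1 (mV.const_mul _) (mG.const_mul _)))
    · rw [nq_cmul, nq_cmul]; finiteness
    · refine le_trans ?_ (le_abs_self _)
      have e : LL a b c (s ^ 2) u z = Pa a u z + ((∑ j, b z j * D (ex j) u z) + c z * u z) - s ^ 2 * u z := by unfold LL; ring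
      rw [e]
      refine (abs_sub _ _).trans ?_
      have i1 := abs_add_le (Pa a u z) ((∑ j, b z j * D (ex j) u z) + c z * u z)
      have i2 := Pa_le hδ ha u z
      have i3 : |s ^ 2 * u z| ≤ s ^ 2 * G1 u z := by
        rw [abs_mul, abs_of_nonneg (sq_nonneg s)]
        refine mul_le_mul_of_nonneg_left ?_ (sq_nonneg s)
        unfold G1
        have : 0 ≤ ∑ k, |D (ex k) u z| := by positivity
        linarith
      have := lb z
      linarith
  have fW : nq p (Hs 0) (fun q => VV u q + s ^ 2 * |u q|) ≠ ⊤ := by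
    refine ne_top_of_le_ne_top ?_ (nq_add hp1 mV (mu.abs.const_mul _))
    rw [nq_cmul, nq_abs]; finiteness
  refine ⟨fX, fW, ?_⟩
  have hP : nq p (Hs 0) (fun q => Pa a u q - s ^ 2 * u q) ≤ nq p (Hs 0) (LL a b c (s ^ 2) u) +
      oR K * (nq p (Hs 0) u + ∑ k, nq p (Hs 0) (D (ex k) u)) := by
    refine (nq_mono (measurableSet_Hs 0) (G := fun q => |LL a b c (s ^ 2) u q| + K * G1 u q) fun z _ => ?_).trans
      ((nq_add hp1 mL.abs (mG.const_mul _)).trans (add_le_add (nq_abs _).le ?_))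
    · refine le_trans ?_ (le_abs_self _)
      have e : Pa a u z - s ^ 2 * u z = LL a b c (s ^ 2) u z - ((∑ j, b z j * D (ex j) u z) + c z * u z) := by unfold LL; ring
      rw [e]
      exact (abs_sub _ _).trans (add_le_add le_rfl (lb z))
    · rw [nq_cmul, abs_of_pos hK]; exact mul_le_mul' le_rfl hG
  have main := (hN a ha (hfr a ha hs) u hu 0 s s00).trans (mul_le_mul' le_rfl (add_le_add (add_le_add hP le_rfl) le_rfl))
  have hVW : nq p (Hs 0) (VV u) ≤ nq p (Hs 0) (fun q => VV u q + s ^ 2 * |u q|) := nq_mono (measurableSet_Hs 0) fun z _ => by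
    have := VV_nonneg u z
    rw [abs_of_nonneg this]
    refine le_trans ?_ (le_abs_self _)
    have : 0 ≤ s ^ 2 * |u z| := by positivity
    linarith
  have hUW : oR (s ^ 2) * nq p (Hs 0) u ≤ nq p (Hs 0) (fun q => VV u q + s ^ 2 * |u q|) := by
    rw [← abs_of_nonneg (sq_nonneg s), ← nq_cmul]
    refine nq_mono (measurableSet_Hs 0) fun z _ => ?_
    have := VV_nonneg u z
    rw [abs_mul]
    refine le_trans ?_ (le_abs_self _)
    rw [abs_of_nonneg (sq_nonneg s)]
    linarith
  have hI : (∑ k, nq p (Hs 0) (D (ex k) u)).toReal ≤ (n + 1) * (2 / μ * (nq p (Hs 0) u).toReal + μ * (nq p (Hs 0) (VV u)).toReal) := by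
    rw [toReal_sum fun k _ => (hu.D (ex k)).fin _ _]
    refine (Finset.sum_le_sum fun k _ => interp hp1 hμ hu 0 k).trans (le_of_eq ?_)
    simp [mul_add]
  generalize nq p (Hs 0) (LL a b c (s ^ 2) u) = X at *
  generalize nq p (Hs 0) (fun q => VV u q + s ^ 2 * |u q|) = W at *
  generalize nq p (Hs 0) (VV u) = V at *
  generalize nq p (Hs 0) u = U at *
  generalize ∑ k, nq p (Hs 0) (D (ex k) u) = S at *
  have r1 := toReal_mono (by finiteness) main
  have r2 := toReal_mono fW hVW
  have r3 := toReal_mono fW hUW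
  rw [toReal_mul, toReal_add (by finiteness) (by finiteness), toReal_add (by finiteness) (by finiteness),
    toReal_add (by finiteness) (by finiteness), toReal_mul, toReal_mul,
    toReal_add (by finiteness) (by finiteness), toReal_ofReal hK.le, toReal_ofReal (by linarith)] at r1
  rw [toReal_mul, toReal_ofReal (sq_nonneg s)] at r3
  have U0 : 0 ≤ U.toReal := toReal_nonneg
  have W0 : 0 ≤ W.toReal := toReal_nonneg
  change _ ≤ (N:ℝ) * _ at r1
  generalize X.toReal = X at *
  generalize W.toReal = W at *
  generalize V.toReal = V at *
  generalize U.toReal = U at *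
  generalize S.toReal = S at *
  have k1 : N * (1 + K) * S ≤ A * (2 / μ) * U + (1 / 4) * W := by
    have : N * (1 + K) * S ≤ N * (1 + K) * ((n + 1) * (2 / μ * U + μ * V)) := mul_le_mul_of_nonneg_left hI (by positivity)
    have h2 : (A * μ) * V ≤ (A * μ) * W := mul_le_mul_of_nonneg_left r2 (by positivity)
    have h3 : (A * μ) * W ≤ 1 / 4 * W := mul_le_mul_of_nonneg_right Aμ W0
    have h4 : N * (1 + K) * ((n + 1) * (2 / μ * U + μ * V)) = A * (2 / μ) * U + A * μ * V := by simp only [A]; ring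
    linarith
  have k2 : (B + N * s) * U ≤ 1 / 4 * W := by
    have h1 : B + N * s ≤ 1 / 4 * s ^ 2 := by nlinarith
    have := mul_le_mul_of_nonneg_right h1 U0
    linarith
  have k3 : N * (X + K * (U + S) + (1 + s) * U + S) = N * X + N * (1 + K) * U + N * s * U + N * (1 + K) * S := by ring
  have k4 : (B + N * s) * U = N * (1 + K) * U + A * (2 / μ) * U + N * s * U := by simp only [B]; ring
  linarith

end

theorem stmt16 (n : ℕ) (hn : 1 ≤ n) (δ : ℝ) (hδ : δ ∈ Set.Ioo (0 : ℝ) 1)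
    (K : ℝ) (hK : 0 < K) (p : ℝ) (hp : 2 < p)
    (ω : ℝ → ℝ) (hω : ContinuousOn ω (Set.Ici 0)) (hω0 : ω 0 = 0) :
    ∃ lam₀ N : ℝ, 0 ≤ lam₀ ∧ 0 < N ∧
      ∀ T : ℝ≥0∞, 0 < T →
        ∀ (a : ℝ × (Fin (n + 1) → ℝ) → Fin (n + 1) → Fin (n + 1) → ℝ)
          (b : ℝ × (Fin (n + 1) → ℝ) → Fin (n + 1) → ℝ)
          (c : ℝ × (Fin (n + 1) → ℝ) → ℝ),
          (∀ j k, Measurable fun q => a q j k) →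
          (∀ j, Measurable fun q => b q j) → Measurable c →
          (∀ q j k, a q j k = a q k j) →
          (∀ q j, |b q j| ≤ K) → (∀ q, |c q| ≤ K) →
          (∀ (q : ℝ × (Fin (n + 1) → ℝ)) (θ : Fin (n + 1) → ℝ),
            δ * ∑ j, (θ j) ^ 2 ≤ ∑ j, ∑ k, a q j k * θ j * θ k ∧
            ∑ j, ∑ k, a q j k * θ j * θ k ≤ δ⁻¹ * ∑ j, (θ j) ^ 2) →
          (∀ R : ℝ, 0 ≤ R → aSharp a R ≤ ω R) →
          ∀ lam : ℝ, lam₀ ≤ lam →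
            ∀ u : ℝ × (Fin (n + 1) → ℝ) → ℝ, ContDiff ℝ (⊤ : ℕ∞) u → HasCompactSupport u →
              (∀ q : ℝ × (Fin (n + 1) → ℝ), T ≤ ENNReal.ofReal q.1 → u q = 0) →
              lam * LpNormOn p (OmegaT (n + 1) T) u
                  + LpNormOn p (OmegaT (n + 1) T)
                      (fun q => Real.sqrt (∑ j, ∑ k, (pdxx j k u q) ^ 2))
                  + LpNormOn p (OmegaT (n + 1) T) (pdt u)
                ≤ N * LpNormOn p (OmegaT (n + 1) T) (fun q =>
                    pdt u q + (∑ j, ∑ k, a q j k * pdxx j k u q)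
                      + (∑ j, b q j * pdx j u q) + c q * u q - lam * u q) := by
  obtain ⟨s0, N, hs0, hN, H⟩ := core n hn hδ.1 hδ.2.le hK hp hω hω0
  refine ⟨s0 ^ 2, 3 * N + 1, sq_nonneg _, by linarith, fun T hT a b c ma mb mc sy hb hc el hs lam hlam u us uc u0 => ?_⟩
  have hp1 : 1 ≤ p := by linarith
  have hp0 : 0 < p := by linarith
  have hu : TF u := ⟨us, uc⟩
  have ha : GEll δ a := ⟨ma, fun q => ⟨sy q, fun θ => (el q θ).1, fun θ => (el q θ).2⟩⟩
  have l0 : 0 ≤ lam := (sq_nonneg s0).trans hlam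
  have hsq : Real.sqrt lam ^ 2 = lam := Real.sq_sqrt l0
  obtain ⟨fX, fW, hm⟩ := H a b c ha mb mc hb hc hs (Real.sqrt lam) (Real.le_sqrt_of_sq_le hlam) u hu
  rw [hsq] at fX fW hm
  have mL := LL_meas ha mb mc lam hu
  change lam * LpNormOn p (OmegaT (n + 1) T) u + LpNormOn p (OmegaT (n + 1) T)
    (fun q => Real.sqrt (∑ j, ∑ k, (D (ex j) (D (ex k) u) q) ^ 2)) + LpNormOn p (OmegaT (n + 1) T) (D et u)
    ≤ (3 * N + 1) * LpNormOn p (OmegaT (n + 1) T) (LL a b c lam u)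
  have mq : Measurable (fun q => Real.sqrt (∑ j, ∑ k, (D (ex j) (D (ex k) u) q) ^ 2)) :=
    (Finset.measurable_sum _ fun j _ => Finset.measurable_sum _ fun k _ =>
      ((hu.D (ex k)).D (ex j)).cont.measurable.pow_const 2).sqrt
  rw [LpN hp0 hu.cont.measurable, LpN hp0 mq, LpN hp0 (hu.D et).cont.measurable, LpN hp0 mL]
  have hsub : OmegaT (n + 1) T ⊆ (Hs 0 : Set (E n)) := fun q hq => hq.1
  have mS : MeasurableSet {q : E n | ENNReal.ofReal q.1 < T} := measurableSet_lt (by fun_prop) measurable_const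
  have hX : nq p (Hs 0) (LL a b c lam u) ≤ nq p (OmegaT (n + 1) T) (LL a b c lam u) := by
    have e : {q : E n | ENNReal.ofReal q.1 < T} ∩ Hs 0 = OmegaT (n + 1) T := by ext q; exact and_comm
    rw [← e]
    refine nq_supp mS fun z hz => ?_
    have hz' : T ≤ ENNReal.ofReal z.1 := not_lt.1 hz
    have z0 : ∀ q : E n, z.1 ≤ q.1 → u q = 0 := fun q hq => u0 q (hz'.trans (ofReal_le_ofReal hq))
    have z1 : ∀ v : E n, ∀ q : E n, z.1 ≤ q.1 → D v u q = 0 := fun v => zer hu.sm z0 v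
    have z2 : ∀ v w : E n, D v (D w u) z = 0 := fun v w => zer (hu.D w).sm (z1 w) v z le_rfl
    simp [LL, Pa, z0 z le_rfl, z1 _ z le_rfl, z2]
  have fX' : nq p (OmegaT (n + 1) T) (LL a b c lam u) ≠ ⊤ := ne_top_of_le_ne_top fX (nq_set hsub _)
  have rX := toReal_mono fX' hX
  have cmp : ∀ F : E n → ℝ, (∀ z, |F z| ≤ VV u z + lam * |u z|) →
      (nq p (OmegaT (n + 1) T) F).toReal ≤ (nq p (Hs 0) (fun q => VV u q + lam * |u q|)).toReal := fun F hF =>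
    toReal_mono fW ((nq_set hsub _).trans (nq_mono (measurableSet_Hs 0) fun z _ => (hF z).trans (le_abs_self _)))
  have lu : ∀ z, 0 ≤ lam * |u z| := fun z => mul_nonneg l0 (abs_nonneg _)
  have c1 := cmp (fun z => lam * u z) fun z => by
    have := VV_nonneg u z
    rw [abs_mul, abs_of_nonneg l0]; linarith
  rw [nq_cmul, toReal_mul, abs_of_nonneg l0, toReal_ofReal l0] at c1
  have c2 := cmp (fun q => Real.sqrt (∑ j, ∑ k, (D (ex j) (D (ex k) u) q) ^ 2)) fun z => by
    rw [abs_of_nonneg (Real.sqrt_nonneg _)]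
    have v0 := VV_nonneg u z
    refine le_trans (Real.sqrt_le_iff.2 ⟨v0, ?_⟩) (le_add_of_nonneg_right (lu z))
    have : ∑ j, ∑ k, (D (ex j) (D (ex k) u) z) ^ 2 ≤ ∑ j, ∑ k, |D (ex j) (D (ex k) u) z| * VV u z :=
      Finset.sum_le_sum fun j _ => Finset.sum_le_sum fun k _ => by
        rw [← sq_abs, sq]; exact mul_le_mul_of_nonneg_left (VV_exr u z j k) (abs_nonneg _)
    refine this.trans ?_
    simp only [← Finset.sum_mul]
    rw [sq]
    refine mul_le_mul_of_nonneg_right ?_ v0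
    rw [VV]; exact le_add_of_nonneg_left (abs_nonneg _)
  have c3 := cmp (D et u) fun z => by
    have : 0 ≤ ∑ j, ∑ k, |D (ex j) (D (ex k) u) z| := by positivity
    have := lu z
    rw [VV]; linarith
  have x0 : 0 ≤ (nq p (OmegaT (n + 1) T) (LL a b c lam u)).toReal := toReal_nonneg
  have := mul_le_mul_of_nonneg_left rX hN
  linarith
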